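/- Superhedging Theorem (nondominated, with options): Assume NA(𝒫) holds and let f : Ω → ℝ be upper semianalytic. Then the minimal superhedging price π(f) := inf{x ∈ ℝ : ∃(H,h) ∈ ℋ × ℝ^e with x + (H·S)_T + hg ≥ f 𝒫-q.s.} satisfies π(f) = sup_{Q∈𝒬} E_Q[f] ∈ (−∞, ∞], and there exist (H,h) ∈ ℋ × ℝ^e such that π(f) + (H·S)_T + hg ≥ f 𝒫-q.s. -/

import Mathlib

open MeasureTheory Set Filter Topology
open scoped ENNReal NNReal

noncomputable section

namespace BN

/-- The universal completion of the ambient measurable structure on `α`: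
a set is measurable iff it is null-measurable for every probability measure. -/
def univComp (α : Type*) [MeasurableSpace α] : MeasurableSpace α where
  MeasurableSet' s := ∀ μ : Measure α, IsProbabilityMeasure μ → NullMeasurableSet s μ
  measurableSet_empty := fun _ _ => MeasurableSet.empty.nullMeasurableSet
  measurableSet_compl := fun _ hs μ hμ => (hs μ hμ).compl
  measurableSet_iUnion := fun _ hf μ hμ => NullMeasurableSet.iUnion fun i => hf i μ hμ

/-- `N` is `PP`-polar: it is contained in an `m`-measurable set which is null under
every `P ∈ PP`. -/
def IsPolar {α : Type*} [MeasurableSpace α] (PP : Set (Measure α)) (m : MeasurableSpace α)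
    (N : Set α) : Prop :=
  ∃ A : Set α, MeasurableSet[m] A ∧ N ⊆ A ∧ ∀ P ∈ PP, P A = 0

/-- A property holds `PP`-quasi surely if its complement is `PP`-polar. -/
def QuasiSure {α : Type*} [mα : MeasurableSpace α] (PP : Set (Measure α))
    (m : MeasurableSpace α) (p : α → Prop) : Prop :=
  @IsPolar α mα PP m {ω | ¬ p ω}

/-- Expectation of a real random variable, with the convention
`E[f] = E[f⁺] - E[f⁻]` and `∞ - ∞ = -∞` (which holds in `EReal`). -/
def expec {α : Type*} [MeasurableSpace α] (Q : Measure α) (f : α → ℝ) : EReal :=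
  ((∫⁻ x, ENNReal.ofReal (f x) ∂Q : ℝ≥0∞) : EReal)
    - ((∫⁻ x, ENNReal.ofReal (-f x) ∂Q : ℝ≥0∞) : EReal)

/-- Positive part of an extended real, valued in `ℝ≥0∞`. -/
def posE (x : EReal) : ℝ≥0∞ := if x = ⊤ then ⊤ else ENNReal.ofReal x.toReal

/-- Expectation of an extended-real random variable, with the convention
`E[f] = E[f⁺] - E[f⁻]` and `∞ - ∞ = -∞`. -/
def eexpec {α : Type*} [MeasurableSpace α] (Q : Measure α) (f : α → EReal) : EReal :=
  ((∫⁻ x, posE (f x) ∂Q : ℝ≥0∞) : EReal) - ((∫⁻ x, posE (-(f x)) ∂Q : ℝ≥0∞) : EReal)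

/-- A real-valued function is upper semianalytic if all its strict superlevel sets
are analytic. -/
def UpperSemianalytic {α : Type*} [TopologicalSpace α] (f : α → ℝ) : Prop :=
  ∀ c : ℝ, AnalyticSet {x | c < f x}

/-- An extended-real-valued function is upper semianalytic if all its strict
superlevel sets `{f > c}`, `c ∈ ℝ`, are analytic. -/
def UpperSemianalyticE {α : Type*} [TopologicalSpace α] (f : α → EReal) : Prop :=
  ∀ c : ℝ, AnalyticSet {x | (c : EReal) < f x}

/-- Convexity of a set of probability measures. -/
def ConvexPM {α : Type*} [MeasurableSpace α] (C : Set (ProbabilityMeasure α)) : Prop :=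
  ∀ μ ∈ C, ∀ ν ∈ C, ∀ a b : ℝ≥0∞, a + b = 1 →
    ∀ ξ : ProbabilityMeasure α, (ξ : Measure α) = a • (μ : Measure α) + b • (ν : Measure α) →
      ξ ∈ C

/-! ### The general (non-Polish) setting of Section 2 -/

section General

variable {Ω : Type*} [MeasurableSpace Ω]

/-- Predictability of a trading strategy `H` with respect to a filtration `F`:
the holding `H (u+1)` over the period `(u, u+1]` is `F u`-measurable. -/
def PredictableF (F : ℕ → MeasurableSpace Ω) (T d : ℕ) (H : ℕ → Ω → Fin d → ℝ) : Prop :=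
  ∀ u : ℕ, u < T → Measurable[F u] (H (u + 1))

/-- The final gain `(H · S)_T` from trading `H` in the stocks `S`. -/
def gainF {d : ℕ} (S : ℕ → Ω → Fin d → ℝ) (H : ℕ → Ω → Fin d → ℝ) (T : ℕ) (ω : Ω) : ℝ :=
  ∑ u : Fin T, ∑ i : Fin d, H (u + 1) ω i * (S (u + 1) ω i - S u ω i)

/-- The no-arbitrage condition `NA(PP)` (no options). -/
def NAF (F : ℕ → MeasurableSpace Ω) (T d : ℕ) (S : ℕ → Ω → Fin d → ℝ)
    (PP : Set (Measure Ω)) : Prop :=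
  ∀ H : ℕ → Ω → Fin d → ℝ, PredictableF F T d H →
    QuasiSure PP ‹MeasurableSpace Ω› (fun ω => 0 ≤ gainF S H T ω) →
      QuasiSure PP ‹MeasurableSpace Ω› (fun ω => gainF S H T ω = 0)

/-- The cone `𝒞` of claims superreplicable from zero initial capital. -/
def Cset (F : ℕ → MeasurableSpace Ω) (T d : ℕ) (S : ℕ → Ω → Fin d → ℝ) : Set (Ω → ℝ) :=
  {W | ∃ H : ℕ → Ω → Fin d → ℝ, PredictableF F T d H ∧
    ∃ K : Ω → ℝ, Measurable K ∧ (∀ ω, 0 ≤ K ω) ∧ ∀ ω, W ω = gainF S H T ω - K ω}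

/-- The superhedging price (no options), with values in `EReal` (`inf ∅ = +∞`). -/
def superPriceF (F : ℕ → MeasurableSpace Ω) (T d : ℕ) (S : ℕ → Ω → Fin d → ℝ)
    (PP : Set (Measure Ω)) (f : Ω → ℝ) : EReal :=
  sInf ((fun x : ℝ => (x : EReal)) ''
    {x : ℝ | ∃ H : ℕ → Ω → Fin d → ℝ, PredictableF F T d H ∧
      QuasiSure PP ‹MeasurableSpace Ω› (fun ω => f ω ≤ x + gainF S H T ω)})

end General

/-! ### The one-period setting of Section 3 -/

section OnePeriod

variable {Ω : Type*} [MeasurableSpace Ω] {d : ℕ}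

/-- One-period no-arbitrage condition `NA(PP)` for the increment `ΔS`. -/
def NA1 (PP : Set (Measure Ω)) (ΔS : Ω → Fin d → ℝ) : Prop :=
  ∀ y : Fin d → ℝ,
    QuasiSure PP ‹MeasurableSpace Ω› (fun ω => 0 ≤ ∑ i, y i * ΔS ω i) →
      QuasiSure PP ‹MeasurableSpace Ω› (fun ω => ∑ i, y i * ΔS ω i = 0)

/-- The martingale measures dominated by `PP` in the one-period market:
`𝒬 = {Q : Q ⋘ 𝒫, E_Q[ΔS] = 0}`. -/
def Q1set (PP : Set (Measure Ω)) (ΔS : Ω → Fin d → ℝ) : Set (Measure Ω) :=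
  {Q | IsProbabilityMeasure Q ∧ (∃ P ∈ PP, Q ≪ P) ∧
    ∀ i, expec Q (fun ω => ΔS ω i) = 0}

/-- One-period superhedging price, with values in `EReal` (`inf ∅ = +∞`). -/
def superPrice1 (PP : Set (Measure Ω)) (ΔS : Ω → Fin d → ℝ) (f : Ω → ℝ) : EReal :=
  sInf ((fun x : ℝ => (x : EReal)) ''
    {x : ℝ | ∃ H : Fin d → ℝ,
      QuasiSure PP ‹MeasurableSpace Ω› (fun ω => f ω ≤ x + ∑ i, H i * ΔS ω i)})

end OnePeriod

/-! ### The Polish multi-period setting -/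

section Polish

variable (Ω₁ : Type) [MeasurableSpace Ω₁]

/-- Restriction of a path up to time `t`. -/
def restr {T : ℕ} (t : ℕ) (h : t ≤ T) (ω : Fin T → Ω₁) : Fin t → Ω₁ :=
  fun i => ω (Fin.castLE h i)

/-- Universally measurable predictability: `H u` (the holding over `(u, u+1]`)
is a universally measurable function of the first `u` coordinates. -/
def Pred (d : ℕ) (H : (u : ℕ) → (Fin u → Ω₁) → Fin d → ℝ) : Prop :=
  ∀ u : ℕ, @Measurable _ _ (univComp (Fin u → Ω₁)) _ (H u)

/-- The gain `(H · S)_t = ∑_{u=1}^t H_u (S_u - S_{u-1})` up to time `t ≤ T`. -/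
def gain {T d : ℕ} (S : (t : ℕ) → (Fin t → Ω₁) → Fin d → ℝ)
    (H : (u : ℕ) → (Fin u → Ω₁) → Fin d → ℝ) (t : ℕ) (h : t ≤ T) (ω : Fin T → Ω₁) : ℝ :=
  ∑ u : Fin t, ∑ i : Fin d,
    H u (restr Ω₁ u (u.2.le.trans h) ω) i *
      (S (u + 1) (restr Ω₁ (u + 1) (Nat.succ_le_of_lt (u.2.trans_le h)) ω) i
        - S u (restr Ω₁ u (u.2.le.trans h) ω) i)

variable [TopologicalSpace Ω₁] [OpensMeasurableSpace Ω₁]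

/-- The set `PP = {P₀ ⊗ ⋯ ⊗ P_{t-1}}` of measures built from universally
measurable selectors of the one-step collections `𝒫_s(·)`. -/
def MeasFam (Pt : (t : ℕ) → (Fin t → Ω₁) → Set (ProbabilityMeasure Ω₁)) :
    (t : ℕ) → Set (Measure (Fin t → Ω₁))
  | 0 => {μ | μ = Measure.dirac Fin.elim0}
  | (t + 1) => {μ | ∃ ν ∈ MeasFam Pt t, ∃ κ : (Fin t → Ω₁) → ProbabilityMeasure Ω₁,
      @Measurable _ _ (univComp (Fin t → Ω₁)) (borel (ProbabilityMeasure Ω₁)) κ ∧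
      (∀ ω, κ ω ∈ Pt t ω) ∧
      μ = ν.bind (fun ω => Measure.map (Fin.snoc ω) (κ ω : Measure Ω₁))}

/-- The σ-field `ℱ_t` on `Ω = Ω₁^T`: the comap under the restriction map of the
universal completion of the Borel σ-field of `Ω₁^t`. -/
def filtr (T : ℕ) (t : ℕ) (h : t ≤ T) : MeasurableSpace (Fin T → Ω₁) :=
  MeasurableSpace.comap (restr Ω₁ t h) (univComp (Fin t → Ω₁))

/-- `S` is a `Q`-martingale with respect to the filtration `(ℱ_t)`. -/
def IsMartMeas {T d : ℕ} (S : (t : ℕ) → (Fin t → Ω₁) → Fin d → ℝ)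
    (Q : Measure (Fin T → Ω₁)) : Prop :=
  (∀ (t : ℕ) (h : t ≤ T) (i : Fin d), Integrable (fun ω => S t (restr Ω₁ t h ω) i) Q) ∧
  (∀ (t : ℕ) (h : t + 1 ≤ T) (i : Fin d) (A : Set (Fin T → Ω₁)),
    MeasurableSet[filtr Ω₁ T t ((Nat.le_succ t).trans h)] A →
      ∫ ω in A, S (t + 1) (restr Ω₁ (t + 1) h ω) i ∂Q
        = ∫ ω in A, S t (restr Ω₁ t ((Nat.le_succ t).trans h) ω) i ∂Q)

/-- The martingale measures `Q ⋘ PP` consistent with the option prices: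
`𝒬 = {Q ⋘ PP : S is a Q-martingale, E_Q[gⁱ] = 0}`. -/
def QSet {T d e : ℕ} (PP : Set (Measure (Fin T → Ω₁)))
    (S : (t : ℕ) → (Fin t → Ω₁) → Fin d → ℝ) (g : Fin e → (Fin T → Ω₁) → ℝ) :
    Set (Measure (Fin T → Ω₁)) :=
  {Q | IsProbabilityMeasure Q ∧ (∃ P ∈ PP, Q ≪ P) ∧ IsMartMeas Ω₁ S Q ∧
    ∀ i : Fin e, expec Q (g i) = 0}

/-- The no-arbitrage condition `NA(PP)` with semistatic trading in the stocks `S`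
and the options `g`. -/
def NA {T d e : ℕ} (PP : Set (Measure (Fin T → Ω₁)))
    (S : (t : ℕ) → (Fin t → Ω₁) → Fin d → ℝ) (g : Fin e → (Fin T → Ω₁) → ℝ) : Prop :=
  ∀ H : (u : ℕ) → (Fin u → Ω₁) → Fin d → ℝ, Pred Ω₁ d H → ∀ h : Fin e → ℝ,
    QuasiSure PP (univComp (Fin T → Ω₁))
      (fun ω => 0 ≤ gain Ω₁ S H T le_rfl ω + ∑ i, h i * g i ω) →
    QuasiSure PP (univComp (Fin T → Ω₁))
      (fun ω => gain Ω₁ S H T le_rfl ω + ∑ i, h i * g i ω = 0)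

/-- The minimal semistatic superhedging price, valued in `EReal` (`inf ∅ = +∞`). -/
def superPrice {T d e : ℕ} (PP : Set (Measure (Fin T → Ω₁)))
    (S : (t : ℕ) → (Fin t → Ω₁) → Fin d → ℝ) (g : Fin e → (Fin T → Ω₁) → ℝ)
    (f : (Fin T → Ω₁) → ℝ) : EReal :=
  sInf ((fun x : ℝ => (x : EReal)) ''
    {x : ℝ | ∃ H : (u : ℕ) → (Fin u → Ω₁) → Fin d → ℝ, ∃ h : Fin e → ℝ, Pred Ω₁ d H ∧
      QuasiSure PP (univComp (Fin T → Ω₁))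
        (fun ω => f ω ≤ x + gain Ω₁ S H T le_rfl ω + ∑ i, h i * g i ω)})

/-- `f` is replicable by semistatic trading. -/
def Replicable {T d e : ℕ} (PP : Set (Measure (Fin T → Ω₁)))
    (S : (t : ℕ) → (Fin t → Ω₁) → Fin d → ℝ) (g : Fin e → (Fin T → Ω₁) → ℝ)
    (f : (Fin T → Ω₁) → ℝ) : Prop :=
  ∃ x : ℝ, ∃ H : (u : ℕ) → (Fin u → Ω₁) → Fin d → ℝ, ∃ h : Fin e → ℝ, Pred Ω₁ d H ∧
    QuasiSure PP (univComp (Fin T → Ω₁))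
      (fun ω => x + gain Ω₁ S H T le_rfl ω + ∑ i, h i * g i ω = f ω)

/-- The one-period increment `ΔS_{t+1}(ω, ·)` of the stock, given history `ω ∈ Ω_t`. -/
def incr {d : ℕ} (S : (t : ℕ) → (Fin t → Ω₁) → Fin d → ℝ) (t : ℕ) (ω : Fin t → Ω₁)
    (x : Ω₁) : Fin d → ℝ :=
  fun i => S (t + 1) (Fin.snoc ω x) i - S t ω i

/-- The one-step martingale measures `𝒬_t(ω)` dominated by `𝒫_t(ω)`. -/
def Q1fam {d : ℕ} (Pt : (t : ℕ) → (Fin t → Ω₁) → Set (ProbabilityMeasure Ω₁))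
    (S : (t : ℕ) → (Fin t → Ω₁) → Fin d → ℝ) (t : ℕ) (ω : Fin t → Ω₁) :
    Set (ProbabilityMeasure Ω₁) :=
  {Q | (∃ P' ∈ Pt t ω, (Q : Measure Ω₁) ≪ (P' : Measure Ω₁)) ∧
    ∀ i, expec (Q : Measure Ω₁) (fun x => incr Ω₁ S t ω x i) = 0}

/-- `V` is a `Q`-supermartingale with respect to the filtration `(ℱ_t)`:
each `V_t` is `Q`-integrable and `E_Q[V_{t+1} | ℱ_t] ≤ V_t`. -/
def IsSupermart {T : ℕ} (V : ℕ → (Fin T → Ω₁) → ℝ) (Q : Measure (Fin T → Ω₁)) : Prop :=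
  (∀ t : ℕ, t ≤ T → Integrable (V t) Q) ∧
  ∀ (t : ℕ) (h : t + 1 ≤ T) (A : Set (Fin T → Ω₁)),
    MeasurableSet[filtr Ω₁ T t ((Nat.le_succ t).trans h)] A →
      ∫ ω in A, V (t + 1) ω ∂Q ≤ ∫ ω in A, V t ω ∂Q

end Polish

/-! ### Quasi-sure supports -/

/-- The quasi-sure support of a family of measures on `ℝ^d`. -/
def qsSupp {d : ℕ} (Rs : Set (Measure (Fin d → ℝ))) : Set (Fin d → ℝ) :=
  ⋂₀ {A : Set (Fin d → ℝ) | IsClosed A ∧ ∀ R ∈ Rs, R A = 1}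

end BN

namespace BN

/-- Continuous images of the sets `{z ≤ σ}` of the Baire space form a closed family. -/
theorem isClosed_le_image {Z : Type*} [TopologicalSpace Z] [TopologicalSpace.MetrizableSpace Z]
    {φ : (ℕ → ℕ) → Z} (hφ : Continuous φ) :
    IsClosed {p : (ℕ → ℕ) × Z | ∃ z ≤ p.1, φ z = p.2} := by
  apply IsSeqClosed.isClosed
  intro p q hp hpq
  choose z hzle hz using hp
  have h1 : Tendsto (fun k => (p k).1) atTop (𝓝 q.1) := (continuous_fst.tendsto q).comp hpq
  have h2 : Tendsto (fun k => (p k).2) atTop (𝓝 q.2) := (continuous_snd.tendsto q).comp hpq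
  have hb : ∀ i, ∃ b, ∀ k, (p k).1 i ≤ b := fun i => by
    obtain ⟨b, hb⟩ := ((tendsto_pi_nhds.1 h1) i).bddAbove_range
    exact ⟨b, fun k => hb ⟨k, rfl⟩⟩
  choose b hb using hb
  have hK : IsCompact (Set.pi univ fun i => Set.Iic (b i)) :=
    isCompact_univ_pi fun i => (Set.finite_Iic (b i)).isCompact
  obtain ⟨w, -, ψ, hψ, hw⟩ := hK.tendsto_subseq (x := z)
    (fun k i _ => (hzle k i).trans (hb i k))
  refine ⟨w, ?_, ?_⟩
  · exact le_of_tendsto_of_tendsto' hw (h1.comp hψ.tendsto_atTop) fun k => hzle (ψ k)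
  · refine tendsto_nhds_unique ((hφ.tendsto w).comp hw) ?_
    refine (h2.comp hψ.tendsto_atTop).congr fun k => ?_
    simp [hz]

theorem iInter_closure_image_subset {Z : Type*} [TopologicalSpace Z]
    [TopologicalSpace.MetrizableSpace Z] {φ : (ℕ → ℕ) → Z} (hφ : Continuous φ) (n : ℕ → ℕ) :
    ⋂ k : ℕ, closure (φ '' {z | ∀ i < k, z i ≤ n i}) ⊆ φ '' {z | z ≤ n} := by
  let := TopologicalSpace.metrizableSpaceMetric Z
  intro y hy
  have hz : ∀ k : ℕ, ∃ z : ℕ → ℕ, (∀ i < k, z i ≤ n i) ∧ dist (φ z) y < 1 / ((k : ℝ) + 1) := by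
    intro k
    obtain ⟨_, ⟨z, hz, rfl⟩, hd⟩ := Metric.mem_closure_iff.1 (mem_iInter.1 hy k)
      (1 / ((k : ℝ) + 1)) (by positivity)
    exact ⟨z, hz, by rwa [dist_comm]⟩
  choose z hzle hzd using hz
  have hK : IsCompact (Set.pi univ fun i => Set.Iic (n i)) :=
    isCompact_univ_pi fun i => (Set.finite_Iic (n i)).isCompact
  obtain ⟨w, hwK, ψ, hψ, hw⟩ := hK.tendsto_subseq (x := fun k i => min (z k i) (n i))
    (fun k i _ => Set.mem_Iic.2 (min_le_right (z k i) (n i)))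
  have hw' : Tendsto (fun k => z (ψ k)) atTop (𝓝 w) := by
    rw [tendsto_pi_nhds] at hw ⊢
    intro i
    refine (hw i).congr' ?_
    filter_upwards [eventually_gt_atTop i] with k hk
    exact min_eq_left (hzle _ _ (hk.trans_le hψ.le_apply))
  refine ⟨w, fun i => hwK i (mem_univ i), ?_⟩
  refine tendsto_nhds_unique ((hφ.tendsto w).comp hw') ?_
  rw [tendsto_iff_dist_tendsto_zero]
  refine squeeze_zero (fun _ => dist_nonneg) (fun k => (hzd (ψ k)).le) ?_
  exact tendsto_one_div_add_atTop_nhds_zero_nat.comp hψ.tendsto_atTop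

/-- **Capacitability**: the outer measure of a continuous image of the Baire space is approximated
from within by the images of the compact sets `{z ≤ σ}`. -/
theorem exists_lt_measure_le_image {Z : Type*} [TopologicalSpace Z]
    [TopologicalSpace.MetrizableSpace Z] [MeasurableSpace Z] [OpensMeasurableSpace Z]
    {φ : (ℕ → ℕ) → Z} (hφ : Continuous φ) (μ : Measure Z) [IsFiniteMeasure μ] {c : ℝ≥0∞}
    (hc : c < μ (range φ)) : ∃ σ : ℕ → ℕ, c < μ (φ '' {z | z ≤ σ}) := by
  obtain ⟨c', hcc', hc'⟩ := exists_between hc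
  let L : (ℕ → ℕ) → ℕ → Set (ℕ → ℕ) := fun n k => {z | ∀ i < k, z i ≤ n i}
  have step : ∀ (k : ℕ) (s : ℕ → ℕ), c' < μ (φ '' L s k) →
      ∃ m, c' < μ (φ '' L (Function.update s k m) (k + 1)) := by
    intro k s hs
    have hU : φ '' L s k = ⋃ m, φ '' L (Function.update s k m) (k + 1) := by
      rw [← image_iUnion]
      congr 1
      ext z
      simp only [L, mem_ofPred_eq, mem_iUnion]
      constructor
      · intro h
        refine ⟨z k, fun i hi => ?_⟩
        rcases Nat.lt_succ_iff_lt_or_eq.1 hi with h' | rfl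
        · simpa [Function.update_of_ne h'.ne] using h i h'
        · simp
      · rintro ⟨m, h⟩ i hi
        simpa [Function.update_of_ne hi.ne] using h i (by omega)
    have hM : Monotone fun m => φ '' L (Function.update s k m) (k + 1) := by
      intro a b hab
      refine image_mono fun z hz i hi => (hz i hi).trans ?_
      exact (update_le_update_iff.2 ⟨hab, fun j _ => le_rfl⟩ : _ ≤ _) i
    rw [hU, hM.measure_iUnion, lt_iSup_iff] at hs
    exact hs
  choose m hm using step
  let s : ℕ → ℕ → ℕ := fun k => Nat.rec (fun _ => 0)
    (fun k t => by
      classical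
      exact Function.update t k (if h : c' < μ (φ '' L t k) then m k t h else 0)) k
  have hs : ∀ k, c' < μ (φ '' L (s k) k) := by
    intro k
    induction k with
    | zero => simpa [L] using hc'
    | succ k ih =>
      have : s (k + 1) = Function.update (s k) k (m k (s k) ih) := by
        change Function.update (s k) k _ = _
        rw [dif_pos ih]
      rw [this]
      exact hm k (s k) ih
  let n : ℕ → ℕ := fun i => s (i + 1) i
  have hn : ∀ k, ∀ i < k, s k i = n i := by
    intro k
    induction k with
    | zero => intro i hi; omega
    | succ k ih =>
      intro i hi
      rcases Nat.lt_succ_iff_lt_or_eq.1 hi with h' | rfl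
      · rw [← ih i h']
        exact Function.update_of_ne h'.ne _ _
      · rfl
  have hLn : ∀ k, L (s k) k = L n k := fun k => by
    ext z
    exact forall₂_congr fun i hi => by rw [hn k i hi]
  refine ⟨n, hcc'.trans_le ?_⟩
  refine le_trans ?_ (measure_mono (iInter_closure_image_subset hφ n))
  rw [Antitone.measure_iInter]
  · refine le_iInf fun k => ?_
    have := hs k
    rw [hLn] at this
    exact this.le.trans (measure_mono subset_closure)
  · intro a b hab
    exact closure_mono (image_mono fun z hz i hi => hz i (hi.trans_le hab))
  · exact fun k => isClosed_closure.measurableSet.nullMeasurableSet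
  · exact ⟨0, measure_ne_top _ _⟩

/-- Analytic sets are null-measurable for every finite measure. -/
theorem nullMeasurableSet_of_analyticSet {Z : Type*} [TopologicalSpace Z]
    [TopologicalSpace.MetrizableSpace Z] [MeasurableSpace Z] [OpensMeasurableSpace Z]
    {A : Set Z} (hA : AnalyticSet A) (μ : Measure Z) [IsFiniteMeasure μ] :
    NullMeasurableSet A μ := by
  rw [AnalyticSet] at hA
  rcases hA with rfl | ⟨φ, hφ, rfl⟩
  · exact MeasurableSet.empty.nullMeasurableSet
  have hcl : ∀ σ : ℕ → ℕ, IsClosed (φ '' {z | z ≤ σ}) := fun σ =>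
    (isClosed_le_image hφ).preimage (Continuous.prodMk_right σ)
  rcases eq_or_ne (μ (range φ)) 0 with h0 | h0
  · exact NullMeasurableSet.of_null h0
  obtain ⟨c, hcm, hclt, hct⟩ := exists_seq_strictMono_tendsto' (pos_iff_ne_zero.2 h0)
  have hex := fun k => exists_lt_measure_le_image hφ μ (hclt k).2
  choose σ hσ using hex
  set B : Set Z := ⋃ k, φ '' {z | z ≤ σ k}
  have hBm : MeasurableSet B := MeasurableSet.iUnion fun k => (hcl (σ k)).measurableSet
  have hBs : B ⊆ range φ := iUnion_subset fun k => image_subset_range _ _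
  have hle : μ (range φ) ≤ μ B := by
    refine le_of_tendsto' hct fun k => (hσ k).le.trans (measure_mono ?_)
    exact subset_iUnion (fun k => φ '' {z | z ≤ σ k}) k
  have hae : B =ᵐ[μ] range φ :=
    ae_eq_of_subset_of_measure_ge hBs hle hBm.nullMeasurableSet (measure_ne_top _ _)
  exact hBm.nullMeasurableSet.congr hae

theorem measurableSet_univComp_of_analyticSet {Z : Type*} [TopologicalSpace Z]
    [TopologicalSpace.MetrizableSpace Z] [MeasurableSpace Z] [OpensMeasurableSpace Z]
    {A : Set Z} (hA : AnalyticSet A) : MeasurableSet[univComp Z] A :=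
  fun μ _ => nullMeasurableSet_of_analyticSet hA μ

theorem analyticSet_inter {Z : Type*} [TopologicalSpace Z] [T2Space Z] {A B : Set Z}
    (hA : AnalyticSet A) (hB : AnalyticSet B) : AnalyticSet (A ∩ B) := by
  rw [inter_eq_iInter]
  exact AnalyticSet.iInter fun b => by cases b <;> assumption

/-- The measure of the sections of an analytic set is upper semianalytic. -/
theorem analyticSet_lt_kernel {X Y : Type*} [TopologicalSpace X] [PolishSpace X]
    [MeasurableSpace X] [BorelSpace X] [TopologicalSpace Y] [PolishSpace Y]
    [MeasurableSpace Y] [BorelSpace Y] (κ : ProbabilityTheory.Kernel X Y)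
    [ProbabilityTheory.IsFiniteKernel κ] {A : Set (X × Y)} (hA : AnalyticSet A) (c : ℝ≥0∞) :
    AnalyticSet {x | c < κ x {y | (x, y) ∈ A}} := by
  rw [AnalyticSet] at hA
  rcases hA with rfl | ⟨φ, hφ, rfl⟩
  · simpa using analyticSet_empty
  have hcl := isClosed_le_image hφ
  let C : Set ((X × (ℕ → ℕ)) × Y) := {p | ∃ z ≤ p.1.2, φ z = (p.1.1, p.2)}
  have hC : MeasurableSet C := by
    have : IsClosed C := hcl.preimage
      (f := fun p : (X × (ℕ → ℕ)) × Y => (p.1.2, (p.1.1, p.2))) (by fun_prop)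
    exact this.measurableSet
  let κ' : ProbabilityTheory.Kernel (X × (ℕ → ℕ)) Y := κ.comap Prod.fst measurable_fst
  have hm : Measurable fun p : X × (ℕ → ℕ) => κ' p (Prod.mk p ⁻¹' C) :=
    ProbabilityTheory.Kernel.measurable_kernel_prodMk_left hC
  have hB : MeasurableSet {p : X × (ℕ → ℕ) | c < κ' p (Prod.mk p ⁻¹' C)} :=
    measurableSet_lt measurable_const hm
  convert! hB.analyticSet.image_of_continuous continuous_fst using 1
  ext x
  simp only [mem_ofPred_eq, mem_image, Prod.exists, exists_and_right, exists_eq_right]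
  have hmap : ∀ s : Set (X × Y), (κ x).map (Prod.mk x) s = κ x (Prod.mk x ⁻¹' s) := fun s =>
    (measurableEmbedding_prodMk_left x).map_apply _ _
  constructor
  · intro h
    have h' : c < (κ x).map (Prod.mk x) (range φ) := by rw [hmap]; exact h
    obtain ⟨σ, hσ⟩ := exists_lt_measure_le_image hφ _ h'
    refine ⟨σ, ?_⟩
    rw [hmap] at hσ
    exact hσ
  · rintro ⟨σ, hσ⟩
    refine hσ.trans_le (measure_mono ?_)
    rintro y ⟨z, -, hz⟩
    exact ⟨z, hz⟩

/-! ### Lower semianalytic functions -/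

/-- A nonnegative extended function is lower semianalytic if its strict sublevel sets are
analytic. -/
def LSA {X : Type*} [TopologicalSpace X] (u : X → ℝ≥0∞) : Prop :=
  ∀ c, AnalyticSet {x | u x < c}

theorem exists_nnrat_btwn_ennreal {a b : ℝ≥0∞} (h : a < b) :
    ∃ q : ℚ≥0, a < ((q : ℝ≥0) : ℝ≥0∞) ∧ ((q : ℝ≥0) : ℝ≥0∞) < b := by
  obtain ⟨q, q0, aq, qb⟩ := ENNReal.lt_iff_exists_rat_btwn.1 h
  lift q to ℚ≥0 using q0
  have : ((Real.toNNReal ((q : ℚ) : ℝ) : ℝ≥0) : ℝ≥0∞) = ((q : ℝ≥0) : ℝ≥0∞) := by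
    have : Real.toNNReal ((q : ℚ) : ℝ) = (q : ℝ≥0) := by
      ext
      rw [Real.coe_toNNReal _ (by exact_mod_cast q.2)]
      rfl
    rw [this]
  rw [this] at aq qb
  exact ⟨q, aq, qb⟩

section LSA

variable {X : Type*} [TopologicalSpace X] [PolishSpace X]

theorem LSA.analyticSet_le {u : X → ℝ≥0∞} (hu : LSA u) (c : ℝ≥0∞) :
    AnalyticSet {x | u x ≤ c} := by
  have : {x | u x ≤ c} = ⋂ k : {q : ℚ≥0 // c < ((q : ℝ≥0) : ℝ≥0∞)}, {x | u x < (((k : ℚ≥0) : ℝ≥0) : ℝ≥0∞)} := by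
    ext x
    simp only [mem_ofPred_eq, mem_iInter, Subtype.forall]
    refine ⟨fun h q hq => h.trans_lt hq, fun h => ?_⟩
    by_contra! hlt
    obtain ⟨q, h1, h2⟩ := exists_nnrat_btwn_ennreal hlt
    exact absurd (h q h1) h2.le.not_gt
  rw [this]
  by_cases hne : Nonempty {q : ℚ≥0 // c < ((q : ℝ≥0) : ℝ≥0∞)}
  · exact AnalyticSet.iInter fun k => hu _
  · have := not_nonempty_iff.1 hne
    simpa using (isClosed_univ : IsClosed (univ : Set X)).analyticSet

omit [PolishSpace X] in
theorem lsa_of_analyticSet_le {u : X → ℝ≥0∞} (hu : ∀ c, AnalyticSet {x | u x ≤ c}) : LSA u := by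
  intro c
  have : {x | u x < c} = ⋃ k : {q : ℚ≥0 // ((q : ℝ≥0) : ℝ≥0∞) < c}, {x | u x ≤ (((k : ℚ≥0) : ℝ≥0) : ℝ≥0∞)} := by
    ext x
    simp only [mem_ofPred_eq, mem_iUnion, Subtype.exists]
    refine ⟨fun h => ?_, fun ⟨q, hq, h⟩ => h.trans_lt hq⟩
    obtain ⟨q, h1, h2⟩ := exists_nnrat_btwn_ennreal h
    exact ⟨q, h2, h1.le⟩
  rw [this]
  exact AnalyticSet.iUnion fun k => hu _

omit [PolishSpace X] in
theorem ennreal_add_lt_iff_exists_nnrat (a b c : ℝ≥0∞) :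
    a + b < c ↔ ∃ q : ℚ≥0 × ℚ≥0, ((q.1 : ℝ≥0) : ℝ≥0∞) + (q.2 : ℝ≥0) < c ∧
      a < (q.1 : ℝ≥0) ∧ b < (q.2 : ℝ≥0) := by
  constructor
  · intro h
    obtain ⟨a', ha, h1⟩ : ∃ a' : ℝ≥0∞, a < a' ∧ a' + b < c := by
      by_contra! hcon
      have hb : b ≠ ⊤ := fun hb => by simp [hb] at h
      have ha : a < c - b := (ENNReal.addLECancellable_iff_ne.2 hb).lt_tsub_iff_right.2 h
      obtain ⟨a', h1, h2⟩ := exists_between ha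
      exact absurd (hcon a' h1) (not_le.2 (lt_tsub_iff_right.1 h2))
    obtain ⟨q, hq1, hq2⟩ := exists_nnrat_btwn_ennreal ha
    have h2 : b < c - (q : ℝ≥0) := (ENNReal.addLECancellable_iff_ne.2
      (by simp)).lt_tsub_iff_left.2 ((add_le_add_left hq2.le b).trans_lt h1)
    obtain ⟨r, hr1, hr2⟩ := exists_nnrat_btwn_ennreal h2
    exact ⟨(q, r), lt_tsub_iff_left.1 hr2, hq1, hr1⟩
  · rintro ⟨q, h, h1, h2⟩
    exact (add_le_add h1.le h2.le).trans_lt h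

theorem LSA.add {u v : X → ℝ≥0∞} (hu : LSA u) (hv : LSA v) : LSA fun x => u x + v x := by
  intro c
  have : {x | u x + v x < c} = ⋃ q : {q : ℚ≥0 × ℚ≥0 // ((q.1 : ℝ≥0) : ℝ≥0∞) + (q.2 : ℝ≥0) < c},
      ({x | u x < (q.1.1 : ℝ≥0)} ∩ {x | v x < (q.1.2 : ℝ≥0)}) := by
    ext x
    simp only [mem_ofPred_eq, mem_iUnion, mem_inter_iff]
    rw [ennreal_add_lt_iff_exists_nnrat]
    exact ⟨fun ⟨q, h, h'⟩ => ⟨⟨q, h⟩, h'⟩, fun ⟨q, h'⟩ => ⟨q.1, q.2, h'⟩⟩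
  rw [this]
  exact AnalyticSet.iUnion fun q => analyticSet_inter (hu _) (hv _)

theorem LSA.of_measurable [MeasurableSpace X] [BorelSpace X] {u : X → ℝ≥0∞} (hu : Measurable u) :
    LSA u := fun _ => (measurableSet_lt hu measurable_const).analyticSet

theorem LSA.const (a : ℝ≥0∞) : LSA fun _ : X => a := by
  let : MeasurableSpace X := borel X
  have : BorelSpace X := ⟨rfl⟩
  exact LSA.of_measurable measurable_const

theorem LSA.sum {ι : Type*} {u : ι → X → ℝ≥0∞} (s : Finset ι) (hu : ∀ i ∈ s, LSA (u i)) :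
    LSA fun x => ∑ i ∈ s, u i x := by
  classical
  induction s using Finset.induction_on with
  | empty => simpa using LSA.const 0
  | insert a s ha ih =>
    simp only [Finset.sum_insert ha]
    exact (hu a (by simp)).add (ih fun i hi => hu i (by simp [hi]))

theorem LSA.comp {Y : Type*} [TopologicalSpace Y] [PolishSpace Y] {u : X → ℝ≥0∞} (hu : LSA u)
    {g : Y → X} (hg : Continuous g) : LSA fun y => u (g y) :=
  fun c => (hu c).preimage hg

theorem LSA.measurable_univComp [MeasurableSpace X] [BorelSpace X] {u : X → ℝ≥0∞} (hu : LSA u) :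
    Measurable[univComp X] u :=
  @measurable_of_Iio _ X _ _ _ (univComp X) _ _ _ _
    fun c => measurableSet_univComp_of_analyticSet (hu c)

end LSA

theorem discretization_bounds (v : ℝ≥0∞) (N : ℕ) :
    (∑ k ∈ Finset.range N, (if ((k : ℝ≥0∞) + 1) ≤ v then (1 : ℝ≥0∞) else 0)) ≤ min v N ∧
    min v N ≤ (∑ k ∈ Finset.range N, (if ((k : ℝ≥0∞) + 1) ≤ v then (1 : ℝ≥0∞) else 0)) + 1 ∧
    ((N : ℝ≥0∞) ≤ v →
      (∑ k ∈ Finset.range N, (if ((k : ℝ≥0∞) + 1) ≤ v then (1 : ℝ≥0∞) else 0)) = N) := by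
  induction N with
  | zero => simp
  | succ N ih =>
    obtain ⟨h1, h2, h3⟩ := ih
    rw [Finset.sum_range_succ]
    push_cast
    by_cases hv : ((N : ℝ≥0∞) + 1) ≤ v
    · have hN : (N : ℝ≥0∞) ≤ v := le_self_add.trans hv
      simp only [hv, if_true, h3 hN, min_eq_right hv]
      exact ⟨le_rfl, le_self_add, fun _ => trivial⟩
    · simp only [hv, if_false, add_zero]
      rw [min_eq_left (not_le.1 hv).le]
      refine ⟨h1.trans (min_le_left _ _), ?_, fun h => h.elim⟩
      by_cases hN : (N : ℝ≥0∞) ≤ v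
      · rw [h3 hN]; exact (not_le.1 hv).le
      · rw [min_eq_left (not_le.1 hN).le] at h2
        exact h2

/-- Approximation of an integral by finite sums of probabilities of level sets. -/
theorem lintegral_le_iff_discretization {Y : Type*} [MeasurableSpace Y] (μ : Measure Y)
    {u : Y → ℝ≥0∞} (hu : AEMeasurable u μ) (c : ℝ≥0∞) :
    ∫⁻ y, u y ∂μ ≤ c ↔ ∀ n : ℕ, (∑ k ∈ Finset.range ((n + 1) * (n + 1)),
      μ {y | ((k : ℝ≥0∞) + 1) ≤ ((n + 1 : ℕ) : ℝ≥0∞) * u y}) ≤ ((n + 1 : ℕ) : ℝ≥0∞) * c := by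
  set s : ℕ → Y → ℝ≥0∞ := fun n y => ∑ k ∈ Finset.range ((n + 1) * (n + 1)),
      (if ((k : ℝ≥0∞) + 1) ≤ ((n + 1 : ℕ) : ℝ≥0∞) * u y then (1 : ℝ≥0∞) else 0) with hs
  have hmeas : ∀ n (k : ℕ), NullMeasurableSet
      {y | ((k : ℝ≥0∞) + 1) ≤ ((n + 1 : ℕ) : ℝ≥0∞) * u y} μ := fun n k =>
    nullMeasurableSet_le aemeasurable_const (hu.const_mul _)
  have hind : ∀ n (k : ℕ), (fun y => if ((k : ℝ≥0∞) + 1) ≤ ((n + 1 : ℕ) : ℝ≥0∞) * u y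
      then (1 : ℝ≥0∞) else 0) =
      indicator {y | ((k : ℝ≥0∞) + 1) ≤ ((n + 1 : ℕ) : ℝ≥0∞) * u y} 1 := by
    intro n k; ext y; simp [indicator]
  have hterm : ∀ n (k : ℕ), AEMeasurable (fun y => if ((k : ℝ≥0∞) + 1) ≤
      ((n + 1 : ℕ) : ℝ≥0∞) * u y then (1 : ℝ≥0∞) else 0) μ := by
    intro n k
    rw [hind]
    exact (aemeasurable_const (b := (1 : ℝ≥0∞))).indicator₀ (hmeas n k)
  have hsm : ∀ n, AEMeasurable (s n) μ := fun n => by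
    have := Finset.aemeasurable_sum (Finset.range ((n + 1) * (n + 1))) (fun k _ => hterm n k)
    convert! this using 1
    ext y; simp [hs]
  have hInt : ∀ n, ∫⁻ y, s n y ∂μ = ∑ k ∈ Finset.range ((n + 1) * (n + 1)),
      μ {y | ((k : ℝ≥0∞) + 1) ≤ ((n + 1 : ℕ) : ℝ≥0∞) * u y} := by
    intro n
    rw [lintegral_finsetSum' _ (fun k _ => hterm n k)]
    refine Finset.sum_congr rfl fun k _ => ?_
    rw [hind, lintegral_indicator_one₀ (hmeas n k)]
  simp only [← hInt]
  constructor
  · intro h n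
    calc ∫⁻ y, s n y ∂μ ≤ ∫⁻ y, ((n + 1 : ℕ) : ℝ≥0∞) * u y ∂μ :=
          lintegral_mono fun y => (discretization_bounds _ _).1.trans (min_le_left _ _)
      _ = ((n + 1 : ℕ) : ℝ≥0∞) * ∫⁻ y, u y ∂μ := lintegral_const_mul'' _ hu
      _ ≤ _ := by gcongr
  · intro h
    set w : ℕ → Y → ℝ≥0∞ := fun n y => ((n + 1 : ℕ) : ℝ≥0∞)⁻¹ * s n y with hw
    have hwint : ∀ n, ∫⁻ y, w n y ∂μ ≤ c := by
      intro n
      rw [hw, lintegral_const_mul'' _ (hsm n)]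
      refine (mul_le_mul_right (h n) _).trans ?_
      rw [← mul_assoc, ENNReal.inv_mul_cancel (by simp) (by simp), one_mul]
    have hlim : ∀ y, u y ≤ liminf (fun n => w n y) atTop := by
      intro y
      have hbd : ∀ n : ℕ, min (u y) ((n + 1 : ℕ) : ℝ≥0∞) - ((n + 1 : ℕ) : ℝ≥0∞)⁻¹ ≤ w n y := by
        intro n
        rw [tsub_le_iff_right]
        have := (discretization_bounds (((n + 1 : ℕ) : ℝ≥0∞) * u y) ((n + 1) * (n + 1))).2.1
        have hn0 : ((n + 1 : ℕ) : ℝ≥0∞) ≠ 0 := by simp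
        have hnt : ((n + 1 : ℕ) : ℝ≥0∞) ≠ ⊤ := by simp
        have h2 := mul_le_mul_right this (((n + 1 : ℕ) : ℝ≥0∞)⁻¹)
        rw [mul_add _ (Finset.sum _ _) 1, mul_one] at h2
        refine le_trans ?_ h2
        rw [Nat.cast_mul, ← mul_min, ← mul_assoc, ENNReal.inv_mul_cancel hn0 hnt, one_mul]
      have ht1 : Tendsto (fun n : ℕ => ((n + 1 : ℕ) : ℝ≥0∞)) atTop (𝓝 ⊤) :=
        ENNReal.tendsto_nat_nhds_top.comp (tendsto_add_atTop_nat 1)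
      have ht2 : Tendsto (fun n : ℕ => min (u y) ((n + 1 : ℕ) : ℝ≥0∞)) atTop (𝓝 (u y)) := by
        simpa using (tendsto_const_nhds (x := u y)).min ht1
      have ht3 : Tendsto (fun n : ℕ => ((n + 1 : ℕ) : ℝ≥0∞)⁻¹) atTop (𝓝 0) := by
        simpa using tendsto_inv_iff.2 ht1
      have ht4 := ENNReal.Tendsto.sub ht2 ht3 (Or.inr ENNReal.zero_ne_top)
      rw [tsub_zero] at ht4
      rw [← ht4.liminf_eq]
      exact liminf_le_liminf (Eventually.of_forall hbd)
    calc ∫⁻ y, u y ∂μ ≤ ∫⁻ y, liminf (fun n => w n y) atTop ∂μ := lintegral_mono hlim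
      _ ≤ liminf (fun n => ∫⁻ y, w n y ∂μ) atTop :=
          lintegral_liminf_le' fun n => (hsm n).const_mul _
      _ ≤ c := by
          refine liminf_le_of_le (by isBoundedDefault) fun b hb => ?_
          obtain ⟨n, hn⟩ := hb.exists
          exact hn.trans (hwint n)

theorem aemeasurable_of_measurable_univComp {X Z : Type*} [MeasurableSpace X]
    [MeasurableSpace Z] [Nonempty Z] [TopologicalSpace Z]
    [SecondCountableTopology Z] [TopologicalSpace.PseudoMetrizableSpace Z] [BorelSpace Z]
    {u : X → Z} (hu : Measurable[univComp X] u) (μ : Measure X) [IsProbabilityMeasure μ] :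
    AEMeasurable u μ :=
  NullMeasurable.aemeasurable fun _ hs => hu hs μ inferInstance

theorem LSA.aemeasurable {X : Type*} [TopologicalSpace X] [PolishSpace X] [MeasurableSpace X]
    [BorelSpace X] {u : X → ℝ≥0∞} (hu : LSA u) (μ : Measure X) [IsProbabilityMeasure μ] :
    AEMeasurable u μ :=
  aemeasurable_of_measurable_univComp hu.measurable_univComp μ

/-- Integrating a lower semianalytic function against a Markov kernel gives a lower
semianalytic function. -/
theorem LSA.lintegral_kernel {X Y : Type*} [TopologicalSpace X] [PolishSpace X]
    [MeasurableSpace X] [BorelSpace X] [TopologicalSpace Y] [PolishSpace Y]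
    [MeasurableSpace Y] [BorelSpace Y] (κ : ProbabilityTheory.Kernel X Y)
    [ProbabilityTheory.IsMarkovKernel κ] {u : X × Y → ℝ≥0∞} (hu : LSA u) :
    LSA fun x => ∫⁻ y, u (x, y) ∂(κ x) := by
  apply lsa_of_analyticSet_le
  intro c
  have hux : ∀ x, LSA fun y => u (x, y) := fun x => hu.comp (by fun_prop)
  have hlevel : ∀ (n k : ℕ), LSA fun x =>
      κ x {y | ((k : ℝ≥0∞) + 1) ≤ ((n + 1 : ℕ) : ℝ≥0∞) * u (x, y)} := by
    intro n k
    set A : Set (X × Y) := {p | u p < ((k : ℝ≥0∞) + 1) / ((n + 1 : ℕ) : ℝ≥0∞)} with hA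
    have hAan : AnalyticSet A := hu _
    have hcompl : ∀ x, κ x {y | ((k : ℝ≥0∞) + 1) ≤ ((n + 1 : ℕ) : ℝ≥0∞) * u (x, y)}
        = 1 - κ x {y | (x, y) ∈ A} := by
      intro x
      have hnm : NullMeasurableSet {y | (x, y) ∈ A} (κ x) :=
        nullMeasurableSet_of_analyticSet (hAan.preimage (by fun_prop)) _
      rw [← prob_compl_eq_one_sub₀ hnm]
      congr 1
      ext y
      simp only [hA, mem_ofPred_eq, mem_compl_iff, not_lt]
      rw [ENNReal.div_le_iff_le_mul (by simp) (by simp), mul_comm]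
    intro b
    simp only [hcompl]
    rcases eq_or_ne b 0 with rfl | hb0
    · simpa using analyticSet_empty
    rcases lt_or_ge 1 b with hb | hb
    · have : {x | 1 - κ x {y | (x, y) ∈ A} < b} = univ := by
        ext x; simpa using tsub_le_self.trans_lt hb
      rw [this]
      exact isClosed_univ.analyticSet
    · have : {x | 1 - κ x {y | (x, y) ∈ A} < b} = {x | 1 - b < κ x {y | (x, y) ∈ A}} := by
        ext x
        have h1 : κ x {y | (x, y) ∈ A} ≤ 1 := prob_le_one
        have hbt : b ≠ ⊤ := (hb.trans_lt ENNReal.one_lt_top).ne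
        have hkt : κ x {y | (x, y) ∈ A} ≠ ⊤ := (h1.trans_lt ENNReal.one_lt_top).ne
        simp only [mem_ofPred_eq]
        rw [ENNReal.sub_lt_iff_lt_right hkt h1, ENNReal.sub_lt_iff_lt_right hbt hb, add_comm]
      rw [this]
      exact analyticSet_lt_kernel κ hAan _
  have : {x | ∫⁻ y, u (x, y) ∂(κ x) ≤ c} = ⋂ n : ℕ, {x |
      (∑ k ∈ Finset.range ((n + 1) * (n + 1)),
        κ x {y | ((k : ℝ≥0∞) + 1) ≤ ((n + 1 : ℕ) : ℝ≥0∞) * u (x, y)})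
        ≤ ((n + 1 : ℕ) : ℝ≥0∞) * c} := by
    ext x
    simp only [mem_ofPred_eq, mem_iInter]
    exact lintegral_le_iff_discretization (κ x) ((hux x).aemeasurable _) c
  rw [this]
  exact AnalyticSet.iInter fun n => (LSA.sum _ fun k _ => hlevel n k).analyticSet_le _

/-! ### Parametrizing probability measures by distribution functions -/

section Code

open ProbabilityTheory

variable (Y : Type*) [MeasurableSpace Y] [StandardBorelSpace Y]

/-- The distribution function, at rational points, of a measure transported to `ℝ`. -/
def code (μ : Measure Y) (q : ℚ) : ℝ := (μ (embeddingReal Y ⁻¹' Iic (q : ℝ))).toReal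

theorem measurable_code : Measurable (code Y) := by
  refine measurable_pi_iff.2 fun q => ?_
  exact (Measure.measurable_coe (measurable_embeddingReal Y measurableSet_Iic)).ennreal_toReal

/-- A Markov kernel from sequences to `Y` which inverts `code`. -/
def decode [Nonempty Y] : Kernel (ℚ → ℝ) Y :=
  Kernel.borelMarkovFromReal Y
    ⟨fun w => (stieltjesOfMeasurableRat (fun w : ℚ → ℝ => w) measurable_id w).measure,
      measurable_measure_stieltjesOfMeasurableRat measurable_id⟩

instance isMarkovKernel_decode [Nonempty Y] : IsMarkovKernel (decode Y) := by
  have : IsMarkovKernel (⟨fun w => (stieltjesOfMeasurableRat (fun w : ℚ → ℝ => w)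
      measurable_id w).measure, measurable_measure_stieltjesOfMeasurableRat measurable_id⟩ :
      Kernel (ℚ → ℝ) ℝ) := ⟨fun w => by
    change IsProbabilityMeasure (stieltjesOfMeasurableRat _ _ _).measure
    infer_instance⟩
  unfold decode
  infer_instance

variable {Y}

theorem decode_code [Nonempty Y] (μ : Measure Y) [IsProbabilityMeasure μ] :
    decode Y (code Y μ) = μ := by
  set ν : Measure ℝ := μ.map (embeddingReal Y) with hν
  have he := measurableEmbedding_embeddingReal Y
  have : IsProbabilityMeasure ν := Measure.isProbabilityMeasure_map he.measurable.aemeasurable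
  have hcode : ∀ q : ℚ, code Y μ q = cdf ν q := fun q => by
    rw [cdf_eq_real, code, measureReal_def, hν, Measure.map_apply he.measurable measurableSet_Iic]
  have hpt : IsRatStieltjesPoint (fun w : ℚ → ℝ => w) (code Y μ) := by
    have hfun : code Y μ = fun q : ℚ => cdf ν q := funext hcode
    refine ⟨?_, ?_, ?_, ?_⟩
    · intro p q hpq
      simp only [hcode]
      exact monotone_cdf ν (by exact_mod_cast hpq)
    · simp only [hfun]
      exact (tendsto_cdf_atTop ν).comp (tendsto_ratCast_atTop_iff.2 tendsto_id)
    · simp only [hfun]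
      exact (tendsto_cdf_atBot ν).comp (tendsto_ratCast_atBot_iff.2 tendsto_id)
    · intro t
      simp only [hcode]
      rw [← StieltjesFunction.iInf_rat_gt_eq (cdf ν) (t : ℝ)]
      refine Equiv.iInf_congr (Equiv.subtypeEquivRight fun r => by simp) fun r => rfl
  have hst : (stieltjesOfMeasurableRat (fun w : ℚ → ℝ => w) measurable_id (code Y μ)).measure
      = ν := by
    refine Measure.eq_of_cdf _ _ ?_
    rw [cdf_measure_stieltjesFunction _ (tendsto_stieltjesOfMeasurableRat_atBot _ _)
      (tendsto_stieltjesOfMeasurableRat_atTop _ _)]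
    ext x
    rw [← StieltjesFunction.iInf_rat_gt_eq, ← StieltjesFunction.iInf_rat_gt_eq]
    refine iInf_congr fun r => ?_
    rw [stieltjesOfMeasurableRat_eq, toRatCDF_of_isRatStieltjesPoint hpt, hcode]
  rw [decode, Kernel.borelMarkovFromReal_apply]
  change (if (stieltjesOfMeasurableRat (fun w : ℚ → ℝ => w) measurable_id (code Y μ)).measure
    (range (embeddingReal Y))ᶜ = 0 then
    ((stieltjesOfMeasurableRat (fun w : ℚ → ℝ => w) measurable_id (code Y μ)).measure).comap _
    else _) = μ
  rw [hst, if_pos, hν, he.comap_map]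
  rw [hν, Measure.map_apply he.measurable he.measurableSet_range.compl]
  simp

/-- A universally measurable probability kernel agrees almost everywhere with a Borel Markov
kernel. -/
theorem exists_kernel_ae_eq [Nonempty Y] {X : Type*} [MeasurableSpace X] {κ : X → Measure Y}
    (hκ : Measurable[univComp X] κ) [∀ x, IsProbabilityMeasure (κ x)] (ν : Measure X)
    [IsProbabilityMeasure ν] :
    ∃ κ' : Kernel X Y, IsMarkovKernel κ' ∧ ∀ᵐ x ∂ν, κ x = κ' x := by
  have h1 : Measurable[univComp X] fun x => code Y (κ x) :=
    @Measurable.comp _ _ _ (univComp X) _ _ _ _ (measurable_code Y) hκ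
  have h2 : AEMeasurable (fun x => code Y (κ x)) ν := aemeasurable_of_measurable_univComp h1 ν
  refine ⟨(decode Y).comap (h2.mk _) h2.measurable_mk, inferInstance, ?_⟩
  filter_upwards [h2.ae_eq_mk] with x hx
  rw [Kernel.comap_apply, ← hx, decode_code]

end Code

/-- Evaluations of probability measures are Borel for the weak topology. -/
theorem measurable_coe_borel_probabilityMeasure {Y : Type*} [MeasurableSpace Y]
    [TopologicalSpace Y] [BorelSpace Y] [HasOuterApproxClosed Y] :
    Measurable[borel (ProbabilityMeasure Y)]
      (fun P : ProbabilityMeasure Y => (P : Measure Y)) := by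
  have hb : @BorelSpace (ProbabilityMeasure Y) _ (borel _) := @BorelSpace.mk _ _ (borel _) rfl
  refine @Measurable.measure_of_isPiSystem_of_isProbabilityMeasure _ _ (borel _) _ _ _
    {s | IsOpen s} (BorelSpace.measurable_eq) isPiSystem_isOpen ?_
  intro G hG
  refine @LowerSemicontinuous.measurable _ _ _ _ _ (borel _) _ _ _ _
    (@BorelSpace.opensMeasurable _ _ (borel _) hb) _ ?_
  rw [lowerSemicontinuous_iff_le_liminf]
  exact fun P => ProbabilityMeasure.le_liminf_measure_open_of_tendsto tendsto_id hG

/-! ### Measurable selection -/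

section Selection

variable {X E : Type*} [MeasurableSpace X] [TopologicalSpace E] [PolishSpace E]
  [MeasurableSpace E] [BorelSpace E]

/-- Kuratowski–Ryll-Nardzewski selection, for nonempty values. -/
theorem exists_measurable_selector_of_nonempty {H : X → Set E}
    (hH : ∀ x, IsClosed (H x)) (hne : ∀ x, (H x).Nonempty)
    (hit : ∀ O : Set E, IsOpen O → MeasurableSet {x | (H x ∩ O).Nonempty}) :
    ∃ s : X → E, Measurable s ∧ ∀ x, s x ∈ H x := by
  classical
  let := TopologicalSpace.upgradeIsCompletelyMetrizable E
  rcases isEmpty_or_nonempty X with hX | ⟨⟨x₀⟩⟩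
  · exact ⟨fun x => (hX.false x).elim, measurable_of_empty _, fun x =>
      (hX.false x).elim⟩
  have : Nonempty E := (hne x₀).to_type
  let c : ℕ → E := TopologicalSpace.denseSeq E
  have hc : ∀ (p : E) (r : ℝ), 0 < r → ∃ k, dist p (c k) < r := fun p r hr =>
    (TopologicalSpace.denseRange_denseSeq E).exists_dist_lt p hr
  let r : ℕ → ℝ := fun n => (1 / 2 : ℝ) ^ n
  have hr : ∀ n, 0 < r n := fun n => by positivity
  have hrs : ∀ n, r (n + 1) = r n / 2 := fun n => by simp only [r, pow_succ]; ring
  have step : ∀ (n : ℕ) (s : X → E), (Measurable s ∧ ∀ x, ∃ p ∈ H x, dist p (s x) < r n) →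
      ∃ s' : X → E, (Measurable s' ∧ ∀ x, ∃ p ∈ H x, dist p (s' x) < r (n + 1)) ∧
        ∀ x, dist (s x) (s' x) < 2 * r n := by
    rintro n s ⟨hs, hsp⟩
    let p : X → ℕ → Prop := fun x k =>
      (H x ∩ Metric.ball (c k) (r (n + 1))).Nonempty ∧ dist (s x) (c k) < 2 * r n
    have hp : ∀ x, ∃ k, p x k := by
      intro x
      obtain ⟨q, hq, hqs⟩ := hsp x
      obtain ⟨k, hk⟩ := hc q (r (n + 1)) (hr _)
      refine ⟨k, ⟨q, hq, hk⟩, ?_⟩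
      have := dist_triangle (s x) q (c k)
      rw [dist_comm (s x) q] at this
      have h3 := hrs n
      have h4 := hr n
      linarith
    have hpm : ∀ k, MeasurableSet {x | p x k} := fun k =>
      (hit _ Metric.isOpen_ball).inter
        (measurableSet_lt (hs.dist measurable_const) measurable_const)
    refine ⟨fun x => c (Nat.find (hp x)),
      ⟨(measurable_from_nat (f := c)).comp (measurable_find hp hpm), fun x => ?_⟩, fun x => ?_⟩
    · obtain ⟨q, hq, hq'⟩ := (Nat.find_spec (hp x)).1
      exact ⟨q, hq, hq'⟩
    · exact (Nat.find_spec (hp x)).2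
  choose! F hF hFd using step
  have base : ∃ s : X → E, Measurable s ∧ ∀ x, ∃ p ∈ H x, dist p (s x) < r 0 := by
    have hp : ∀ x, ∃ k, (H x ∩ Metric.ball (c k) (r 0)).Nonempty := fun x => by
      obtain ⟨q, hq⟩ := hne x
      obtain ⟨k, hk⟩ := hc q (r 0) (hr _)
      exact ⟨k, q, hq, hk⟩
    refine ⟨fun x => c (Nat.find (hp x)), (measurable_from_nat (f := c)).comp
      (measurable_find hp fun k => hit _ Metric.isOpen_ball), fun x => ?_⟩
    obtain ⟨q, hq, hq'⟩ := Nat.find_spec (hp x)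
    exact ⟨q, hq, hq'⟩
  obtain ⟨s₀, hs₀⟩ := base
  let s : ℕ → X → E := fun n => Nat.rec s₀ F n
  have hs : ∀ n, Measurable (s n) ∧ ∀ x, ∃ p ∈ H x, dist p (s n x) < r n := by
    intro n
    induction n with
    | zero => exact hs₀
    | succ n ih => exact hF n (s n) ih
  have hsd : ∀ n x, dist (s n x) (s (n + 1) x) ≤ 2 * (1 / 2 : ℝ) ^ n := fun n x =>
    (hFd n (s n) (hs n) x).le
  have hcau : ∀ x, CauchySeq fun n => s n x := fun x =>
    cauchySeq_of_le_geometric (1 / 2) 2 (by norm_num) fun n => hsd n x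
  choose l hl using fun x => cauchySeq_tendsto_of_complete (hcau x)
  refine ⟨l, measurable_of_tendsto_metrizable (fun n => (hs n).1) (tendsto_pi_nhds.2 hl),
    fun x => ?_⟩
  choose p hp hpd using fun n => (hs n).2 x
  have h0 : Tendsto r atTop (𝓝 0) := tendsto_pow_atTop_nhds_zero_of_lt_one (by norm_num)
    (by norm_num)
  have hpt : Tendsto p atTop (𝓝 (l x)) := by
    refine (hl x).congr_dist ?_
    refine squeeze_zero (fun _ => dist_nonneg) (fun n => ?_) h0
    rw [dist_comm]
    exact (hpd n).le
  exact (hH x).mem_of_tendsto hpt (Eventually.of_forall hp)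

/-- Kuratowski–Ryll-Nardzewski selection: a closed-valued multifunction whose open hitting sets
are measurable has a measurable selector on its domain. -/
theorem exists_measurable_selector [Nonempty E] {H : X → Set E} (hH : ∀ x, IsClosed (H x))
    (hit : ∀ O : Set E, IsOpen O → MeasurableSet {x | (H x ∩ O).Nonempty}) :
    ∃ s : X → E, Measurable s ∧ ∀ x, (H x).Nonempty → s x ∈ H x := by
  classical
  obtain ⟨s, hs, hsH⟩ := exists_measurable_selector_of_nonempty
    (H := fun x => if (H x).Nonempty then H x else univ)
    (fun x => by split_ifs; exacts [hH x, isClosed_univ])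
    (fun x => by split_ifs with h; exacts [h, univ_nonempty])
    (fun O hO => by
      rcases O.eq_empty_or_nonempty with rfl | hOne
      · simp
      have h1 := (hit O hO).union (hit univ isOpen_univ).compl
      convert! h1 using 1
      ext x
      by_cases h : (H x).Nonempty <;> simp [h, hOne])
  refine ⟨s, hs, fun x hx => ?_⟩
  have := hsH x
  simpa only [hx, if_true] using this

end Selection

/-- Jankov–von Neumann selection: an analytic set has a universally measurable uniformization. -/
theorem exists_univComp_selector {X E : Type*} [TopologicalSpace X] [PolishSpace X]
    [MeasurableSpace X] [BorelSpace X] [TopologicalSpace E] [MeasurableSpace E]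
    [BorelSpace E] [Nonempty E] {Γ : Set (X × E)} (hΓ : AnalyticSet Γ) :
    ∃ s : X → E, Measurable[univComp X] s ∧ ∀ x, (∃ e, (x, e) ∈ Γ) → (x, s x) ∈ Γ := by
  rw [AnalyticSet] at hΓ
  rcases hΓ with hempty | ⟨φ, hφ, hrange⟩
  · refine ⟨fun _ => Classical.arbitrary E, @measurable_const _ _ _ (univComp X) _, ?_⟩
    rintro x ⟨e, he⟩
    simp [hempty] at he
  obtain ⟨z, hz, hzH⟩ := @exists_measurable_selector X (ℕ → ℕ) (univComp X) _ _ _ _ _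
    (fun x => {z | (φ z).1 = x}) (fun x => isClosed_eq (by fun_prop) continuous_const) (by
      intro O hO
      have : {x | ({z | (φ z).1 = x} ∩ O).Nonempty} = (fun z => (φ z).1) '' O := by
        ext x
        simp only [mem_ofPred_eq, Set.Nonempty, mem_inter_iff, mem_image]
        exact ⟨fun ⟨z, h1, h2⟩ => ⟨z, h2, h1⟩, fun ⟨z, h1, h2⟩ => ⟨z, h2, h1⟩⟩
      rw [this]
      exact measurableSet_univComp_of_analyticSet
        (hO.measurableSet.analyticSet.image_of_continuous (by fun_prop)))
  refine ⟨fun x => (φ (z x)).2, ?_, ?_⟩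
  · have h2 : Measurable fun z => (φ z).2 :=
      (by fun_prop : Continuous fun z => (φ z).2).measurable
    exact @Measurable.comp _ _ _ (univComp X) _ _ (fun z => (φ z).2) z h2 hz
  · rintro x ⟨e, he⟩
    rw [← hrange] at he
    obtain ⟨z', hz'⟩ := he
    have h1 : (φ (z x)).1 = x := hzH x ⟨z', by simp [hz']⟩
    rw [← hrange]
    exact ⟨z x, Prod.ext h1 rfl⟩

/-! ### Separation in finite dimension -/

/-- A convex set avoiding the origin is properly separated from it. -/
theorem exists_proper_separation {E : Type*} [NormedAddCommGroup E] [NormedSpace ℝ E]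
    [FiniteDimensional ℝ E] {V : Set E} (hV : Convex ℝ V) (hne : V.Nonempty) (h0 : (0 : E) ∉ V) :
    ∃ f : E →ₗ[ℝ] ℝ, (∀ v ∈ V, 0 ≤ f v) ∧ ∃ v ∈ V, f v ≠ 0 := by
  obtain ⟨v₀, hv₀⟩ := hne
  by_cases haff : (0 : E) ∈ affineSpan ℝ V
  · obtain ⟨M, hM⟩ := (Submodule.span ℝ V).exists_isCompl
    set D : Set E := {x | ∃ v ∈ V, ∃ m ∈ M, x = v + m} with hD
    have hVD : V ⊆ D := fun v hv => ⟨v, hv, 0, M.zero_mem, by simp⟩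
    have hDconv : Convex ℝ D := by
      rintro _ ⟨v, hv, m, hm, rfl⟩ _ ⟨v', hv', m', hm', rfl⟩ a b ha hb hab
      refine ⟨a • v + b • v', hV hv hv' ha hb hab, a • m + b • m',
        M.add_mem (M.smul_mem _ hm) (M.smul_mem _ hm'), ?_⟩
      simp only [smul_add]; abel
    have hD0 : (0 : E) ∉ D := by
      rintro ⟨v, hv, m, hm, h⟩
      have hvM : v ∈ M := by
        rw [eq_neg_of_add_eq_zero_left h.symm]; exact M.neg_mem hm
      have := Submodule.disjoint_def.1 hM.disjoint v (Submodule.subset_span hv) hvM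
      exact h0 (this ▸ hv)
    have hInt : (interior D).Nonempty := by
      rw [hDconv.interior_nonempty_iff_affineSpan_eq_top]
      have hzero : (0 : E) ∈ affineSpan ℝ D := affineSpan_mono ℝ hVD haff
      have hdir : (affineSpan ℝ D).direction = ⊤ := by
        rw [eq_top_iff, ← hM.sup_eq_top]
        refine sup_le (Submodule.span_le.2 fun v hv => ?_) fun m hm => ?_
        · have := AffineSubspace.vsub_mem_direction (subset_affineSpan ℝ D (hVD hv)) hzero
          simpa using this
        · have := AffineSubspace.vsub_mem_direction
            (subset_affineSpan ℝ D ⟨v₀, hv₀, m, hm, rfl⟩) (subset_affineSpan ℝ D (hVD hv₀))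
          simpa using this
      exact (AffineSubspace.direction_eq_top_iff_of_nonempty ⟨0, hzero⟩).1 hdir
    obtain ⟨f, hf⟩ := geometric_hahn_banach_open_point hDconv.interior isOpen_interior
      (fun h => hD0 (interior_subset h))
    simp only [map_zero] at hf
    have hfD : ∀ x ∈ D, f x ≤ 0 := by
      intro x hx
      have h1 : x ∈ closure (interior D) := by
        rw [hDconv.closure_interior_eq_closure_of_nonempty_interior hInt]
        exact subset_closure hx
      have h2 : closure (interior D) ⊆ {x | f x ≤ 0} :=
        closure_minimal (fun y hy => (hf y hy).le) (isClosed_le f.continuous continuous_const)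
      exact h2 h1
    have hfM : ∀ m ∈ M, f m = 0 := by
      intro m hm
      by_contra hne
      have h1 := hfD _ ⟨v₀, hv₀, ((1 - f v₀) / f m) • m, M.smul_mem _ hm, rfl⟩
      rw [map_add, map_smul, smul_eq_mul, div_mul_cancel₀ _ hne] at h1
      linarith
    refine ⟨-f.toLinearMap, fun v hv => ?_, ?_⟩
    · simpa using hfD v (hVD hv)
    · obtain ⟨x, hx⟩ := hInt
      obtain ⟨v, hv, m, hm, rfl⟩ := interior_subset hx
      have := hf _ hx
      rw [map_add, hfM m hm, add_zero] at this
      exact ⟨v, hv, by simpa using this.ne⟩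
  · have hdir : v₀ ∉ (affineSpan ℝ V).direction := by
      intro h
      apply haff
      have := AffineSubspace.vadd_mem_of_mem_direction (Submodule.neg_mem _ h)
        (subset_affineSpan ℝ V hv₀)
      simpa using this
    obtain ⟨f, hf, hker⟩ := Submodule.exists_le_ker_of_notMem hdir
    have hconst : ∀ v ∈ V, f v = f v₀ := by
      intro v hv
      have : v - v₀ ∈ LinearMap.ker f := hker (AffineSubspace.vsub_mem_direction
        (subset_affineSpan ℝ V hv) (subset_affineSpan ℝ V hv₀))
      rw [LinearMap.mem_ker, map_sub, sub_eq_zero] at this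
      exact this
    refine ⟨(f v₀) • f, fun v hv => ?_, v₀, hv₀, ?_⟩
    · rw [LinearMap.smul_apply, hconst v hv]
      exact mul_self_nonneg _
    · simpa using hf

/-- Duality for a convex set of pairs (position, value): without arbitrage in the positions, the
origin is a position, and an upper bound for the values at the origin extends to an affine upper
bound. -/
theorem exists_hedge_of_no_arbitrage {d : ℕ} {K : Set ((Fin d → ℝ) × ℝ)} (hK : Convex ℝ K)
    (hne : K.Nonempty)
    (hNA : ∀ h : Fin d → ℝ, (∀ k ∈ K, 0 ≤ ∑ i, h i * k.1 i) → ∀ k ∈ K, ∑ i, h i * k.1 i = 0) :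
    (∃ r, ((0 : Fin d → ℝ), r) ∈ K) ∧
    ∀ y : ℝ, (∀ r, ((0 : Fin d → ℝ), r) ∈ K → r ≤ y) →
      ∃ h : Fin d → ℝ, ∀ k ∈ K, k.2 + ∑ i, h i * k.1 i ≤ y := by
  have hlin : ∀ (f : (Fin d → ℝ) →ₗ[ℝ] ℝ) (v : Fin d → ℝ),
      f v = ∑ i, f (Pi.single i 1) * v i := fun f v => by
    rw [LinearMap.pi_apply_eq_sum_univ f v]
    refine Finset.sum_congr rfl fun i _ => ?_
    rw [smul_eq_mul, mul_comm]
    congr 2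
    ext j
    simp [Pi.single_apply, eq_comm]
  constructor
  · by_contra hcon
    have hV : Convex ℝ (Prod.fst '' K) := hK.linear_image (LinearMap.fst ℝ _ _)
    obtain ⟨f, hf, v, hv, hfv⟩ := exists_proper_separation hV (hne.image _) (by
      rintro ⟨k, hk, hk0⟩
      exact hcon ⟨k.2, by rwa [← hk0]⟩)
    obtain ⟨k, hk, rfl⟩ := hv
    apply hfv
    rw [hlin]
    refine hNA _ (fun k hk => ?_) k hk
    rw [← hlin]
    exact hf _ ⟨k, hk, rfl⟩
  · intro y hy
    set C : Set ((Fin d → ℝ) × ℝ) := {p | ∃ k ∈ K, p.1 = k.1 ∧ p.2 < k.2 - y} with hC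
    have hCconv : Convex ℝ C := by
      rintro p ⟨k, hk, h1, h2⟩ p' ⟨k', hk', h1', h2'⟩ a b ha hb hab
      refine ⟨a • k + b • k', hK hk hk' ha hb hab, by simp [h1, h1'], ?_⟩
      simp only [Prod.snd_add, Prod.smul_snd, smul_eq_mul]
      rcases ha.eq_or_lt with rfl | ha'
      · have : b = 1 := by linarith
        subst this; simpa using h2'
      · have e1 : a * p.2 < a * (k.2 - y) := mul_lt_mul_of_pos_left h2 ha'
        have e2 : b * p'.2 ≤ b * (k'.2 - y) := mul_le_mul_of_nonneg_left h2'.le hb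
        have : a * y + b * y = y := by rw [← add_mul, hab, one_mul]
        linarith
    obtain ⟨k₀, hk₀⟩ := hne
    obtain ⟨f, hf, p, hp, hfp⟩ := exists_proper_separation hCconv
      ⟨(k₀.1, k₀.2 - y - 1), k₀, hk₀, rfl, by linarith⟩ (by
        rintro ⟨k, hk, h1, h2⟩
        simp only [Prod.fst_zero, Prod.snd_zero] at h1 h2
        have := hy k.2 (by rw [h1]; exact hk)
        linarith)
    set α : ℝ := f (0, 1) with hα
    set g : (Fin d → ℝ) →ₗ[ℝ] ℝ := f.comp (LinearMap.inl ℝ _ _) with hg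
    have hfeq : ∀ v ρ, f (v, ρ) = g v + ρ * α := by
      intro v ρ
      have : ((v, ρ) : (Fin d → ℝ) × ℝ) = (v, 0) + ρ • (0, 1) := by simp
      rw [this, map_add, map_smul, smul_eq_mul]
      rfl
    have hfC : ∀ k ∈ K, ∀ ρ, ρ < k.2 - y → 0 ≤ g k.1 + ρ * α := fun k hk ρ hρ => by
      rw [← hfeq]
      exact hf _ ⟨k, hk, rfl, hρ⟩
    have hα0 : α ≤ 0 := by
      by_contra! hpos
      have h1 := hfC k₀ hk₀ (min (k₀.2 - y - 1) ((-g k₀.1 - 1) / α))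
        ((min_le_left _ _).trans_lt (by linarith))
      have h2 : min (k₀.2 - y - 1) ((-g k₀.1 - 1) / α) * α ≤ -g k₀.1 - 1 := by
        calc _ ≤ ((-g k₀.1 - 1) / α) * α :=
              mul_le_mul_of_nonneg_right (min_le_right _ _) hpos.le
          _ = _ := div_mul_cancel₀ _ hpos.ne'
      linarith
    have hαneg : α < 0 := by
      refine lt_of_le_of_ne hα0 fun hα00 => hfp ?_
      obtain ⟨k, hk, h1, h2⟩ := hp
      have : p = (p.1, p.2) := rfl
      rw [this, hfeq, hα00, mul_zero, add_zero, h1, hlin]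
      refine hNA _ (fun k hk => ?_) k hk
      have := hfC k hk (k.2 - y - 1) (by linarith)
      rwa [hα00, mul_zero, add_zero, hlin] at this
    refine ⟨fun i => g (Pi.single i 1) / α, fun k hk => ?_⟩
    have hsum : ∑ i, g (Pi.single i 1) / α * k.1 i = g k.1 / α := by
      rw [hlin g k.1, Finset.sum_div]
      exact Finset.sum_congr rfl fun i _ => by ring
    rw [hsum]
    have hlim : ∀ ρ, ρ < k.2 - y → ρ ≤ -(g k.1 / α) := fun ρ hρ => by
      have h1 := hfC k hk ρ hρ
      rw [← neg_div, le_div_iff_of_neg hαneg]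
      linarith
    have := le_of_forall_lt_imp_le_of_dense hlim
    linarith

/-! ### The one-step market at a fixed history -/

section OneStep

variable {Y : Type*} [MeasurableSpace Y] {d : ℕ}

/-- Probability measures dominated by the model set which integrate the increment. -/
def Adm (PS : Set (ProbabilityMeasure Y)) (D : Y → Fin d → ℝ) (ρ : Measure Y) : Prop :=
  IsProbabilityMeasure ρ ∧ (∃ P ∈ PS, ρ ≪ (P : Measure Y)) ∧ ∀ i, Integrable (fun y => D y i) ρ

/-- Pairs of a mean increment and a value strictly below `n - E[u n]` for some `n`. -/
def meanValueSet (PS : Set (ProbabilityMeasure Y)) (D : Y → Fin d → ℝ) (u : ℕ → Y → ℝ≥0∞) :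
    Set ((Fin d → ℝ) × ℝ) :=
  {k | ∃ ρ, Adm PS D ρ ∧ (∀ i, ∫ y, D y i ∂ρ = k.1 i) ∧
    ∃ n : ℕ, ∫⁻ y, u n y ∂ρ < ENNReal.ofReal (n - k.2)}

/-- The optimal one-step expected cost under martingale measures. -/
def stepCost (PS : Set (ProbabilityMeasure Y)) (D : Y → Fin d → ℝ) (u : Y → ℝ≥0∞) : ℝ≥0∞ :=
  ⨅ (ρ : Measure Y) (_ : Adm PS D ρ ∧ ∀ i, ∫ y, D y i ∂ρ = 0), ∫⁻ y, u y ∂ρ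

variable {PS : Set (ProbabilityMeasure Y)} {D : Y → Fin d → ℝ} {u : ℕ → Y → ℝ≥0∞}

theorem Adm.integrable_sum {ρ : Measure Y} (hρ : Adm PS D ρ) (h : Fin d → ℝ) :
    Integrable (fun y => ∑ i, h i * D y i) ρ :=
  integrable_finsetSum _ fun i _ => (hρ.2.2 i).const_mul _

theorem Adm.integral_sum {ρ : Measure Y} (hρ : Adm PS D ρ) (h : Fin d → ℝ) :
    ∫ y, ∑ i, h i * D y i ∂ρ = ∑ i, h i * ∫ y, D y i ∂ρ := by
  rw [integral_finsetSum _ fun i _ => (hρ.2.2 i).const_mul _]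
  simp only [integral_const_mul]

theorem lintegral_shift_lt {ρ : Measure Y} [IsProbabilityMeasure ρ]
    (hmono : ∀ n m : ℕ, n ≤ m → ∀ y, u m y ≤ u n y + ((m - n : ℕ) : ℝ≥0∞)) {n m : ℕ}
    (hnm : n ≤ m) {r : ℝ} (h : ∫⁻ y, u n y ∂ρ < ENNReal.ofReal (n - r)) :
    ∫⁻ y, u m y ∂ρ < ENNReal.ofReal (m - r) := by
  have hpos : 0 < (n : ℝ) - r := ENNReal.ofReal_pos.1 (pos_of_gt h)
  calc ∫⁻ y, u m y ∂ρ ≤ ∫⁻ y, (u n y + ((m - n : ℕ) : ℝ≥0∞)) ∂ρ := lintegral_mono (hmono n m hnm)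
    _ = ∫⁻ y, u n y ∂ρ + ((m - n : ℕ) : ℝ≥0∞) := by
        rw [lintegral_add_right _ measurable_const]; simp
    _ < ENNReal.ofReal (n - r) + ((m - n : ℕ) : ℝ≥0∞) :=
        ENNReal.add_lt_add_right (by simp) h
    _ = ENNReal.ofReal (m - r) := by
        rw [← ENNReal.ofReal_natCast, ← ENNReal.ofReal_add hpos.le (by positivity),
          Nat.cast_sub hnm]
        congr 1; ring

theorem exists_half_sum_mem (hconv : ConvexPM PS) {P₁ P₂ : ProbabilityMeasure Y} (h₁ : P₁ ∈ PS)
    (h₂ : P₂ ∈ PS) : ∃ P ∈ PS, (P₁ : Measure Y) ≪ P ∧ (P₂ : Measure Y) ≪ P := by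
  set μ : Measure Y := (2⁻¹ : ℝ≥0∞) • (P₁ : Measure Y) + (2⁻¹ : ℝ≥0∞) • (P₂ : Measure Y) with hμ
  have hprob : IsProbabilityMeasure μ := ⟨by simp [hμ, ENNReal.inv_two_add_inv_two]⟩
  refine ⟨⟨μ, hprob⟩, hconv P₁ h₁ P₂ h₂ 2⁻¹ 2⁻¹ ENNReal.inv_two_add_inv_two _ rfl, ?_, ?_⟩
  · intro s hs
    simp only [ProbabilityMeasure.coe_mk, hμ, Measure.add_apply, Measure.smul_apply, smul_eq_mul,
      add_eq_zero, mul_eq_zero, ENNReal.inv_eq_zero, ENNReal.ofNat_ne_top, false_or] at hs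
    exact hs.1
  · intro s hs
    simp only [ProbabilityMeasure.coe_mk, hμ, Measure.add_apply, Measure.smul_apply, smul_eq_mul,
      add_eq_zero, mul_eq_zero, ENNReal.inv_eq_zero, ENNReal.ofNat_ne_top, false_or] at hs
    exact hs.2

theorem integrable_ofReal_smul_add {ρ₁ ρ₂ : Measure Y} {f : Y → ℝ} (h₁ : Integrable f ρ₁)
    (h₂ : Integrable f ρ₂) {a b : ℝ} (ha : 0 ≤ a) (hb : 0 ≤ b) :
    Integrable f (ENNReal.ofReal a • ρ₁ + ENNReal.ofReal b • ρ₂) ∧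
    ∫ y, f y ∂(ENNReal.ofReal a • ρ₁ + ENNReal.ofReal b • ρ₂)
      = a * ∫ y, f y ∂ρ₁ + b * ∫ y, f y ∂ρ₂ := by
  have i₁ : Integrable f (ENNReal.ofReal a • ρ₁) := h₁.smul_measure ENNReal.ofReal_ne_top
  have i₂ : Integrable f (ENNReal.ofReal b • ρ₂) := h₂.smul_measure ENNReal.ofReal_ne_top
  refine ⟨i₁.add_measure i₂, ?_⟩
  rw [integral_add_measure i₁ i₂, integral_smul_measure, integral_smul_measure,
    ENNReal.toReal_ofReal ha, ENNReal.toReal_ofReal hb, smul_eq_mul, smul_eq_mul]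

theorem isProbabilityMeasure_ofReal_smul_add {ρ₁ ρ₂ : Measure Y} [IsProbabilityMeasure ρ₁]
    [IsProbabilityMeasure ρ₂] {a b : ℝ} (ha : 0 ≤ a) (hb : 0 ≤ b) (hab : a + b = 1) :
    IsProbabilityMeasure (ENNReal.ofReal a • ρ₁ + ENNReal.ofReal b • ρ₂) :=
  ⟨by simp [← ENNReal.ofReal_add ha hb, hab]⟩

theorem absolutelyContinuous_smul_add {ρ₁ ρ₂ P : Measure Y} (h₁ : ρ₁ ≪ P) (h₂ : ρ₂ ≪ P)
    (a b : ℝ≥0∞) : a • ρ₁ + b • ρ₂ ≪ P := by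
  intro s hs
  simp [h₁ hs, h₂ hs]

theorem convex_meanValueSet (hconv : ConvexPM PS)
    (hmono : ∀ n m : ℕ, n ≤ m → ∀ y, u m y ≤ u n y + ((m - n : ℕ) : ℝ≥0∞)) :
    Convex ℝ (meanValueSet PS D u) := by
  rintro k₁ ⟨ρ₁, hρ₁, hD₁, n₁, hn₁⟩ k₂ ⟨ρ₂, hρ₂, hD₂, n₂, hn₂⟩ a b ha hb hab
  obtain ⟨hp₁, ⟨P₁, hP₁, hρP₁⟩, hi₁⟩ := hρ₁
  obtain ⟨hp₂, ⟨P₂, hP₂, hρP₂⟩, hi₂⟩ := hρ₂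
  obtain ⟨P, hP, hPP₁, hPP₂⟩ := exists_half_sum_mem hconv hP₁ hP₂
  have hn₁' := lintegral_shift_lt hmono (le_max_left n₁ n₂) hn₁
  have hn₂' := lintegral_shift_lt hmono (le_max_right n₁ n₂) hn₂
  refine ⟨ENNReal.ofReal a • ρ₁ + ENNReal.ofReal b • ρ₂,
    ⟨isProbabilityMeasure_ofReal_smul_add ha hb hab, ⟨P, hP, absolutelyContinuous_smul_add
      (hρP₁.trans hPP₁) (hρP₂.trans hPP₂) _ _⟩, fun i =>
      (integrable_ofReal_smul_add (hi₁ i) (hi₂ i) ha hb).1⟩, fun i => ?_, max n₁ n₂, ?_⟩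
  · rw [(integrable_ofReal_smul_add (hi₁ i) (hi₂ i) ha hb).2, hD₁, hD₂]
    simp
  · rw [lintegral_add_measure, lintegral_smul_measure, lintegral_smul_measure]
    simp only [Prod.snd_add, Prod.smul_snd, smul_eq_mul]
    set N := max n₁ n₂
    have q₁ : 0 < (N : ℝ) - k₁.2 := ENNReal.ofReal_pos.1 (pos_of_gt hn₁')
    have q₂ : 0 < (N : ℝ) - k₂.2 := ENNReal.ofReal_pos.1 (pos_of_gt hn₂')
    have heq : (N : ℝ) - (a * k₁.2 + b * k₂.2) = a * (N - k₁.2) + b * (N - k₂.2) := by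
      have : (N : ℝ) = a * N + b * N := by rw [← add_mul, hab, one_mul]
      linarith
    rw [heq, ENNReal.ofReal_add (by positivity) (by positivity), ENNReal.ofReal_mul ha,
      ENNReal.ofReal_mul hb]
    rcases ha.eq_or_lt with rfl | ha'
    · have : b = 1 := by linarith
      subst this; simpa using hn₂'
    · exact ENNReal.add_lt_add_of_lt_of_le
        (ENNReal.mul_ne_top ENNReal.ofReal_ne_top (hn₂'.trans ENNReal.ofReal_lt_top).ne)
        (ENNReal.mul_lt_mul_right (by simpa using ha') ENNReal.ofReal_ne_top hn₁')
        (by gcongr)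

/-- Conditioning a model on a non-null event on which the cost is finite. -/
theorem exists_adm_of_measure_ne_zero (hD : Measurable D) {v : Y → ℝ≥0∞}
    (hv : Measurable[univComp Y] v) {P : ProbabilityMeasure Y} (hP : P ∈ PS) {B : Set Y}
    (hB : MeasurableSet[univComp Y] B) (hBv : ∀ y ∈ B, v y < ⊤) (hPB : (P : Measure Y) B ≠ 0) :
    ∃ ρ, Adm PS D ρ ∧ (∀ᵐ y ∂ρ, y ∈ B) ∧ ∫⁻ y, v y ∂ρ ≠ ⊤ := by
  let C : ℕ → Set Y := fun k => B ∩ ({y | v y ≤ k} ∩ {y | ‖D y‖ ≤ k})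
  have hC : ∀ k, NullMeasurableSet (C k) (P : Measure Y) := fun k =>
    (hB _ inferInstance).inter ((nullMeasurableSet_le (aemeasurable_of_measurable_univComp hv _)
      aemeasurable_const).inter (measurableSet_le hD.norm measurable_const).nullMeasurableSet)
  have hBC : B = ⋃ k, C k := by
    ext y
    simp only [C, mem_iUnion, mem_inter_iff]
    refine ⟨fun hy => ?_, fun ⟨k, h, _⟩ => h⟩
    obtain ⟨k₁, hk₁⟩ := ENNReal.exists_nat_gt (hBv y hy).ne
    obtain ⟨k₂, hk₂⟩ := exists_nat_ge ‖D y‖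
    refine ⟨max k₁ k₂, hy, ?_, ?_⟩
    · refine Set.mem_ofPred_eq ▸ (hk₁.le.trans ?_)
      exact_mod_cast le_max_left k₁ k₂
    · refine Set.mem_ofPred_eq ▸ (hk₂.trans ?_)
      exact_mod_cast le_max_right k₁ k₂
  obtain ⟨k, hk⟩ : ∃ k, (P : Measure Y) (C k) ≠ 0 := by
    by_contra! hcon
    exact hPB (by rw [hBC]; exact measure_iUnion_null hcon)
  have hprob : IsProbabilityMeasure (ProbabilityTheory.cond (P : Measure Y) (C k)) :=
    ProbabilityTheory.cond_isProbabilityMeasure hk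
  have hmem : ∀ᵐ y ∂(ProbabilityTheory.cond (P : Measure Y) (C k)), y ∈ C k :=
    Measure.ae_smul_measure (ae_restrict_mem₀ (hC k)) _
  refine ⟨ProbabilityTheory.cond (P : Measure Y) (C k), ⟨hprob, ⟨P, hP,
    ProbabilityTheory.cond_absolutelyContinuous⟩, fun i => ?_⟩, hmem.mono fun y hy => hy.1, ?_⟩
  · refine Integrable.of_bound (C := k) (by fun_prop) ?_
    filter_upwards [hmem] with y hy
    exact (norm_le_pi_norm (D y) i).trans hy.2.2
  · refine ne_top_of_le_ne_top (b := (k : ℝ≥0∞)) (by simp) ?_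
    calc _ ≤ ∫⁻ _, (k : ℝ≥0∞) ∂(ProbabilityTheory.cond (P : Measure Y) (C k)) :=
          lintegral_mono_ae (hmem.mono fun y hy => hy.2.1)
      _ = k := by simp

theorem mem_meanValueSet_of_lintegral_ne_top {ρ : Measure Y} (hρ : Adm PS D ρ) {n : ℕ}
    (hn : ∫⁻ y, u n y ∂ρ ≠ ⊤) : ∃ r, ((fun i => ∫ y, D y i ∂ρ), r) ∈ meanValueSet PS D u := by
  refine ⟨n - ((∫⁻ y, u n y ∂ρ).toReal + 1), ρ, hρ, fun i => rfl, n, ?_⟩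
  rw [sub_sub_cancel, ENNReal.ofReal_add ENNReal.toReal_nonneg zero_le_one,
    ENNReal.ofReal_toReal hn]
  exact ENNReal.lt_add_right hn (by simp)

variable (hD : Measurable D) (hu : ∀ n, Measurable[univComp Y] (u n))

include hD in
theorem measurable_univComp_sum (h : Fin d → ℝ) :
    Measurable[univComp Y] fun y => ∑ i, h i * D y i := by
  have : Measurable fun y => ∑ i, h i * D y i := by fun_prop
  exact fun s hs μ _ => (this hs).nullMeasurableSet

include hD hu

theorem meanValueSet_nonempty {P : ProbabilityMeasure Y} (hP : P ∈ PS)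
    (hA : (P : Measure Y) {y | ∃ n, u n y < ⊤} ≠ 0) : (meanValueSet PS D u).Nonempty := by
  obtain ⟨n, hn⟩ : ∃ n, (P : Measure Y) {y | u n y < ⊤} ≠ 0 := by
    by_contra! hcon
    refine hA ?_
    have : {y | ∃ n, u n y < ⊤} = ⋃ n, {y | u n y < ⊤} := by ext; simp
    rw [this]
    exact measure_iUnion_null hcon
  obtain ⟨ρ, hρ, -, hρn⟩ := exists_adm_of_measure_ne_zero hD (hu n) hP
    (hu n measurableSet_Iio) (fun y hy => hy) hn
  obtain ⟨r, hr⟩ := mem_meanValueSet_of_lintegral_ne_top hρ hρn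
  exact ⟨_, hr⟩

/-- A position with nonnegative mean increments is almost surely nonnegative where the cost is
finite. -/
theorem ae_nonneg_of_meanValueSet {h : Fin d → ℝ}
    (hh : ∀ k ∈ meanValueSet PS D u, 0 ≤ ∑ i, h i * k.1 i) {P : ProbabilityMeasure Y}
    (hP : P ∈ PS) :
    ∀ᵐ y ∂(P : Measure Y), (∃ n, u n y < ⊤) → 0 ≤ ∑ i, h i * D y i := by
  have key : ∀ n, ∀ᵐ y ∂(P : Measure Y), u n y < ⊤ → 0 ≤ ∑ i, h i * D y i := by
    intro n
    by_contra hcon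
    obtain ⟨ρ, hρ, hρB, hρn⟩ := exists_adm_of_measure_ne_zero
      (B := {y | u n y < ⊤} ∩ {y | ∑ i, h i * D y i < 0}) hD (hu n) hP
      (@MeasurableSet.inter _ (univComp Y) _ _ (hu n measurableSet_Iio)
        (measurable_univComp_sum hD h measurableSet_Iio)) (fun y hy => hy.1) (by
        intro h0
        apply hcon
        rw [ae_iff]
        convert! h0 using 2
        ext y
        simp)
    obtain ⟨r, hr⟩ := mem_meanValueSet_of_lintegral_ne_top hρ hρn
    have h1 := hh _ hr
    simp only [← hρ.integral_sum] at h1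
    have := hρ.1
    have h2 : 0 ≤ᵐ[ρ] fun y => - ∑ i, h i * D y i := hρB.mono fun y hy =>
      neg_nonneg.2 (le_of_lt hy.2)
    have h3 : ∫ y, - ∑ i, h i * D y i ∂ρ = 0 :=
      le_antisymm (by rw [integral_neg]; linarith) (integral_nonneg_of_ae h2)
    rw [integral_eq_zero_iff_of_nonneg_ae h2 (hρ.integrable_sum h).neg] at h3
    obtain ⟨y, hy1, hy2⟩ := (hρB.and h3).exists
    have hy3 : ∑ i, h i * D y i < 0 := hy1.2
    simp only [Pi.zero_apply, neg_eq_zero] at hy2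
    linarith
  filter_upwards [ae_all_iff.2 key] with y hy ⟨n, hn⟩ using hy n hn

omit hD in
/-- A dominated measure with positive mean gain reveals a model under which the gain is positive
with positive probability. -/
theorem measure_pos_of_mean_pos {h : Fin d → ℝ} {ρ : Measure Y} (hρ : Adm PS D ρ) {n : ℕ}
    (hn : ∫⁻ y, u n y ∂ρ ≠ ⊤) (hpos : 0 < ∑ i, h i * ∫ y, D y i ∂ρ) {P : Measure Y}
    (hρP : ρ ≪ P) :
    P {y | (∃ n, u n y < ⊤) ∧ 0 < ∑ i, h i * D y i} ≠ 0 := by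
  intro h0
  have h1 : ∀ᵐ y ∂ρ, ¬ ((∃ n, u n y < ⊤) ∧ 0 < ∑ i, h i * D y i) := by
    rw [ae_iff]
    simpa using hρP h0
  have := hρ.1
  have h2 : ∀ᵐ y ∂ρ, u n y < ⊤ :=
    ae_lt_top' (aemeasurable_of_measurable_univComp (hu n) ρ) hn
  have h3 : ∫ y, ∑ i, h i * D y i ∂ρ ≤ 0 := integral_nonpos_of_ae (by
    filter_upwards [h1, h2] with y hy1 hy2
    exact not_lt.1 fun h => hy1 ⟨⟨n, hy2⟩, h⟩)
  rw [hρ.integral_sum] at h3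
  linarith

/-- An affine bound on the mean-value set is a superhedge for every model. -/
theorem ae_hedge_of_meanValueSet {h : Fin d → ℝ} {c : ℝ}
    (hh : ∀ k ∈ meanValueSet PS D u, k.2 + ∑ i, h i * k.1 i ≤ c) {P : ProbabilityMeasure Y}
    (hP : P ∈ PS) :
    ∀ᵐ y ∂(P : Measure Y), ∀ n : ℕ, ENNReal.ofReal (n - (c - ∑ i, h i * D y i)) ≤ u n y := by
  rw [ae_all_iff]
  intro n
  by_contra hcon
  set ℓ : Y → ℝ := fun y => n - (c - ∑ i, h i * D y i) with hℓ
  have hℓm : Measurable ℓ := by fun_prop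
  obtain ⟨ρ, hρ, hρB, hρn⟩ := exists_adm_of_measure_ne_zero
    (B := {y | u n y < ENNReal.ofReal (ℓ y)}) hD (hu n) hP
    (by
      refine fun μ _ => nullMeasurableSet_lt (aemeasurable_of_measurable_univComp (hu n) μ)
        (by fun_prop))
    (fun y hy => (show u n y < ENNReal.ofReal (ℓ y) from hy).trans ENNReal.ofReal_lt_top) (by
      intro h0
      apply hcon
      rw [ae_iff]
      simpa using h0)
  have := hρ.1
  have hInt : Integrable ℓ ρ :=
    (integrable_const _).sub ((integrable_const _).sub (hρ.integrable_sum h))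
  have hℓ0 : 0 ≤ᵐ[ρ] ℓ := hρB.mono fun y hy =>
    (ENNReal.ofReal_pos.1 (pos_of_gt (show u n y < ENNReal.ofReal (ℓ y) from hy))).le
  have h1 : ∫⁻ y, u n y ∂ρ < ∫⁻ y, ENNReal.ofReal (ℓ y) ∂ρ :=
    lintegral_strict_mono (NeZero.ne ρ) (by fun_prop) hρn hρB
  rw [← ofReal_integral_eq_lintegral_ofReal hInt hℓ0] at h1
  have h2 : ∫ y, ℓ y ∂ρ = n - (c - ∑ i, h i * ∫ y, D y i ∂ρ) := by
    simp only [hℓ]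
    have hc : Integrable (fun y => c - ∑ i, h i * D y i) ρ :=
      (integrable_const _).sub (hρ.integrable_sum h)
    rw [integral_sub (integrable_const _) hc, integral_sub (integrable_const _) (hρ.integrable_sum h), hρ.integral_sum]
    simp
  obtain ⟨q, hq1, hq2⟩ := exists_between h1
  have hqt : q ≠ ⊤ := (hq2.trans ENNReal.ofReal_lt_top).ne
  have h3 := hh ((fun i => ∫ y, D y i ∂ρ), n - q.toReal) ⟨ρ, hρ, fun i => rfl, n, by
    rwa [sub_sub_cancel, ENNReal.ofReal_toReal hqt]⟩
  simp only at h3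
  have h4 : q.toReal < ∫ y, ℓ y ∂ρ := by
    rw [ENNReal.lt_ofReal_iff_toReal_lt hqt] at hq2
    exact hq2
  linarith

omit hD hu

theorem le_of_stepCost {c : ℝ} (hc : ∀ n : ℕ, ENNReal.ofReal (n - c) ≤ stepCost PS D (u n)) {r : ℝ}
    (hr : ((0 : Fin d → ℝ), r) ∈ meanValueSet PS D u) : r ≤ c := by
  obtain ⟨ρ, hρ, hD, n, hn⟩ := hr
  have h1 : stepCost PS D (u n) ≤ ∫⁻ y, u n y ∂ρ := iInf₂_le ρ ⟨hρ, fun i => hD i⟩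
  have h2 := ((hc n).trans h1).trans_lt hn
  rw [ENNReal.ofReal_lt_ofReal_iff (ENNReal.ofReal_pos.1 (pos_of_gt h2))] at h2
  linarith

theorem stepCost_lt_top {r : ℝ} (hr : ((0 : Fin d → ℝ), r) ∈ meanValueSet PS D u) :
    ∃ n, stepCost PS D (u n) < ⊤ := by
  obtain ⟨ρ, hρ, hD, n, hn⟩ := hr
  have h1 : stepCost PS D (u n) ≤ ∫⁻ y, u n y ∂ρ := iInf₂_le ρ ⟨hρ, fun i => hD i⟩
  exact ⟨n, h1.trans_lt (hn.trans ENNReal.ofReal_lt_top)⟩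

theorem stepCost_le_add (hmono : ∀ n m : ℕ, n ≤ m → ∀ y, u m y ≤ u n y + ((m - n : ℕ) : ℝ≥0∞))
    {n m : ℕ} (hnm : n ≤ m) :
    stepCost PS D (u m) ≤ stepCost PS D (u n) + ((m - n : ℕ) : ℝ≥0∞) := by
  rw [stepCost, stepCost, ENNReal.iInf_add]
  refine le_iInf fun ρ => ?_
  rw [ENNReal.iInf_add]
  refine le_iInf fun hρ => ?_
  have := hρ.1.1
  calc _ ≤ ∫⁻ y, u m y ∂ρ := iInf₂_le ρ hρ
    _ ≤ ∫⁻ y, (u n y + ((m - n : ℕ) : ℝ≥0∞)) ∂ρ := lintegral_mono (hmono n m hnm)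
    _ = _ := by rw [lintegral_add_right _ measurable_const]; simp

end OneStep

/-! ### Measurable selection of affine majorants -/

section AffineMajorant

variable {X : Type*} {d : ℕ}

/-- The slopes `h` for which `k ↦ k.2 + h · k.1` is bounded by `c` on `K`. -/
def slopes (K : Set ((Fin d → ℝ) × ℝ)) (c : ℝ) : Set (Fin d → ℝ) :=
  {h | ∀ k ∈ K, k.2 + ∑ i, h i * k.1 i ≤ c}

theorem isClosed_slopes (K : Set ((Fin d → ℝ) × ℝ)) (c : ℝ) : IsClosed (slopes K c) := by
  simp only [slopes, ofPred_forall]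
  exact isClosed_iInter fun k => isClosed_iInter fun _ =>
    isClosed_le (by fun_prop) continuous_const

/-- Compactness criterion for the existence of a majorant slope in a compact set. -/
theorem slopes_inter_nonempty_iff {K : Set ((Fin d → ℝ) × ℝ)} {c : ℝ} {C : Set (Fin d → ℝ)}
    (hC : IsCompact C) :
    (slopes K c ∩ C).Nonempty ↔ ∀ m : ℕ, ∃ j : ℕ,
      TopologicalSpace.denseSeq (Fin d → ℝ) j ∈ Metric.thickening (1 / (m + 1 : ℝ)) C ∧
      ¬ (K ∩ {k | c < k.2 + ∑ i, TopologicalSpace.denseSeq (Fin d → ℝ) j i * k.1 i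
        - 1 / (m + 1 : ℝ) * ∑ i, |k.1 i|}).Nonempty := by
  constructor
  · rintro ⟨h₀, hh₀, hC₀⟩ m
    have hm : (0 : ℝ) < 1 / (m + 1 : ℝ) := by positivity
    obtain ⟨_, hj, ⟨j, rfl⟩⟩ := Metric.dense_iff.1
      (TopologicalSpace.denseRange_denseSeq (Fin d → ℝ)) h₀ _ hm
    rw [Metric.mem_ball] at hj
    refine ⟨j, Metric.mem_thickening_iff.2 ⟨h₀, hC₀, hj⟩, ?_⟩
    rintro ⟨k, hk, hlt⟩
    rw [Set.mem_ofPred_eq] at hlt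
    have h1 := hh₀ k hk
    have h2 : ∑ i, TopologicalSpace.denseSeq (Fin d → ℝ) j i * k.1 i - ∑ i, h₀ i * k.1 i
        ≤ 1 / (m + 1 : ℝ) * ∑ i, |k.1 i| := by
      rw [← Finset.sum_sub_distrib, Finset.mul_sum]
      refine Finset.sum_le_sum fun i _ => ?_
      rw [← sub_mul]
      refine (le_abs_self _).trans ?_
      rw [abs_mul]
      refine mul_le_mul_of_nonneg_right ?_ (abs_nonneg _)
      rw [← Real.dist_eq]
      exact (dist_le_pi_dist _ _ i).trans hj.le
    linarith
  · intro h
    choose j hj hK using h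
    choose a haC ha using fun m => Metric.mem_thickening_iff.1 (hj m)
    obtain ⟨b, hbC, φ, hφ, hlim⟩ := hC.tendsto_subseq haC
    have hε : Tendsto (fun m : ℕ => 1 / (m + 1 : ℝ)) atTop (𝓝 0) :=
      tendsto_one_div_add_atTop_nhds_zero_nat
    have hεφ := hε.comp hφ.tendsto_atTop
    have hj' : Tendsto (fun m => TopologicalSpace.denseSeq (Fin d → ℝ) (j (φ m))) atTop (𝓝 b) := by
      rw [tendsto_iff_dist_tendsto_zero] at hlim ⊢
      refine squeeze_zero (fun _ => dist_nonneg) (fun m => ?_) (by simpa only [zero_add] using hεφ.add hlim)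
      exact (dist_triangle _ (a (φ m)) _).trans (add_le_add (ha (φ m)).le le_rfl)
    refine ⟨b, fun k hk => ?_, hbC⟩
    have hle : ∀ m, k.2 + ∑ i, TopologicalSpace.denseSeq (Fin d → ℝ) (j (φ m)) i * k.1 i
        - 1 / ((φ m : ℕ) + 1 : ℝ) * ∑ i, |k.1 i| ≤ c := fun m =>
      not_lt.1 fun hlt => hK (φ m) ⟨k, hk, hlt⟩
    have hlim2 : Tendsto (fun m => k.2 + ∑ i, TopologicalSpace.denseSeq (Fin d → ℝ) (j (φ m)) i
        * k.1 i - 1 / ((φ m : ℕ) + 1 : ℝ) * ∑ i, |k.1 i|) atTop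
        (𝓝 (k.2 + ∑ i, b i * k.1 i - 0 * ∑ i, |k.1 i|)) := by
      refine (tendsto_const_nhds.add (tendsto_finsetSum _ fun i _ => ?_)).sub
        (hεφ.mul tendsto_const_nhds)
      exact (((continuous_apply i).tendsto b).comp hj').mul tendsto_const_nhds
    simpa using le_of_tendsto' hlim2 hle

variable [MeasurableSpace X] {K : X → Set ((Fin d → ℝ) × ℝ)} {c : X → ℝ}
  (hK : ∀ O, IsOpen O → MeasurableSet {x | (K x ∩ O).Nonempty}) (hc : Measurable c)

include hK hc

theorem measurableSet_slopes_inter (O : Set (Fin d → ℝ)) (hO : IsOpen O) :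
    MeasurableSet {x | (slopes (K x) (c x) ∩ O).Nonempty} := by
  have hcomp : ∀ C : Set (Fin d → ℝ), IsCompact C →
      MeasurableSet {x | (slopes (K x) (c x) ∩ C).Nonempty} := by
    intro C hC
    simp only [slopes_inter_nonempty_iff hC, ofPred_forall, ofPred_exists]
    refine MeasurableSet.iInter fun m => MeasurableSet.iUnion fun j =>
      (MeasurableSet.const _).inter (MeasurableSet.compl ?_)
    set θ : (Fin d → ℝ) × ℝ → ℝ := fun k => k.2 + ∑ i, TopologicalSpace.denseSeq (Fin d → ℝ) j i
      * k.1 i - 1 / (m + 1 : ℝ) * ∑ i, |k.1 i| with hθ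
    have hθc : Continuous θ := by fun_prop
    have : {x | (K x ∩ {k | c x < θ k}).Nonempty}
        = ⋃ q : ℚ, {x | c x < q} ∩ {x | (K x ∩ {k | (q : ℝ) < θ k}).Nonempty} := by
      ext x
      simp only [mem_iUnion, mem_inter_iff, Set.mem_ofPred_eq]
      constructor
      · rintro ⟨k, hk, hlt⟩
        obtain ⟨q, hq1, hq2⟩ := exists_rat_btwn (show c x < θ k from hlt)
        exact ⟨q, hq1, k, hk, hq2⟩
      · rintro ⟨q, hq1, k, hk, hq2⟩
        exact ⟨k, hk, lt_trans hq1 hq2⟩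
    change MeasurableSet {x | (K x ∩ {k | c x < θ k}).Nonempty}
    rw [this]
    exact MeasurableSet.iUnion fun q => (measurableSet_lt hc measurable_const).inter
      (hK _ (isOpen_lt continuous_const hθc))
  obtain ⟨F, hF, -, hFO, -⟩ := hO.exists_iUnion_isClosed
  have : {x | (slopes (K x) (c x) ∩ O).Nonempty} = ⋃ n : ℕ, ⋃ r : ℕ,
      {x | (slopes (K x) (c x) ∩ (F n ∩ Metric.closedBall 0 r)).Nonempty} := by
    ext x
    simp only [mem_iUnion, Set.mem_ofPred_eq, ← hFO]
    constructor
    · rintro ⟨h, hh, hhF⟩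
      obtain ⟨n, hn⟩ := mem_iUnion.1 hhF
      obtain ⟨r, hr⟩ := exists_nat_ge ‖h‖
      exact ⟨n, r, h, hh, hn, by simpa using hr⟩
    · rintro ⟨n, r, h, hh, hn, -⟩
      exact ⟨h, hh, mem_iUnion.2 ⟨n, hn⟩⟩
  rw [this]
  exact MeasurableSet.iUnion fun n => MeasurableSet.iUnion fun r =>
    hcomp _ ((isCompact_closedBall 0 _).inter_left (hF n))

theorem exists_measurable_slope :
    ∃ h : X → Fin d → ℝ, Measurable h ∧
      ∀ x, (slopes (K x) (c x)).Nonempty → h x ∈ slopes (K x) (c x) :=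
  exists_measurable_selector (fun _ => isClosed_slopes _ _)
    (measurableSet_slopes_inter hK hc)

end AffineMajorant

/-! ### The one-step market, measurably in the history -/

set_option linter.unusedSectionVars false

section Parametrized

open ProbabilityTheory

variable {X Y : Type*} [TopologicalSpace X] [PolishSpace X] [MeasurableSpace X] [BorelSpace X]
  [TopologicalSpace Y] [PolishSpace Y] [MeasurableSpace Y] [BorelSpace Y] {d : ℕ}

/-- A continuous parametrization of the graph of a set-valued map of probability measures. -/
structure IsParam (Pt : X → Set (ProbabilityMeasure Y)) (p : (ℕ → ℕ) → X)
    (q : (ℕ → ℕ) → ProbabilityMeasure Y) : Prop where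
  continuous_fst : Continuous p
  continuous_snd : Continuous q
  mem_iff : ∀ x P, P ∈ Pt x ↔ ∃ z, p z = x ∧ q z = P

theorem exists_isParam [Nonempty X] {Pt : X → Set (ProbabilityMeasure Y)}
    (hne : ∀ x, (Pt x).Nonempty)
    (hgraph : AnalyticSet {a : X × ProbabilityMeasure Y | a.2 ∈ Pt a.1}) :
    ∃ p q, IsParam Pt p q := by
  rw [AnalyticSet] at hgraph
  rcases hgraph with h0 | ⟨ψ, hψ, hr⟩
  · obtain ⟨x⟩ := ‹Nonempty X›
    obtain ⟨P, hP⟩ := hne x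
    have : (x, P) ∈ {a : X × ProbabilityMeasure Y | a.2 ∈ Pt a.1} := hP
    simp [h0] at this
  · refine ⟨fun z => (ψ z).1, fun z => (ψ z).2, by fun_prop, by fun_prop, fun x P => ?_⟩
    have : P ∈ Pt x ↔ (x, P) ∈ range ψ := by rw [hr]; rfl
    rw [this]
    exact ⟨fun ⟨z, hz⟩ => ⟨z, by simp [hz]⟩, fun ⟨z, h1, h2⟩ => ⟨z, Prod.ext h1 h2⟩⟩

variable {Pt : X → Set (ProbabilityMeasure Y)} {p : (ℕ → ℕ) → X}
  {q : (ℕ → ℕ) → ProbabilityMeasure Y}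

theorem IsParam.measurable_coe (h : IsParam Pt p q) : Measurable fun z => (q z : Measure Y) := by
  have h1 : Measurable[MeasurableSpace.pi, borel (ProbabilityMeasure Y)] q := by
    rw [BorelSpace.measurable_eq (α := ℕ → ℕ)]
    exact h.continuous_snd.borel_measurable
  exact @Measurable.comp _ _ _ _ (borel _) _ _ _ measurable_coe_borel_probabilityMeasure h1

/-- The models of a parametrization as a kernel. -/
def IsParam.kernel (h : IsParam Pt p q) : Kernel (ℕ → ℕ) Y := ⟨fun z => q z, h.measurable_coe⟩

instance (h : IsParam Pt p q) : IsMarkovKernel h.kernel :=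
  ⟨fun z => inferInstanceAs (IsProbabilityMeasure (q z : Measure Y))⟩

theorem IsParam.measurable_comp (h : IsParam Pt p q) {z : X → ℕ → ℕ}
    (hz : Measurable[univComp X] z) :
    Measurable[univComp X, borel (ProbabilityMeasure Y)] fun x => q (z x) := by
  have h1 : Measurable[MeasurableSpace.pi, borel (ProbabilityMeasure Y)] q := by
    rw [BorelSpace.measurable_eq (α := ℕ → ℕ)]
    exact h.continuous_snd.borel_measurable
  exact @Measurable.comp _ _ _ (univComp X) _ (borel _) _ _ h1 hz

variable [Nonempty Y] {D : X × Y → Fin d → ℝ}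

variable (p q D) in
/-- Codes of admissible measures, together with the parameter of a dominating model. -/
def admRel : Set (X × ((ℕ → ℕ) × (ℚ → ℝ))) :=
  {a | p a.2.1 = a.1 ∧ decode Y a.2.2 ≪ (q a.2.1 : Measure Y) ∧
    ∀ i, Integrable (fun y => D (a.1, y) i) (decode Y a.2.2)}

variable (D) in
/-- The mean increment of a coded measure. -/
def codedMean (a : X × ((ℕ → ℕ) × (ℚ → ℝ))) (i : Fin d) : ℝ :=
  ∫ y, D (a.1, y) i ∂(decode Y a.2.2)

theorem adm_iff (h : IsParam Pt p q) {x : X} {ρ : Measure Y} :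
    Adm (Pt x) (fun y => D (x, y)) ρ ↔ ∃ e, (x, e) ∈ admRel p q D ∧ decode Y e.2 = ρ := by
  constructor
  · rintro ⟨hρ, ⟨P, hP, hac⟩, hi⟩
    obtain ⟨z, rfl, rfl⟩ := (h.mem_iff _ _).1 hP
    exact ⟨(z, code Y ρ), ⟨rfl, by rwa [decode_code], by rwa [decode_code]⟩, decode_code ρ⟩
  · rintro ⟨⟨z, w⟩, ⟨h1, h2, h3⟩, rfl⟩
    exact ⟨inferInstance, ⟨q z, (h.mem_iff _ _).2 ⟨z, h1, rfl⟩, h2⟩, h3⟩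

theorem stronglyMeasurable_coded (hD : Measurable D) (i : Fin d) :
    StronglyMeasurable (Function.uncurry
      fun (a : X × ((ℕ → ℕ) × (ℚ → ℝ))) (y : Y) => D (a.1, y) i) := by
  refine Measurable.stronglyMeasurable ?_
  simp only [Function.uncurry_def]
  fun_prop

theorem measurable_codedMean (hD : Measurable D) : Measurable (codedMean D) := by
  refine measurable_pi_iff.2 fun i => ?_
  exact (StronglyMeasurable.integral_kernel_prod_right
    (κ := (decode Y).comap (fun a : X × ((ℕ → ℕ) × (ℚ → ℝ)) => a.2.2) (by fun_prop))
    (stronglyMeasurable_coded hD i)).measurable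

theorem measurableSet_admRel (h : IsParam Pt p q) (hD : Measurable D) :
    MeasurableSet (admRel p q D) := by
  have h1 : MeasurableSet {a : X × ((ℕ → ℕ) × (ℚ → ℝ)) | p a.2.1 = a.1} :=
    (isClosed_eq (h.continuous_fst.comp (by fun_prop)) continuous_fst).measurableSet
  have h2 := Kernel.measurableSet_absolutelyContinuous
    ((decode Y).comap (fun a : X × ((ℕ → ℕ) × (ℚ → ℝ)) => a.2.2) (by fun_prop))
    (h.kernel.comap (fun a : X × ((ℕ → ℕ) × (ℚ → ℝ)) => a.2.1) (by fun_prop))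
  have h3 : MeasurableSet {a : X × ((ℕ → ℕ) × (ℚ → ℝ)) |
      ∀ i, Integrable (fun y => D (a.1, y) i) (decode Y a.2.2)} := by
    rw [Set.ofPred_forall]
    exact MeasurableSet.iInter fun i => measurableSet_kernel_integrable
      (κ := (decode Y).comap (fun a : X × ((ℕ → ℕ) × (ℚ → ℝ)) => a.2.2) (by fun_prop))
      (stronglyMeasurable_coded hD i)
  exact h1.inter (h2.inter h3)

theorem lsa_coded_lintegral {v : X × Y → ℝ≥0∞} (hv : LSA v) :
    LSA fun a : X × ((ℕ → ℕ) × (ℚ → ℝ)) => ∫⁻ y, v (a.1, y) ∂(decode Y a.2.2) :=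
  LSA.lintegral_kernel ((decode Y).comap (fun a : X × ((ℕ → ℕ) × (ℚ → ℝ)) => a.2.2) (by fun_prop))
    (u := fun b : (X × ((ℕ → ℕ) × (ℚ → ℝ))) × Y => v (b.1.1, b.2)) (hv.comp (by fun_prop))

theorem stepCost_lt_iff (h : IsParam Pt p q) {v : X × Y → ℝ≥0∞} {x : X} {c : ℝ≥0∞} :
    stepCost (Pt x) (fun y => D (x, y)) (fun y => v (x, y)) < c ↔
      ∃ e, (x, e) ∈ admRel p q D ∩ codedMean D ⁻¹' {0} ∩
        {a | ∫⁻ y, v (a.1, y) ∂(decode Y a.2.2) < c} := by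
  simp only [stepCost, iInf_lt_iff]
  constructor
  · rintro ⟨ρ, ⟨hρ, h0⟩, hlt⟩
    obtain ⟨e, he, rfl⟩ := (adm_iff h).1 hρ
    exact ⟨e, ⟨he, funext h0⟩, hlt⟩
  · rintro ⟨e, ⟨he, h0⟩, hlt⟩
    exact ⟨_, ⟨(adm_iff h).2 ⟨e, he, rfl⟩, fun i => congrFun h0 i⟩, hlt⟩

theorem analyticSet_near_optimal (h : IsParam Pt p q) (hD : Measurable D) {v : X × Y → ℝ≥0∞}
    (hv : LSA v) (c : ℝ≥0∞) :
    AnalyticSet (admRel p q D ∩ codedMean D ⁻¹' {0} ∩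
      {a | ∫⁻ y, v (a.1, y) ∂(decode Y a.2.2) < c}) :=
  analyticSet_inter ((measurableSet_admRel h hD).inter
    (measurable_codedMean hD (measurableSet_singleton 0))).analyticSet (lsa_coded_lintegral hv c)

theorem lsa_stepCost (h : IsParam Pt p q) (hD : Measurable D) {v : X × Y → ℝ≥0∞} (hv : LSA v) :
    LSA fun x => stepCost (Pt x) (fun y => D (x, y)) (fun y => v (x, y)) := by
  intro c
  have : {x | stepCost (Pt x) (fun y => D (x, y)) (fun y => v (x, y)) < c} = Prod.fst ''
      (admRel p q D ∩ codedMean D ⁻¹' {0} ∩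
        {a | ∫⁻ y, v (a.1, y) ∂(decode Y a.2.2) < c}) := by
    ext x
    rw [Set.mem_ofPred_eq, stepCost_lt_iff h]
    exact ⟨fun ⟨e, he⟩ => ⟨_, he, rfl⟩, fun ⟨⟨_, e⟩, he, hx⟩ => ⟨e, hx ▸ he⟩⟩
  rw [this]
  exact (analyticSet_near_optimal h hD hv c).image_of_continuous continuous_fst

/-- A universally measurable selector of the models. -/
theorem IsParam.exists_selector (h : IsParam Pt p q) (hne : ∀ x, (Pt x).Nonempty) :
    ∃ z : X → ℕ → ℕ, Measurable[univComp X] z ∧ ∀ x, p (z x) = x := by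
  obtain ⟨z, hz, hzx⟩ := exists_univComp_selector (X := X) (E := ℕ → ℕ)
    (Γ := {a | p a.2 = a.1})
    (isClosed_eq (h.continuous_fst.comp (by fun_prop)) (by fun_prop)).analyticSet
  refine ⟨z, hz, fun x => hzx x ?_⟩
  obtain ⟨P, hP⟩ := hne x
  obtain ⟨z, hz, -⟩ := (h.mem_iff _ _).1 hP
  exact ⟨z, hz⟩

/-- Universally measurable near-optimal martingale kernels. -/
theorem exists_near_optimal (h : IsParam Pt p q) (hne : ∀ x, (Pt x).Nonempty) (hD : Measurable D)
    {v : X × Y → ℝ≥0∞} (hv : LSA v) {ε : ℝ≥0∞} (hε : ε ≠ 0) :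
    ∃ (P : X → ProbabilityMeasure Y) (Q : X → Measure Y),
      Measurable[univComp X, borel (ProbabilityMeasure Y)] P ∧ Measurable[univComp X] Q ∧
      (∀ x, P x ∈ Pt x) ∧ (∀ x, IsProbabilityMeasure (Q x)) ∧
      ∀ x, stepCost (Pt x) (fun y => D (x, y)) (fun y => v (x, y)) < ⊤ →
        Q x ≪ (P x : Measure Y) ∧ (∀ i, Integrable (fun y => D (x, y) i) (Q x)) ∧
        (∀ i, ∫ y, D (x, y) i ∂(Q x) = 0) ∧
        ∫⁻ y, v (x, y) ∂(Q x) ≤ stepCost (Pt x) (fun y => D (x, y)) (fun y => v (x, y)) + ε := by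
  classical
  obtain ⟨z, hz, hzx⟩ := h.exists_selector hne
  choose s hs hsx using fun k : ℕ => exists_univComp_selector
    (analyticSet_near_optimal h hD hv ((k + 1 : ℕ) * ε))
  set V : X → ℝ≥0∞ := fun x => stepCost (Pt x) (fun y => D (x, y)) (fun y => v (x, y)) with hV
  have hVm : Measurable[univComp X] V := (lsa_stepCost h hD hv).measurable_univComp
  have hVk : ∀ k : ℕ, MeasurableSet[univComp X] {x | V x < (k + 1 : ℕ) * ε} :=
    fun k => hVm measurableSet_Iio
  have hlev : ∀ x, ∃ k : ℕ, V x < (k + 1 : ℕ) * ε ∨ V x = ⊤ := by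
    intro x
    rcases eq_or_ne (V x) ⊤ with hx | hx
    · exact ⟨0, Or.inr hx⟩
    · obtain ⟨k, hk⟩ := ENNReal.exists_nat_mul_gt hε hx
      refine ⟨k, Or.inl (hk.trans_le ?_)⟩
      gcongr
      simp
  let s' : ℕ → X → (ℕ → ℕ) × (ℚ → ℝ) := fun k x =>
    if V x < (k + 1 : ℕ) * ε then s k x else (z x, 0)
  have hs' : ∀ k, Measurable[univComp X] (s' k) := fun k =>
    @Measurable.ite _ _ _ _ (univComp X) _ _ _ (hVk k) (hs k)
      (@Measurable.prodMk _ (univComp X) _ _ _ _ _ _ hz (@measurable_const _ _ _ (univComp X) _))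
  let N : X → ℕ := fun x => Nat.find (hlev x)
  have hN : Measurable[univComp X] fun x => s' (N x) x := by
    refine @Measurable.find _ _ _ (univComp X) s' (fun k x => V x < (k + 1 : ℕ) * ε ∨ V x = ⊤) _
      hs' (fun k => ?_) hlev
    exact @MeasurableSet.union _ (univComp X) _ _ (hVk k) (hVm (measurableSet_singleton ⊤))
  have hp : ∀ x, p (s' (N x) x).1 = x := by
    intro x
    simp only [s']
    split_ifs with hlt
    · exact (hsx (N x) x ((stepCost_lt_iff h).1 hlt)).1.1.1
    · exact hzx x
  refine ⟨fun x => q (s' (N x) x).1, fun x => decode Y (s' (N x) x).2,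
    h.measurable_comp (@Measurable.comp _ _ _ (univComp X) _ _ _ _ measurable_fst hN),
    @Measurable.comp _ _ _ (univComp X) _ _ _ _ (decode Y).measurable
      (@Measurable.comp _ _ _ (univComp X) _ _ _ _ measurable_snd hN),
    fun x => (h.mem_iff _ _).2 ⟨_, hp x, rfl⟩, fun x => inferInstance, fun x hx => ?_⟩
  have hlt : V x < (N x + 1 : ℕ) * ε := (Nat.find_spec (hlev x)).resolve_right hx.ne
  have hs'x : s' (N x) x = s (N x) x := if_pos hlt
  obtain ⟨⟨⟨h1, h2, h3⟩, h4⟩, h5⟩ := hsx (N x) x ((stepCost_lt_iff h).1 hlt)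
  simp only [hs'x]
  refine ⟨h2, h3, fun i => congrFun h4 i, le_of_lt (lt_of_lt_of_le h5 ?_)⟩
  rcases Nat.eq_zero_or_pos (N x) with h0 | h0
  · simp [h0]
  · have hmin := Nat.find_min (hlev x) (Nat.sub_lt h0 one_pos)
    push Not at hmin
    have : ((N x - 1 + 1 : ℕ) : ℝ≥0∞) * ε ≤ V x := hmin.1
    rw [Nat.sub_add_cancel (show 1 ≤ N x from h0)] at this
    push_cast
    rw [add_mul, one_mul]
    gcongr

end Parametrized

theorem LSA.analyticSet_lt {X : Type*} [TopologicalSpace X] [PolishSpace X] [MeasurableSpace X]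
    [BorelSpace X] {u w : X → ℝ≥0∞} (hu : LSA u) (hw : Measurable w) :
    AnalyticSet {x | u x < w x} := by
  have : {x | u x < w x} = ⋃ r : ℚ≥0, {x | u x < (r : ℝ≥0)} ∩ {x | ((r : ℝ≥0) : ℝ≥0∞) < w x} := by
    ext x
    simp only [mem_iUnion, mem_inter_iff, Set.mem_ofPred_eq]
    exact ⟨exists_nnrat_btwn_ennreal, fun ⟨r, h1, h2⟩ => h1.trans h2⟩
  rw [this]
  exact AnalyticSet.iUnion fun r => analyticSet_inter (hu _)
    (measurableSet_lt measurable_const hw).analyticSet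

section Parametrized

open ProbabilityTheory

variable {X Y : Type*} [TopologicalSpace X] [PolishSpace X] [MeasurableSpace X] [BorelSpace X]
  [TopologicalSpace Y] [PolishSpace Y] [MeasurableSpace Y] [BorelSpace Y] {d : ℕ}
  {Pt : X → Set (ProbabilityMeasure Y)} {p : (ℕ → ℕ) → X}
  {q : (ℕ → ℕ) → ProbabilityMeasure Y} [Nonempty Y] {D : X × Y → Fin d → ℝ}
  {u : ℕ → X × Y → ℝ≥0∞}

variable (Pt D u) in
/-- The mean-value set of the one-step market at the history `x`. -/
def stepSet (x : X) : Set ((Fin d → ℝ) × ℝ) :=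
  meanValueSet (Pt x) (fun y => D (x, y)) fun n y => u n (x, y)

theorem analyticSet_stepSet_inter (h : IsParam Pt p q) (hD : Measurable D) (hu : ∀ n, LSA (u n))
    {O : Set ((Fin d → ℝ) × ℝ)} (hO : MeasurableSet O) :
    AnalyticSet {x | (stepSet Pt D u x ∩ O).Nonempty} := by
  let Γ : Set (X × (((ℕ → ℕ) × (ℚ → ℝ)) × ℝ)) := ⋃ n : ℕ,
    ({a | (a.1, a.2.1) ∈ admRel p q D} ∩ {a | (codedMean D (a.1, a.2.1), a.2.2) ∈ O}) ∩
      {a | ∫⁻ y, u n (a.1, y) ∂(decode Y a.2.1.2) < ENNReal.ofReal (n - a.2.2)}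
  have hΓ : AnalyticSet Γ := by
    refine AnalyticSet.iUnion fun n => analyticSet_inter (MeasurableSet.analyticSet ?_) ?_
    · have hm : Measurable fun a : X × (((ℕ → ℕ) × (ℚ → ℝ)) × ℝ) => (a.1, a.2.1) := by fun_prop
      exact (hm (measurableSet_admRel h hD)).inter
        ((((measurable_codedMean hD).comp hm).prodMk (by fun_prop)) hO)
    · exact LSA.analyticSet_lt ((lsa_coded_lintegral (hu n)).comp
        (g := fun a : X × (((ℕ → ℕ) × (ℚ → ℝ)) × ℝ) => (a.1, a.2.1)) (by fun_prop)) (by fun_prop)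
  have : {x | (stepSet Pt D u x ∩ O).Nonempty} = Prod.fst '' Γ := by
    ext x
    constructor
    · rintro ⟨⟨k, r⟩, ⟨ρ, hρ, hk, n, hn⟩, hkO⟩
      obtain ⟨e, he, rfl⟩ := (adm_iff h).1 hρ
      obtain rfl : codedMean D (x, e) = k := funext hk
      exact ⟨(x, e, r), mem_iUnion.2 ⟨n, ⟨he, hkO⟩, hn⟩, rfl⟩
    · rintro ⟨⟨x, e, r⟩, ha, rfl⟩
      obtain ⟨n, ⟨he, hkO⟩, hn⟩ := mem_iUnion.1 ha
      exact ⟨(codedMean D (x, e), r), ⟨_, (adm_iff h).2 ⟨e, he, rfl⟩, fun i => rfl, n, hn⟩, hkO⟩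
  rw [this]
  exact hΓ.image_of_continuous continuous_fst

theorem measurableSet_stepSet_inter (h : IsParam Pt p q) (hD : Measurable D)
    (hu : ∀ n, LSA (u n)) {O : Set ((Fin d → ℝ) × ℝ)} (hO : IsOpen O) :
    MeasurableSet[univComp X] {x | (stepSet Pt D u x ∩ O).Nonempty} :=
  measurableSet_univComp_of_analyticSet (analyticSet_stepSet_inter h hD hu hO.measurableSet)

/-- Universally measurable choice of a superhedging position. -/
theorem exists_hedge_selector (h : IsParam Pt p q) (hD : Measurable D) (hu : ∀ n, LSA (u n))
    {c : X → ℝ} (hc : Measurable[univComp X] c) :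
    ∃ H : X → Fin d → ℝ, Measurable[univComp X] H ∧ ∀ x, (slopes (stepSet Pt D u x) (c x)).Nonempty →
      H x ∈ slopes (stepSet Pt D u x) (c x) :=
  @exists_measurable_slope X d (univComp X) _ _
    (fun _ hO => measurableSet_stepSet_inter h hD hu hO) hc

/-- The history `x` admits a position which is nonnegative on the mean-value set, and somewhere
positive. -/
def IsBad (K : Set ((Fin d → ℝ) × ℝ)) : Prop :=
  ∃ h : Fin d → ℝ, (∀ k ∈ K, 0 ≤ ∑ i, h i * k.1 i) ∧ ∃ k ∈ K, 0 < ∑ i, h i * k.1 i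

/-- Constraints expressing that a slope is nonnegative on `K` and at least one on `B`. -/
def positivityConstraints (K : Set ((Fin d → ℝ) × ℝ)) (B : Set (Fin d → ℝ)) :
    Set ((Fin d → ℝ) × ℝ) :=
  (fun k => (-k.1, 0)) '' K ∪ (fun v => (-v, 1)) '' B

theorem mem_slopes_positivityConstraints {K : Set ((Fin d → ℝ) × ℝ)} {B : Set (Fin d → ℝ)}
    {h : Fin d → ℝ} : h ∈ slopes (positivityConstraints K B) 0 ↔
      (∀ k ∈ K, 0 ≤ ∑ i, h i * k.1 i) ∧ ∀ v ∈ B, 1 ≤ ∑ i, h i * v i := by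
  simp only [slopes, positivityConstraints, mem_union, mem_image, Set.mem_ofPred_eq]
  constructor
  · refine fun hh => ⟨fun k hk => ?_, fun v hv => ?_⟩
    · simpa using hh _ (Or.inl ⟨k, hk, rfl⟩)
    · have := hh _ (Or.inr ⟨v, hv, rfl⟩)
      simp only [Pi.neg_apply, mul_neg, Finset.sum_neg_distrib] at this
      linarith
  · rintro ⟨h1, h2⟩ _ (⟨k, hk, rfl⟩ | ⟨v, hv, rfl⟩)
    · simpa using h1 k hk
    · have := h2 v hv
      simp only [Pi.neg_apply, mul_neg, Finset.sum_neg_distrib]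
      linarith

theorem isBad_iff {b : ℕ → Set (Fin d → ℝ)} (hb : TopologicalSpace.IsTopologicalBasis (range b))
    {K : Set ((Fin d → ℝ) × ℝ)} :
    IsBad K ↔ ∃ j, (slopes (positivityConstraints K (b j)) 0).Nonempty ∧
      (K ∩ (b j) ×ˢ univ).Nonempty := by
  constructor
  · rintro ⟨h, hh, k, hk, hpos⟩
    have hO : IsOpen {v : Fin d → ℝ | ∑ i, h i * k.1 i / 2 < ∑ i, h i * v i} :=
      isOpen_lt continuous_const (by fun_prop)
    have hkO : k.1 ∈ {v : Fin d → ℝ | ∑ i, h i * k.1 i / 2 < ∑ i, h i * v i} := by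
      rw [Set.mem_ofPred_eq, ← Finset.sum_div]
      linarith
    obtain ⟨_, ⟨j, rfl⟩, hkj, hj⟩ := hb.exists_subset_of_mem_open hkO hO
    refine ⟨j, ⟨(2 / ∑ i, h i * k.1 i) • h, mem_slopes_positivityConstraints.2 ⟨fun l hl => ?_,
      fun v hv => ?_⟩⟩, k, hk, hkj, mem_univ _⟩
    · simp only [Pi.smul_apply, smul_eq_mul, mul_assoc, ← Finset.mul_sum]
      exact mul_nonneg (by positivity) (hh l hl)
    · have := hj hv
      rw [Set.mem_ofPred_eq, ← Finset.sum_div] at this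
      simp only [Pi.smul_apply, smul_eq_mul, mul_assoc, ← Finset.mul_sum]
      rw [div_mul_eq_mul_div, le_div_iff₀ hpos]
      linarith
  · rintro ⟨j, ⟨h, hh⟩, k, hk, hkj⟩
    rw [mem_slopes_positivityConstraints] at hh
    exact ⟨h, hh.1, k, hk, zero_lt_one.trans_le (hh.2 _ hkj.1)⟩

/-- Universally measurable choice of a one-step arbitrage position, together with a model under
which it is profitable. -/
theorem exists_arbitrage_selector (h : IsParam Pt p q) (hne : ∀ x, (Pt x).Nonempty)
    (hD : Measurable D) (hu : ∀ n, LSA (u n)) :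
    ∃ (H : X → Fin d → ℝ) (P : X → ProbabilityMeasure Y), Measurable[univComp X] H ∧
      Measurable[univComp X, borel (ProbabilityMeasure Y)] P ∧ (∀ x, P x ∈ Pt x) ∧
      (∀ x, ∀ k ∈ stepSet Pt D u x, 0 ≤ ∑ i, H x i * k.1 i) ∧
      ∀ x, IsBad (stepSet Pt D u x) →
        (P x : Measure Y) {y | (∃ n, u n (x, y) < ⊤) ∧ 0 < ∑ i, H x i * D (x, y) i} ≠ 0 := by
  classical
  obtain ⟨z, hz, hzx⟩ := h.exists_selector hne
  obtain ⟨B, hBc, -, hB⟩ := TopologicalSpace.exists_countable_basis (Fin d → ℝ)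
  obtain ⟨b, rfl⟩ := hBc.exists_eq_range (by
    obtain ⟨U, hU, -⟩ := hB.exists_subset_of_mem_open (mem_univ (0 : Fin d → ℝ)) isOpen_univ
    exact ⟨U, hU⟩)
  have hbo : ∀ j, IsOpen (b j) := fun j => hB.isOpen ⟨j, rfl⟩
  set K := stepSet Pt D u with hKdef
  have hit : ∀ j, ∀ O, IsOpen O →
      MeasurableSet[univComp X] {x | (positivityConstraints (K x) (b j) ∩ O).Nonempty} := by
    intro j O hO
    have : {x | (positivityConstraints (K x) (b j) ∩ O).Nonempty} =
        {x | (K x ∩ (fun k => (-k.1, 0)) ⁻¹' O).Nonempty} ∪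
          {_x | (b j ∩ (fun v => (-v, 1)) ⁻¹' O).Nonempty} := by
      ext x
      simp only [positivityConstraints, union_inter_distrib_right, union_nonempty,
        Set.mem_ofPred_eq, mem_union, image_inter_nonempty_iff]
    rw [this]
    exact @MeasurableSet.union _ (univComp X) _ _
      (measurableSet_stepSet_inter h hD hu (hO.preimage (by fun_prop)))
      (@MeasurableSet.const _ (univComp X) _)
  choose Hj hHj hHjx using fun j => @exists_measurable_slope X d (univComp X) _ _ (hit j)
    (@measurable_const _ _ _ (univComp X) (0 : ℝ))
  let bad : ℕ → Set X := fun j => {x | (slopes (positivityConstraints (K x) (b j)) 0).Nonempty ∧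
      (K x ∩ (b j) ×ˢ univ).Nonempty}
  have hbad : ∀ j, MeasurableSet[univComp X] (bad j) := fun j => by
    refine @MeasurableSet.inter _ (univComp X) _ _ ?_
      (measurableSet_stepSet_inter h hD hu ((hbo j).prod isOpen_univ))
    have := @measurableSet_slopes_inter X d (univComp X) _ _ (hit j)
      (@measurable_const _ _ _ (univComp X) (0 : ℝ)) univ isOpen_univ
    simp only [inter_univ] at this
    exact this
  have hΓ : ∀ j, AnalyticSet (⋃ n : ℕ, admRel p q D ∩ codedMean D ⁻¹' (b j) ∩
      {a | ∫⁻ y, u n (a.1, y) ∂(decode Y a.2.2) < ⊤}) := fun j =>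
    AnalyticSet.iUnion fun n => analyticSet_inter ((measurableSet_admRel h hD).inter
      (measurable_codedMean hD (hbo j).measurableSet)).analyticSet (lsa_coded_lintegral (hu n) _)
  choose s hs hsx using fun j => exists_univComp_selector (hΓ j)
  have hsb : ∀ j, ∀ x ∈ bad j, ∃ n : ℕ, (x, s j x) ∈ admRel p q D ∩ codedMean D ⁻¹' (b j) ∩
      {a | ∫⁻ y, u n (a.1, y) ∂(decode Y a.2.2) < ⊤} := by
    rintro j x ⟨-, k, ⟨ρ, hρ, hk, n, hn⟩, hkj⟩
    obtain ⟨e, he, rfl⟩ := (adm_iff h).1 hρ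
    refine mem_iUnion.1 (hsx j x ⟨e, mem_iUnion.2 ⟨n, ⟨he, ?_⟩, hn.trans ENNReal.ofReal_lt_top⟩⟩)
    have : codedMean D (x, e) = k.1 := funext hk
    rw [mem_preimage, this]
    exact hkj.1
  let F : ℕ → X → (Fin d → ℝ) × (ℕ → ℕ) := fun j x =>
    if x ∈ bad j then (Hj j x, (s j x).1) else (0, z x)
  have hF : ∀ j, Measurable[univComp X] (F j) := fun j =>
    @Measurable.ite _ _ _ _ (univComp X) _ _ _ (hbad j)
      (@Measurable.prodMk _ (univComp X) _ _ _ _ _ _ (hHj j)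
        (@Measurable.comp _ _ _ (univComp X) _ _ _ _ measurable_fst (hs j)))
      (@Measurable.prodMk _ (univComp X) _ _ _ _ _ _ (@measurable_const _ _ _ (univComp X) _) hz)
  have hex : ∀ x, ∃ j, x ∈ bad j ∨ x ∈ ⋂ i, (bad i)ᶜ := by
    intro x
    by_cases hx : ∃ j, x ∈ bad j
    · exact hx.imp fun j hj => Or.inl hj
    · exact ⟨0, Or.inr (mem_iInter.2 fun i hi => hx ⟨i, hi⟩)⟩
  let N : X → ℕ := fun x => Nat.find (hex x)
  have hN : Measurable[univComp X] fun x => F (N x) x := by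
    refine @Measurable.find _ _ _ (univComp X) F (fun j x => x ∈ bad j ∨ x ∈ ⋂ i, (bad i)ᶜ) _
      hF (fun j => ?_) hex
    exact @MeasurableSet.union _ (univComp X) _ _ (hbad j)
      (@MeasurableSet.iInter _ _ (univComp X) _ _ fun i =>
        @MeasurableSet.compl _ _ (univComp X) (hbad i))
  refine ⟨fun x => (F (N x) x).1, fun x => q (F (N x) x).2,
    @Measurable.comp _ _ _ (univComp X) _ _ _ _ measurable_fst hN,
    h.measurable_comp (@Measurable.comp _ _ _ (univComp X) _ _ _ _ measurable_snd hN),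
    fun x => (h.mem_iff _ _).2 ⟨_, ?_, rfl⟩, fun x => ?_, fun x hx => ?_⟩
  · simp only [F]
    split_ifs with hx
    · obtain ⟨n, hn⟩ := hsb _ x hx
      exact hn.1.1.1
    · exact hzx x
  · simp only [F]
    split_ifs with hx
    · exact (mem_slopes_positivityConstraints.1 (hHjx _ x hx.1)).1
    · simp
  · obtain ⟨j, hj⟩ := (isBad_iff hB).1 hx
    have hxN : x ∈ bad (N x) := (Nat.find_spec (hex x)).resolve_right fun hall =>
      mem_iInter.1 hall j hj
    have hFx : F (N x) x = (Hj (N x) x, (s (N x) x).1) := if_pos hxN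
    obtain ⟨n, ⟨hadm, hmean⟩, hfin⟩ := hsb _ x hxN
    simp only [hFx]
    refine measure_pos_of_mean_pos (u := fun n y => u n (x, y))
      (fun n => ((hu n).comp (g := fun y => (x, y)) (by fun_prop)).measurable_univComp)
      ((adm_iff h).2 ⟨_, hadm, rfl⟩) (LT.lt.ne hfin) ?_ hadm.2.1
    exact zero_lt_one.trans_le ((mem_slopes_positivityConstraints.1 (hHjx _ x hxN.1)).2 _ hmean)

end Parametrized

section OneStepDuality

variable {Y : Type*} [MeasurableSpace Y] {d : ℕ}
  {PS : Set (ProbabilityMeasure Y)} {D : Y → Fin d → ℝ} {u : ℕ → Y → ℝ≥0∞}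

theorem hedge_of_not_isBad (hconv : ConvexPM PS)
    (hmono : ∀ n m : ℕ, n ≤ m → ∀ y, u m y ≤ u n y + ((m - n : ℕ) : ℝ≥0∞))
    (hne : (meanValueSet PS D u).Nonempty) (hbad : ¬ IsBad (meanValueSet PS D u)) :
    (∃ r, ((0 : Fin d → ℝ), r) ∈ meanValueSet PS D u) ∧
    ∀ y : ℝ, (∀ r, ((0 : Fin d → ℝ), r) ∈ meanValueSet PS D u → r ≤ y) →
      (slopes (meanValueSet PS D u) y).Nonempty := by
  refine exists_hedge_of_no_arbitrage (convex_meanValueSet hconv hmono) hne fun h hh k hk => ?_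
  by_contra hk0
  exact hbad ⟨h, hh, k, hk, lt_of_le_of_ne (hh k hk) (Ne.symm hk0)⟩

/-- One-step superhedging in the absence of one-step arbitrage. -/
theorem slopes_nonempty_of_not_isBad (hconv : ConvexPM PS)
    (hmono : ∀ n m : ℕ, n ≤ m → ∀ y, u m y ≤ u n y + ((m - n : ℕ) : ℝ≥0∞))
    (hbad : ¬ IsBad (meanValueSet PS D u)) {c : ℝ}
    (hc : ∀ n : ℕ, ENNReal.ofReal (n - c) ≤ stepCost PS D (u n)) :
    (slopes (meanValueSet PS D u) c).Nonempty := by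
  rcases (meanValueSet PS D u).eq_empty_or_nonempty with h0 | hne
  · exact ⟨0, by simp [slopes, h0]⟩
  · exact (hedge_of_not_isBad hconv hmono hne hbad).2 c fun r hr => le_of_stepCost hc hr

theorem exists_stepCost_lt_top (hconv : ConvexPM PS)
    (hmono : ∀ n m : ℕ, n ≤ m → ∀ y, u m y ≤ u n y + ((m - n : ℕ) : ℝ≥0∞))
    (hne : (meanValueSet PS D u).Nonempty) (hbad : ¬ IsBad (meanValueSet PS D u)) :
    ∃ n, stepCost PS D (u n) < ⊤ := by
  obtain ⟨r, hr⟩ := (hedge_of_not_isBad hconv hmono hne hbad).1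
  exact stepCost_lt_top hr

end OneStepDuality

/-! ### Extending a measure by one step -/

section Step

open ProbabilityTheory

variable {Ω₁ : Type} [MeasurableSpace Ω₁] [TopologicalSpace Ω₁] [PolishSpace Ω₁] [BorelSpace Ω₁]
  [Nonempty Ω₁] {t : ℕ}

/-- The extension of a measure on paths of length `t` by a kernel. -/
def step (ν : Measure (Fin t → Ω₁)) (κ : (Fin t → Ω₁) → Measure Ω₁) :
    Measure (Fin (t + 1) → Ω₁) :=
  ν.bind fun ω => Measure.map (Fin.snoc ω) (κ ω)

/-- Append a point to a path. -/
def snocPair (a : (Fin t → Ω₁) × Ω₁) : Fin (t + 1) → Ω₁ := Fin.snoc a.1 a.2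

omit [MeasurableSpace Ω₁] [PolishSpace Ω₁] [BorelSpace Ω₁] [Nonempty Ω₁] in
theorem continuous_snocPair : Continuous (snocPair (Ω₁ := Ω₁) (t := t)) :=
  Continuous.finSnoc continuous_fst continuous_snd

omit [Nonempty Ω₁] in
theorem measurable_snocPair : Measurable (snocPair (Ω₁ := Ω₁) (t := t)) :=
  continuous_snocPair.measurable

omit [MeasurableSpace Ω₁] [TopologicalSpace Ω₁] [PolishSpace Ω₁] [BorelSpace Ω₁] [Nonempty Ω₁] in
theorem init_snocPair (a : (Fin t → Ω₁) × Ω₁) : Fin.init (snocPair a) = a.1 :=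
  Fin.init_snoc _ _

omit [Nonempty Ω₁] in
theorem step_eq_map_compProd {ν : Measure (Fin t → Ω₁)} [IsProbabilityMeasure ν]
    {κ : (Fin t → Ω₁) → Measure Ω₁} {κ' : Kernel (Fin t → Ω₁) Ω₁} [IsMarkovKernel κ']
    (h : ∀ᵐ ω ∂ν, κ ω = κ' ω) : step ν κ = (ν ⊗ₘ κ').map snocPair := by
  have h1 : step ν κ = ν.bind fun ω => Measure.map (Fin.snoc ω) (κ' ω) :=
    Measure.bind_congr_right (h.mono fun ω hω => by simp only [hω])
  have hsnoc : ∀ ω : Fin t → Ω₁, Measurable (Fin.snoc (α := fun _ => Ω₁) ω) :=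
    fun ω => measurable_snocPair.comp measurable_prodMk_left
  have hap : ∀ s, MeasurableSet s → ∀ ω, (Measure.map (Fin.snoc ω) (κ' ω) :
      Measure (Fin (t + 1) → Ω₁)) s = κ' ω (Prod.mk ω ⁻¹' (snocPair ⁻¹' s)) := by
    intro s hs ω
    rw [Measure.map_apply (hsnoc ω) hs]
    rfl
  have hm : Measurable fun ω => (Measure.map (Fin.snoc ω) (κ' ω) : Measure (Fin (t + 1) → Ω₁)) := by
    refine Measure.measurable_of_measurable_coe _ fun s hs => ?_
    simp_rw [hap s hs]
    exact Kernel.measurable_kernel_prodMk_left (measurable_snocPair hs)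
  ext s hs
  rw [h1, Measure.bind_apply hs hm.aemeasurable, Measure.map_apply measurable_snocPair hs,
    Measure.compProd_apply (measurable_snocPair hs)]
  simp_rw [hap s hs]

section

variable {ν : Measure (Fin t → Ω₁)} [IsProbabilityMeasure ν] {κ : (Fin t → Ω₁) → Measure Ω₁}
  [∀ ω, IsProbabilityMeasure (κ ω)] (hκ : Measurable[univComp (Fin t → Ω₁)] κ)

include hκ

theorem isProbabilityMeasure_step : IsProbabilityMeasure (step ν κ) := by
  obtain ⟨κ', hκ', hae⟩ := exists_kernel_ae_eq hκ ν
  rw [step_eq_map_compProd hae]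
  exact Measure.isProbabilityMeasure_map measurable_snocPair.aemeasurable

theorem map_init_step : (step ν κ).map Fin.init = ν := by
  obtain ⟨κ', hκ', hae⟩ := exists_kernel_ae_eq hκ ν
  rw [step_eq_map_compProd hae, Measure.map_map (by unfold Fin.init; fun_prop) measurable_snocPair]
  have : (Fin.init ∘ snocPair : (Fin t → Ω₁) × Ω₁ → _) = Prod.fst := funext init_snocPair
  rw [this]
  exact Measure.fst_compProd ν κ'

theorem ae_init_step {p : (Fin t → Ω₁) → Prop} (h : ∀ᵐ ω ∂ν, p ω) :
    ∀ᵐ ω ∂(step ν κ), p (Fin.init ω) := by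
  rw [← map_init_step (ν := ν) hκ] at h
  exact ae_of_ae_map (Measurable.aemeasurable (by unfold Fin.init; fun_prop)) h

theorem ae_ae_of_ae_step {p : (Fin (t + 1) → Ω₁) → Prop} (h : ∀ᵐ ω ∂(step ν κ), p ω) :
    ∀ᵐ ω ∂ν, ∀ᵐ y ∂(κ ω), p (snocPair (ω, y)) := by
  obtain ⟨κ', hκ', hae⟩ := exists_kernel_ae_eq hκ ν
  rw [step_eq_map_compProd hae] at h
  filter_upwards [hae, Measure.ae_ae_of_ae_compProd
    (ae_of_ae_map measurable_snocPair.aemeasurable h)] with ω h1 h2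
  rwa [h1]

theorem lintegral_step {F : (Fin (t + 1) → Ω₁) → ℝ≥0∞} (hF : AEMeasurable F (step ν κ)) :
    ∫⁻ ω, F ω ∂(step ν κ) = ∫⁻ ω, ∫⁻ y, F (snocPair (ω, y)) ∂(κ ω) ∂ν := by
  obtain ⟨κ', hκ', hae⟩ := exists_kernel_ae_eq hκ ν
  have hmk := hF.measurable_mk
  have hEq := hF.ae_eq_mk
  generalize hF.mk F = G at hmk hEq
  calc ∫⁻ ω, F ω ∂(step ν κ) = ∫⁻ ω, G ω ∂(step ν κ) := lintegral_congr_ae hEq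
    _ = ∫⁻ ω, ∫⁻ y, G (snocPair (ω, y)) ∂(κ' ω) ∂ν := by
        rw [step_eq_map_compProd hae, lintegral_map hmk measurable_snocPair]
        exact Measure.lintegral_compProd (hmk.comp measurable_snocPair)
    _ = _ := by
        refine lintegral_congr_ae ?_
        filter_upwards [hae, ae_ae_of_ae_step hκ hEq] with ω h1 h2
        rw [← h1]
        exact (lintegral_congr_ae h2).symm

theorem ae_step_of_ae_ae {p : (Fin (t + 1) → Ω₁) → Prop}
    (hp : MeasurableSet[univComp (Fin (t + 1) → Ω₁)] {ω | p ω})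
    (h : ∀ᵐ ω ∂ν, ∀ᵐ y ∂(κ ω), p (snocPair (ω, y))) : ∀ᵐ ω ∂(step ν κ), p ω := by
  have hprob := isProbabilityMeasure_step (ν := ν) hκ
  have hn : NullMeasurableSet {ω | p ω}ᶜ (step ν κ) := (hp _ hprob).compl
  have h1 : AEMeasurable ({ω | p ω}ᶜ.indicator (1 : (Fin (t + 1) → Ω₁) → ℝ≥0∞)) (step ν κ) :=
    (aemeasurable_indicator_const_iff (b := (1 : ℝ≥0∞))).2 hn
  have h2 := lintegral_step hκ h1
  rw [lintegral_indicator_one₀ hn] at h2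
  rw [ae_iff]
  refine h2.trans ?_
  rw [← lintegral_zero (μ := ν)]
  refine lintegral_congr_ae (h.mono fun ω hω => ?_)
  simp only
  rw [← lintegral_zero (μ := κ ω)]
  refine lintegral_congr_ae (hω.mono fun y hy => ?_)
  simp [hy]

end

theorem step_absolutelyContinuous {ν₁ ν₂ : Measure (Fin t → Ω₁)} [IsProbabilityMeasure ν₁]
    [IsProbabilityMeasure ν₂] {κ₁ κ₂ : (Fin t → Ω₁) → Measure Ω₁}
    [∀ ω, IsProbabilityMeasure (κ₁ ω)] [∀ ω, IsProbabilityMeasure (κ₂ ω)]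
    (hκ₁ : Measurable[univComp (Fin t → Ω₁)] κ₁) (hκ₂ : Measurable[univComp (Fin t → Ω₁)] κ₂)
    (hν : ν₁ ≪ ν₂) (h : ∀ᵐ ω ∂ν₁, κ₁ ω ≪ κ₂ ω) : step ν₁ κ₁ ≪ step ν₂ κ₂ := by
  obtain ⟨κ₁', hκ₁', hae₁⟩ := exists_kernel_ae_eq hκ₁ ν₁
  obtain ⟨κ₂', hκ₂', hae₂⟩ := exists_kernel_ae_eq hκ₂ ν₂
  rw [step_eq_map_compProd hae₁, step_eq_map_compProd hae₂]
  refine Measure.AbsolutelyContinuous.map ?_ measurable_snocPair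
  refine Measure.AbsolutelyContinuous.compProd hν ?_
  filter_upwards [h, hae₁, hν.ae_le hae₂] with ω h0 h1 h2
  rwa [← h1, ← h2]

end Step

theorem measurableSet_univComp {X : Type*} [MeasurableSpace X] {s : Set X} (hs : MeasurableSet s) :
    MeasurableSet[univComp X] s := fun _ _ => hs.nullMeasurableSet

theorem measurable_univComp_of_measurable {X Z : Type*} [MeasurableSpace X] [MeasurableSpace Z]
    {f : X → Z} (hf : Measurable f) : Measurable[univComp X] f :=
  fun _ hs => measurableSet_univComp (hf hs)

theorem measurable_univComp_univComp {X Z : Type*} [MeasurableSpace X] [MeasurableSpace Z]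
    {f : X → Z} (hf : Measurable f) : Measurable[univComp X, univComp Z] f := by
  intro s hs μ hμ
  have := Measure.isProbabilityMeasure_map (μ := μ) hf.aemeasurable
  exact (hs (μ.map f) this).preimage (hf.quasiMeasurePreserving μ)

theorem measurable_univComp_comp {X Z W : Type*} [MeasurableSpace X] [MeasurableSpace Z]
    [MeasurableSpace W] {h : Z → W} (hh : Measurable[univComp Z] h) {f : X → Z}
    (hf : Measurable f) : Measurable[univComp X] fun x => h (f x) :=
  @Measurable.comp _ _ _ (univComp X) (univComp Z) _ _ _ hh (measurable_univComp_univComp hf)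

theorem measurable_init {α : Type*} [MeasurableSpace α] {t : ℕ} :
    Measurable (Fin.init : (Fin (t + 1) → α) → Fin t → α) := by
  unfold Fin.init; fun_prop

section Gain

variable {Ω₁ : Type} {d : ℕ}

/-- The gain from trading, by recursion on the horizon. -/
def gainR (S H : (t : ℕ) → (Fin t → Ω₁) → Fin d → ℝ) : (t : ℕ) → (Fin t → Ω₁) → ℝ
  | 0, _ => 0
  | t + 1, ω => gainR S H t (Fin.init ω) +
      ∑ i, H t (Fin.init ω) i * (S (t + 1) ω i - S t (Fin.init ω) i)

theorem gainR_succ (S H : (t : ℕ) → (Fin t → Ω₁) → Fin d → ℝ) (t : ℕ) (ω : Fin (t + 1) → Ω₁) :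
    gainR S H (t + 1) ω = gainR S H t (Fin.init ω) +
      ∑ i, H t (Fin.init ω) i * (S (t + 1) ω i - S t (Fin.init ω) i) := rfl

theorem gainR_snocPair (S H : (t : ℕ) → (Fin t → Ω₁) → Fin d → ℝ) (t : ℕ) (ω : Fin t → Ω₁)
    (y : Ω₁) : gainR S H (t + 1) (snocPair (ω, y)) =
      gainR S H t ω + ∑ i, H t ω i * incr Ω₁ S t ω y i := by
  rw [gainR_succ, init_snocPair]
  rfl

theorem gain_eq_gainR_restr (S H : (t : ℕ) → (Fin t → Ω₁) → Fin d → ℝ) {T : ℕ} :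
    ∀ (t : ℕ) (h : t ≤ T) (ω : Fin T → Ω₁),
      gain Ω₁ S H t h ω = gainR S H t (restr Ω₁ t h ω)
  | 0, _, _ => by simp [gain, gainR]
  | t + 1, h, ω => by
    have ih := gain_eq_gainR_restr S H t (t.le_succ.trans h) ω
    rw [gain, Fin.sum_univ_castSucc, gainR_succ]
    rw [gain] at ih
    exact congrArg₂ (· + ·) ih rfl

theorem gain_eq_gainR (S H : (t : ℕ) → (Fin t → Ω₁) → Fin d → ℝ) {T : ℕ} (ω : Fin T → Ω₁) :
    gain Ω₁ S H T le_rfl ω = gainR S H T ω :=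
  gain_eq_gainR_restr S H T le_rfl ω

theorem gainR_congr {S H H' : (t : ℕ) → (Fin t → Ω₁) → Fin d → ℝ} :
    ∀ {t : ℕ}, (∀ u < t, H u = H' u) → gainR S H t = gainR S H' t
  | 0, _ => rfl
  | t + 1, h => by
    funext ω
    rw [gainR_succ, gainR_succ, gainR_congr fun u hu => h u (hu.trans t.lt_succ_self),
      h t t.lt_succ_self]

theorem gainR_update (S H : (t : ℕ) → (Fin t → Ω₁) → Fin d → ℝ) (t : ℕ)
    (h : (Fin t → Ω₁) → Fin d → ℝ) : gainR S (Function.update H t h) t = gainR S H t :=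
  gainR_congr fun u hu => by rw [Function.update_of_ne hu.ne]

theorem gainR_update_snocPair (S H : (t : ℕ) → (Fin t → Ω₁) → Fin d → ℝ) (t : ℕ)
    (h : (Fin t → Ω₁) → Fin d → ℝ) (ω : Fin t → Ω₁) (y : Ω₁) :
    gainR S (Function.update H t h) (t + 1) (snocPair (ω, y)) =
      gainR S H t ω + ∑ i, h ω i * incr Ω₁ S t ω y i := by
  rw [gainR_snocPair, gainR_update, Function.update_self]

theorem gainR_zero (S : (t : ℕ) → (Fin t → Ω₁) → Fin d → ℝ) (t : ℕ) (ω : Fin t → Ω₁) :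
    gainR S (fun _ _ => 0) t ω = 0 := by
  induction t with
  | zero => rfl
  | succ t ih => simp [gainR_succ, ih]

variable [MeasurableSpace Ω₁]

theorem Pred.update {H : (t : ℕ) → (Fin t → Ω₁) → Fin d → ℝ} (hH : Pred Ω₁ d H) {t : ℕ}
    {h : (Fin t → Ω₁) → Fin d → ℝ} (hh : Measurable[univComp (Fin t → Ω₁)] h) :
    Pred Ω₁ d (Function.update H t h) := by
  intro u
  rcases eq_or_ne u t with rfl | hu
  · rwa [Function.update_self]
  · rw [Function.update_of_ne hu]; exact hH u

theorem pred_zero : Pred Ω₁ d fun _ _ => 0 := fun u =>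
  @measurable_const _ _ _ (univComp (Fin u → Ω₁)) _

theorem measurable_gainR {S H : (t : ℕ) → (Fin t → Ω₁) → Fin d → ℝ} (hH : Pred Ω₁ d H) :
    ∀ {t : ℕ}, (∀ u ≤ t, Measurable (S u)) → Measurable[univComp (Fin t → Ω₁)] (gainR S H t)
  | 0, _ => @measurable_const _ _ _ (univComp (Fin 0 → Ω₁)) _
  | t + 1, hS => by
    refine @Measurable.add _ _ _ _ (univComp (Fin (t + 1) → Ω₁))
      (fun ω => gainR S H t (Fin.init ω))
      (fun ω => ∑ i, H t (Fin.init ω) i * (S (t + 1) ω i - S t (Fin.init ω) i)) _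
      (measurable_univComp_comp (measurable_gainR hH fun u hu => hS u (hu.trans t.le_succ))
        measurable_init) ?_
    refine @Finset.measurable_fun_sum _ _ _ _ _ _ (univComp (Fin (t + 1) → Ω₁)) _ _ fun i _ => ?_
    refine @Measurable.mul _ _ _ _ (univComp (Fin (t + 1) → Ω₁)) _ _ _
      (measurable_univComp_comp (h := fun ω => H t ω i) ?_ measurable_init)
      (measurable_univComp_of_measurable ?_)
    · exact @Measurable.comp _ _ _ (univComp (Fin t → Ω₁)) _ _ _ _ (measurable_pi_apply i) (hH t)
    · exact ((measurable_pi_apply i).comp (hS _ le_rfl)).sub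
        ((measurable_pi_apply i).comp ((hS t t.le_succ).comp measurable_init))

end Gain

section Market

open ProbabilityTheory

variable {Ω₁ : Type} [MeasurableSpace Ω₁] [TopologicalSpace Ω₁] [PolishSpace Ω₁] [BorelSpace Ω₁]
  [Nonempty Ω₁] {d : ℕ}

/-- The standing assumptions on the model sets and the stock price up to the horizon `T`. -/
structure Market (Pt : (t : ℕ) → (Fin t → Ω₁) → Set (ProbabilityMeasure Ω₁))
    (S : (t : ℕ) → (Fin t → Ω₁) → Fin d → ℝ) (T : ℕ) : Prop where
  nonempty : ∀ t, t < T → ∀ ω, (Pt t ω).Nonempty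
  convex : ∀ t, t < T → ∀ ω, ConvexPM (Pt t ω)
  graph : ∀ t, t < T →
    AnalyticSet {p : (Fin t → Ω₁) × ProbabilityMeasure Ω₁ | p.2 ∈ Pt t p.1}
  measurable : ∀ t, t ≤ T → Measurable (S t)

variable {Pt : (t : ℕ) → (Fin t → Ω₁) → Set (ProbabilityMeasure Ω₁)}
  {S : (t : ℕ) → (Fin t → Ω₁) → Fin d → ℝ} {T : ℕ}

theorem Market.of_succ (h : Market Pt S (T + 1)) : Market Pt S T :=
  ⟨fun t ht => h.nonempty t (ht.trans T.lt_succ_self),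
    fun t ht => h.convex t (ht.trans T.lt_succ_self),
    fun t ht => h.graph t (ht.trans T.lt_succ_self),
    fun t ht => h.measurable t (ht.trans T.le_succ)⟩

theorem Market.exists_isParam (h : Market Pt S (T + 1)) : ∃ p q, IsParam (Pt T) p q :=
  BN.exists_isParam (h.nonempty T T.lt_succ_self) (h.graph T T.lt_succ_self)

theorem Market.measurable_incr (h : Market Pt S (T + 1)) :
    Measurable fun a : (Fin T → Ω₁) × Ω₁ => incr Ω₁ S T a.1 a.2 := by
  refine measurable_pi_lambda _ fun i => ?_
  exact ((measurable_pi_apply i).comp ((h.measurable _ le_rfl).comp measurable_snocPair)).sub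
    ((measurable_pi_apply i).comp ((h.measurable T T.le_succ).comp measurable_fst))

theorem measurable_univComp_coe {X : Type*} [MeasurableSpace X] {P : X → ProbabilityMeasure Ω₁}
    (hP : Measurable[univComp X, borel (ProbabilityMeasure Ω₁)] P) :
    Measurable[univComp X] fun x => (P x : Measure Ω₁) :=
  @Measurable.comp _ _ _ (univComp X) (borel _) _ _ _ measurable_coe_borel_probabilityMeasure hP

theorem Market.exists_selector (h : Market Pt S (T + 1)) :
    ∃ P : (Fin T → Ω₁) → ProbabilityMeasure Ω₁,
      Measurable[univComp (Fin T → Ω₁), borel (ProbabilityMeasure Ω₁)] P ∧ ∀ ω, P ω ∈ Pt T ω := by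
  obtain ⟨p, q, hpq⟩ := h.exists_isParam
  obtain ⟨z, hz, hzx⟩ := hpq.exists_selector (h.nonempty T T.lt_succ_self)
  refine ⟨fun ω => q (z ω), @Measurable.comp _ _ _ (univComp (Fin T → Ω₁)) _ (borel _) _ _ ?_ hz,
    fun ω => (hpq.mem_iff _ _).2 ⟨z ω, hzx ω, rfl⟩⟩
  exact (hpq.continuous_snd.borel_measurable).mono (BorelSpace.measurable_eq (α := ℕ → ℕ)).ge le_rfl

theorem mem_measFam_succ {μ : Measure (Fin (T + 1) → Ω₁)} :
    μ ∈ MeasFam Ω₁ Pt (T + 1) ↔ ∃ ν ∈ MeasFam Ω₁ Pt T,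
      ∃ κ : (Fin T → Ω₁) → ProbabilityMeasure Ω₁,
        Measurable[univComp (Fin T → Ω₁), borel (ProbabilityMeasure Ω₁)] κ ∧
        (∀ ω, κ ω ∈ Pt T ω) ∧ μ = step ν fun ω => (κ ω : Measure Ω₁) := Iff.rfl

theorem isProbabilityMeasure_of_mem_measFam :
    ∀ {t : ℕ} {μ : Measure (Fin t → Ω₁)}, μ ∈ MeasFam Ω₁ Pt t → IsProbabilityMeasure μ
  | 0, μ, hμ => by
    rw [show μ = Measure.dirac Fin.elim0 from hμ]; infer_instance
  | t + 1, μ, hμ => by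
    obtain ⟨ν, hν, κ, hκ, -, rfl⟩ := mem_measFam_succ.1 hμ
    have := isProbabilityMeasure_of_mem_measFam hν
    exact isProbabilityMeasure_step (measurable_univComp_coe hκ)

/-- Martingale measures built from one-step martingale kernels. -/
def MartFam (Pt : (t : ℕ) → (Fin t → Ω₁) → Set (ProbabilityMeasure Ω₁))
    (S : (t : ℕ) → (Fin t → Ω₁) → Fin d → ℝ) : (t : ℕ) → Set (Measure (Fin t → Ω₁))
  | 0 => {Measure.dirac Fin.elim0}
  | t + 1 => {μ | ∃ ν ∈ MartFam Pt S t, ∃ (κ : (Fin t → Ω₁) → Measure Ω₁)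
      (P : (Fin t → Ω₁) → ProbabilityMeasure Ω₁), Measurable[univComp (Fin t → Ω₁)] κ ∧
      (∀ ω, IsProbabilityMeasure (κ ω)) ∧
      Measurable[univComp (Fin t → Ω₁), borel (ProbabilityMeasure Ω₁)] P ∧ (∀ ω, P ω ∈ Pt t ω) ∧
      (∀ᵐ ω ∂ν, κ ω ≪ (P ω : Measure Ω₁) ∧ (∀ i, Integrable (fun y => incr Ω₁ S t ω y i) (κ ω)) ∧
        ∀ i, ∫ y, incr Ω₁ S t ω y i ∂(κ ω) = 0) ∧ μ = step ν κ}

theorem isProbabilityMeasure_of_mem_martFam :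
    ∀ {t : ℕ} {μ : Measure (Fin t → Ω₁)}, μ ∈ MartFam Pt S t → IsProbabilityMeasure μ
  | 0, μ, hμ => by
    rw [show μ = Measure.dirac Fin.elim0 from hμ]; infer_instance
  | t + 1, μ, hμ => by
    obtain ⟨ν, hν, κ, P, hκ, hκp, -, -, -, rfl⟩ := hμ
    have := isProbabilityMeasure_of_mem_martFam hν
    exact isProbabilityMeasure_step hκ

theorem exists_absolutelyContinuous_of_mem_martFam :
    ∀ {t : ℕ} {μ : Measure (Fin t → Ω₁)}, μ ∈ MartFam Pt S t → ∃ P ∈ MeasFam Ω₁ Pt t, μ ≪ P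
  | 0, μ, hμ => ⟨μ, hμ, Measure.AbsolutelyContinuous.rfl⟩
  | t + 1, μ, hμ => by
    obtain ⟨ν, hν, κ, P, hκ, hκp, hP, hPt, hae, rfl⟩ := hμ
    obtain ⟨ν', hν', hνν'⟩ := exists_absolutelyContinuous_of_mem_martFam hν
    have := isProbabilityMeasure_of_mem_martFam hν
    have := isProbabilityMeasure_of_mem_measFam hν'
    exact ⟨_, mem_measFam_succ.2 ⟨ν', hν', P, hP, hPt, rfl⟩,
      step_absolutelyContinuous hκ (measurable_univComp_coe hP) hνν' (hae.mono fun ω h => h.1)⟩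

/-- No arbitrage in the market with stocks only, in almost-sure form. -/
def NoArb (Pt : (t : ℕ) → (Fin t → Ω₁) → Set (ProbabilityMeasure Ω₁))
    (S : (t : ℕ) → (Fin t → Ω₁) → Fin d → ℝ) (T : ℕ) : Prop :=
  ∀ H, Pred Ω₁ d H → (∀ P ∈ MeasFam Ω₁ Pt T, ∀ᵐ ω ∂P, 0 ≤ gainR S H T ω) →
    ∀ P ∈ MeasFam Ω₁ Pt T, ∀ᵐ ω ∂P, gainR S H T ω = 0

theorem NoArb.of_succ (hM : Market Pt S (T + 1)) (h : NoArb Pt S (T + 1)) : NoArb Pt S T := by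
  intro H hH hpos P hP
  have hgain : ∀ ω y, gainR S (Function.update H T fun _ => 0) (T + 1) (snocPair (ω, y)) =
      gainR S H T ω := by
    intro ω y
    simp [gainR_update_snocPair]
  have hgain' : ∀ ω, gainR S (Function.update H T fun _ => 0) (T + 1) ω =
      gainR S H T (Fin.init ω) := by
    intro ω
    rw [gainR_succ, gainR_update]
    simp
  obtain ⟨κ, hκ, hκP⟩ := hM.exists_selector
  have h1 := h _ (hH.update (t := T) (h := fun _ => 0) (@measurable_const _ _ _ (univComp _) _)) ?_ _
    (mem_measFam_succ.2 ⟨P, hP, κ, hκ, hκP, rfl⟩)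
  · have := isProbabilityMeasure_of_mem_measFam hP
    filter_upwards [ae_ae_of_ae_step (measurable_univComp_coe hκ) h1] with ω hω
    simp only [hgain] at hω
    exact hω.exists.choose_spec
  · intro P' hP'
    obtain ⟨ν, hν, κ', hκ', -, rfl⟩ := mem_measFam_succ.1 hP'
    have := isProbabilityMeasure_of_mem_measFam hν
    filter_upwards [ae_init_step (measurable_univComp_coe hκ') (hpos ν hν)] with ω hω
    rwa [hgain']

end Market

section DynamicDuality

open ProbabilityTheory

variable {Ω₁ : Type} [MeasurableSpace Ω₁] [TopologicalSpace Ω₁] [PolishSpace Ω₁] [BorelSpace Ω₁]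
  [Nonempty Ω₁] {d : ℕ} {Pt : (t : ℕ) → (Fin t → Ω₁) → Set (ProbabilityMeasure Ω₁)}
  {S : (t : ℕ) → (Fin t → Ω₁) → Fin d → ℝ} {T : ℕ}

/-- The one-step cost as a function of the history. -/
def condCost (Pt : (t : ℕ) → (Fin t → Ω₁) → Set (ProbabilityMeasure Ω₁))
    (S : (t : ℕ) → (Fin t → Ω₁) → Fin d → ℝ) (u : (Fin (T + 1) → Ω₁) → ℝ≥0∞)
    (ω : Fin T → Ω₁) : ℝ≥0∞ :=
  stepCost (Pt T ω) (fun y => incr Ω₁ S T ω y) fun y => u (snocPair (ω, y))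

/-- The mean-value set of the step from `T` to `T + 1`, as a function of the history. -/
def condSet (Pt : (t : ℕ) → (Fin t → Ω₁) → Set (ProbabilityMeasure Ω₁))
    (S : (t : ℕ) → (Fin t → Ω₁) → Fin d → ℝ) (u : ℕ → (Fin (T + 1) → Ω₁) → ℝ≥0∞)
    (ω : Fin T → Ω₁) : Set ((Fin d → ℝ) × ℝ) :=
  meanValueSet (Pt T ω) (fun y => incr Ω₁ S T ω y) fun n y => u n (snocPair (ω, y))

theorem lsa_condCost (hM : Market Pt S (T + 1)) {u : (Fin (T + 1) → Ω₁) → ℝ≥0∞} (hu : LSA u) :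
    LSA (condCost Pt S u) := by
  obtain ⟨p, q, hpq⟩ := hM.exists_isParam
  exact lsa_stepCost hpq hM.measurable_incr (hu.comp continuous_snocPair)

theorem measurable_univComp_snocPair {u : (Fin (T + 1) → Ω₁) → ℝ≥0∞} (hu : LSA u)
    (ω : Fin T → Ω₁) : Measurable[univComp Ω₁] fun y => u (snocPair (ω, y)) :=
  (hu.comp (g := fun y => snocPair (ω, y))
    (continuous_snocPair.comp (by fun_prop))).measurable_univComp

/-- Near-optimal one-step martingale kernels extend a martingale measure. -/
theorem exists_martFam_step (hM : Market Pt S (T + 1)) {u : (Fin (T + 1) → Ω₁) → ℝ≥0∞}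
    (hu : LSA u) {ν : Measure (Fin T → Ω₁)} (hν : ν ∈ MartFam Pt S T)
    (hfin : ∫⁻ ω, condCost Pt S u ω ∂ν ≠ ⊤) {ε : ℝ≥0∞} (hε : ε ≠ 0) :
    ∃ μ ∈ MartFam Pt S (T + 1), ∫⁻ ω, u ω ∂μ ≤ ∫⁻ ω, condCost Pt S u ω ∂ν + ε := by
  obtain ⟨p, q, hpq⟩ := hM.exists_isParam
  obtain ⟨P, Q, hP, hQ, hPt, hQp, hopt⟩ := exists_near_optimal hpq
    (hM.nonempty T T.lt_succ_self) hM.measurable_incr (hu.comp continuous_snocPair) hε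
  have hνp := isProbabilityMeasure_of_mem_martFam hν
  have hae : ∀ᵐ ω ∂ν, condCost Pt S u ω < ⊤ :=
    ae_lt_top' ((lsa_condCost hM hu).aemeasurable ν) hfin
  refine ⟨step ν Q, ⟨ν, hν, Q, P, hQ, hQp, hP, hPt, hae.mono fun ω hω => ?_, rfl⟩, ?_⟩
  · exact ⟨(hopt ω hω).1, (hopt ω hω).2.1, (hopt ω hω).2.2.1⟩
  · have := isProbabilityMeasure_step (ν := ν) hQ
    rw [lintegral_step hQ (hu.aemeasurable _)]
    calc _ ≤ ∫⁻ ω, (condCost Pt S u ω + ε) ∂ν :=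
          lintegral_mono_ae (hae.mono fun ω hω => (hopt ω hω).2.2.2)
      _ = _ := by rw [lintegral_add_right _ measurable_const]; simp

/-- Absence of arbitrage rules out one-step arbitrage at almost all histories. -/
theorem ae_not_isBad (hM : Market Pt S (T + 1)) (hNA : NoArb Pt S (T + 1))
    {u : ℕ → (Fin (T + 1) → Ω₁) → ℝ≥0∞} (hu : ∀ n, LSA (u n))
    (hgood : ∀ P ∈ MeasFam Ω₁ Pt (T + 1), ∀ᵐ ω ∂P, ∃ n, u n ω < ⊤) :
    ∀ ν ∈ MeasFam Ω₁ Pt T, ∀ᵐ ω ∂ν, ¬ IsBad (condSet Pt S u ω) := by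
  obtain ⟨p, q, hpq⟩ := hM.exists_isParam
  obtain ⟨H, P, hH, hP, hPt, hHpos, hbad⟩ := exists_arbitrage_selector hpq
    (hM.nonempty T T.lt_succ_self) hM.measurable_incr fun n => (hu n).comp continuous_snocPair
  have hpred : Pred Ω₁ d (Function.update (fun _ _ => 0) T H) := pred_zero.update hH
  have hgain : ∀ ω y, gainR S (Function.update (fun _ _ => 0) T H) (T + 1) (snocPair (ω, y)) =
      ∑ i, H ω i * incr Ω₁ S T ω y i := by
    intro ω y
    rw [gainR_update_snocPair, gainR_zero, zero_add]
  have h0 := hNA _ hpred ?_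
  · intro ν hν
    have := isProbabilityMeasure_of_mem_measFam hν
    filter_upwards [ae_ae_of_ae_step (measurable_univComp_coe hP)
      (h0 _ (mem_measFam_succ.2 ⟨ν, hν, P, hP, hPt, rfl⟩))] with ω hω hωbad
    refine hbad ω hωbad (measure_mono_null ?_ (ae_iff.1 hω))
    intro y hy
    rw [Set.mem_ofPred_eq, hgain]
    exact hy.2.ne'
  · intro μ hμ
    have hgμ := hgood μ hμ
    obtain ⟨ν, hν, κ, hκ, hκP, rfl⟩ := mem_measFam_succ.1 hμ
    have := isProbabilityMeasure_of_mem_measFam hν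
    have hκ' := measurable_univComp_coe hκ
    refine ae_step_of_ae_ae hκ' (measurable_gainR hpred hM.measurable measurableSet_Ici) ?_
    filter_upwards [ae_ae_of_ae_step hκ' hgμ] with ω hω
    filter_upwards [hω, ae_nonneg_of_meanValueSet (hM.measurable_incr.comp measurable_prodMk_left)
      (fun n => measurable_univComp_snocPair (hu n) ω) (hHpos ω) (hκP ω)] with y h1 h2
    rw [hgain]
    exact h2 h1

theorem ae_exists_condCost_lt_top (hM : Market Pt S (T + 1)) (hNA : NoArb Pt S (T + 1))
    {u : ℕ → (Fin (T + 1) → Ω₁) → ℝ≥0∞} (hu : ∀ n, LSA (u n))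
    (hmono : ∀ n m : ℕ, n ≤ m → ∀ ω, u m ω ≤ u n ω + ((m - n : ℕ) : ℝ≥0∞))
    (hgood : ∀ P ∈ MeasFam Ω₁ Pt (T + 1), ∀ᵐ ω ∂P, ∃ n, u n ω < ⊤) :
    ∀ ν ∈ MeasFam Ω₁ Pt T, ∀ᵐ ω ∂ν, ∃ n, condCost Pt S (u n) ω < ⊤ := by
  intro ν hν
  obtain ⟨κ, hκ, hκP⟩ := hM.exists_selector
  have := isProbabilityMeasure_of_mem_measFam hν
  filter_upwards [ae_ae_of_ae_step (measurable_univComp_coe hκ)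
    (hgood _ (mem_measFam_succ.2 ⟨ν, hν, κ, hκ, hκP, rfl⟩)),
    ae_not_isBad hM hNA hu hgood ν hν] with ω h1 h2
  refine exists_stepCost_lt_top (u := fun n y => u n (snocPair (ω, y)))
    (hM.convex T T.lt_succ_self ω) (fun n m hnm y => hmono n m hnm _) ?_ h2
  refine meanValueSet_nonempty (hM.measurable_incr.comp measurable_prodMk_left)
    (fun n => measurable_univComp_snocPair (hu n) ω) (hκP ω) ?_
  intro h0
  exact NeZero.ne (κ ω : Measure Ω₁) (Measure.measure_univ_eq_zero.1
    ((measure_eq_measure_of_null_sdiff (subset_univ _) (by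
      rw [← compl_eq_univ_sdiff]; exact ae_iff.1 h1)).symm.trans h0))

/-- One-step extension of a superhedging strategy. -/
theorem exists_pred_succ (hM : Market Pt S (T + 1)) (hNA : NoArb Pt S (T + 1))
    {u : ℕ → (Fin (T + 1) → Ω₁) → ℝ≥0∞} (hu : ∀ n, LSA (u n))
    (hmono : ∀ n m : ℕ, n ≤ m → ∀ ω, u m ω ≤ u n ω + ((m - n : ℕ) : ℝ≥0∞))
    (hgood : ∀ P ∈ MeasFam Ω₁ Pt (T + 1), ∀ᵐ ω ∂P, ∃ n, u n ω < ⊤) {c : ℝ}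
    {H : (t : ℕ) → (Fin t → Ω₁) → Fin d → ℝ} (hH : Pred Ω₁ d H)
    (hHv : ∀ ν ∈ MeasFam Ω₁ Pt T, ∀ᵐ ω ∂ν, ∀ n : ℕ,
      ENNReal.ofReal (n - (c + gainR S H T ω)) ≤ condCost Pt S (u n) ω) :
    ∃ H', Pred Ω₁ d H' ∧ ∀ P ∈ MeasFam Ω₁ Pt (T + 1), ∀ᵐ ω ∂P, ∀ n : ℕ,
      ENNReal.ofReal (n - (c + gainR S H' (T + 1) ω)) ≤ u n ω := by
  obtain ⟨p, q, hpq⟩ := hM.exists_isParam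
  have hgm : Measurable[univComp (Fin T → Ω₁)] fun ω => c + gainR S H T ω :=
    @Measurable.comp _ _ _ (univComp (Fin T → Ω₁)) _ _ _ _ (measurable_const_add c)
      (measurable_gainR hH hM.of_succ.measurable)
  obtain ⟨h, hh, hslope⟩ := exists_hedge_selector hpq hM.measurable_incr
    (fun n => (hu n).comp continuous_snocPair) hgm
  have hpred : Pred Ω₁ d (Function.update H T fun ω => -h ω) :=
    hH.update (@Measurable.comp _ _ _ (univComp (Fin T → Ω₁)) _ _ _ _ measurable_neg hh)
  refine ⟨_, hpred, fun μ hμ => ?_⟩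
  obtain ⟨ν, hν, κ, hκ, hκP, rfl⟩ := mem_measFam_succ.1 hμ
  have := isProbabilityMeasure_of_mem_measFam hν
  rw [ae_all_iff]
  intro n
  refine ae_step_of_ae_ae (measurable_univComp_coe hκ) ?_ ?_
  · refine @measurableSet_le _ _ _ _ _ (univComp _) _ _ _ _ _ ?_ (hu n).measurable_univComp
    exact @Measurable.comp _ _ _ (univComp (Fin (T + 1) → Ω₁)) _ _
      (fun r : ℝ => ENNReal.ofReal (n - (c + r))) _ (by fun_prop)
      (measurable_gainR hpred hM.measurable)
  · filter_upwards [hHv ν hν, ae_not_isBad hM hNA hu hgood ν hν] with ω h1 h2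
    have h3 := hslope ω (slopes_nonempty_of_not_isBad
      (u := fun n y => u n (snocPair (ω, y))) (hM.convex T T.lt_succ_self ω)
      (fun n m hnm y => hmono n m hnm _) h2 h1)
    filter_upwards [ae_hedge_of_meanValueSet (hM.measurable_incr.comp measurable_prodMk_left)
      (fun n => measurable_univComp_snocPair (hu n) ω) h3 (hκP ω)] with y hy
    have := hy n
    rw [gainR_update_snocPair]
    simp only [Pi.neg_apply, neg_mul, Finset.sum_neg_distrib, ← sub_eq_add_neg, ← add_sub_assoc]
    exact this

/-- Superhedging duality for a family of lower semianalytic shortfall costs. -/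
theorem exists_superhedge_of_martFam : ∀ {T : ℕ}, Market Pt S T → NoArb Pt S T →
    ∀ {u : ℕ → (Fin T → Ω₁) → ℝ≥0∞}, (∀ n, LSA (u n)) →
    (∀ n m : ℕ, n ≤ m → ∀ ω, u m ω ≤ u n ω + ((m - n : ℕ) : ℝ≥0∞)) →
    (∀ P ∈ MeasFam Ω₁ Pt T, ∀ᵐ ω ∂P, ∃ n, u n ω < ⊤) →
    (∀ c : ℝ, (∀ n : ℕ, ∀ μ ∈ MartFam Pt S T, ENNReal.ofReal (n - c) ≤ ∫⁻ ω, u n ω ∂μ) →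
      ∃ H, Pred Ω₁ d H ∧ ∀ P ∈ MeasFam Ω₁ Pt T, ∀ᵐ ω ∂P, ∀ n : ℕ,
        ENNReal.ofReal (n - (c + gainR S H T ω)) ≤ u n ω) ∧
    ∃ μ ∈ MartFam Pt S T, ∃ n, ∫⁻ ω, u n ω ∂μ < ⊤
  | 0, _, _, u, _, _, hgood => by
    have hInt : ∀ n, ∫⁻ ω, u n ω ∂(Measure.dirac (Fin.elim0 : Fin 0 → Ω₁)) = u n Fin.elim0 :=
      fun n => lintegral_dirac' _ (Subsingleton.measurable)
    refine ⟨fun c hc => ⟨_, pred_zero, fun P _ => ae_of_all _ fun ω n => ?_⟩,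
      Measure.dirac Fin.elim0, rfl, ?_⟩
    · have := hc n _ rfl
      rw [hInt] at this
      rw [gainR_zero, add_zero, Subsingleton.elim ω Fin.elim0]
      exact this
    · obtain ⟨ω, n, hn⟩ := (hgood (Measure.dirac Fin.elim0) rfl).exists
      refine ⟨n, ?_⟩
      rwa [hInt, Subsingleton.elim Fin.elim0 ω]
  | T + 1, hM, hNA, u, hu, hmono, hgood => by
    obtain ⟨hA, ν, hν, n, hn⟩ := exists_superhedge_of_martFam hM.of_succ (hNA.of_succ hM)
      (u := fun n => condCost Pt S (u n)) (fun n => lsa_condCost hM (hu n))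
      (fun n m hnm ω => stepCost_le_add (u := fun n y => u n (snocPair (ω, y)))
        (fun n m hnm y => hmono n m hnm _) hnm)
      (ae_exists_condCost_lt_top hM hNA hu hmono hgood)
    refine ⟨fun c hc => ?_, ?_⟩
    · obtain ⟨H, hH, hHv⟩ := hA c fun n ν hν => by
        by_cases hfin : ∫⁻ ω, condCost Pt S (u n) ω ∂ν = ⊤
        · simp [hfin]
        · refine ENNReal.le_of_forall_pos_le_add fun ε hε _ => ?_
          obtain ⟨μ, hμ, hle⟩ := exists_martFam_step hM (hu n) hν hfin
            (ENNReal.coe_ne_zero.2 hε.ne')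
          exact (hc n μ hμ).trans hle
      exact exists_pred_succ hM hNA hu hmono hgood hH hHv
    · obtain ⟨μ, hμ, hle⟩ := exists_martFam_step hM (hu n) hν hn.ne one_ne_zero
      exact ⟨μ, hμ, n, hle.trans_lt (ENNReal.add_lt_top.2 ⟨hn, ENNReal.one_lt_top⟩)⟩

end DynamicDuality

theorem LSA.const_mul_inv {X : Type*} [TopologicalSpace X] [PolishSpace X] {φ : X → ℝ≥0∞}
    (hφ : LSA φ) {a : ℝ≥0∞} (ha : a ≠ 0) (ha' : a ≠ ⊤) : LSA fun x => φ x / a := by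
  intro c
  simp_rw [ENNReal.div_lt_iff (Or.inl ha) (Or.inl ha')]
  exact hφ _

theorem UpperSemianalytic.lsa_ofReal_sub {X : Type*} [TopologicalSpace X] [PolishSpace X]
    {F : X → ℝ} (hF : UpperSemianalytic F) (a : ℝ) : LSA fun x => ENNReal.ofReal (a - F x) := by
  intro c
  rcases eq_or_ne c ⊤ with rfl | hc
  · simpa using (isClosed_univ (X := X)).analyticSet
  · by_cases hc0 : c = 0
    · simpa [hc0] using analyticSet_empty
    · have : {x | ENNReal.ofReal (a - F x) < c} = {x | a - c.toReal < F x} := by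
        ext x
        rw [Set.mem_ofPred_eq, Set.mem_ofPred_eq, ← ENNReal.ofReal_toReal hc,
          ENNReal.ofReal_lt_ofReal_iff (ENNReal.toReal_pos hc0 hc), ENNReal.ofReal_toReal hc]
        constructor <;> intro h <;> linarith
      rw [this]
      exact hF _

theorem ofReal_integral_le_lintegral_ofReal {X : Type*} [MeasurableSpace X] {μ : Measure X}
    {G : X → ℝ} (hG : Integrable G μ) :
    ENNReal.ofReal (∫ x, G x ∂μ) ≤ ∫⁻ x, ENNReal.ofReal (G x) ∂μ := by
  calc ENNReal.ofReal (∫ x, G x ∂μ) ≤ ENNReal.ofReal (∫ x, max (G x) 0 ∂μ) :=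
        ENNReal.ofReal_le_ofReal (integral_mono hG hG.pos_part fun x => le_max_left _ _)
    _ = ∫⁻ x, ENNReal.ofReal (max (G x) 0) ∂μ :=
        ofReal_integral_eq_lintegral_ofReal hG.pos_part (ae_of_all _ fun x => le_max_right _ _)
    _ = _ := by simp

theorem le_of_forall_ofReal_sub_le {a b c : ℝ} (hc : 0 ≤ c)
    (h : ∀ n : ℕ, ENNReal.ofReal (n - b) ≤
      ENNReal.ofReal (n - a) + ENNReal.ofReal c / ((n + 1 : ℕ) : ℝ≥0∞)) : a ≤ b := by
  have key : ∀ᶠ n : ℕ in atTop, a ≤ b + c / ((n : ℝ) + 1) := by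
    filter_upwards [eventually_ge_atTop ⌈|a| + |b|⌉₊] with n hn
    have hn' : |a| + |b| ≤ n := (Nat.le_ceil _).trans (by exact_mod_cast hn)
    have h1 : 0 ≤ (n : ℝ) - a := by linarith [le_abs_self a, abs_nonneg b]
    have hpos : (0 : ℝ) < (n + 1 : ℕ) := by positivity
    have h2 := h n
    rw [← ENNReal.ofReal_natCast (n + 1), ← ENNReal.ofReal_div_of_pos hpos,
      ← ENNReal.ofReal_add h1 (by positivity),
      ENNReal.ofReal_le_ofReal_iff (by positivity)] at h2
    push_cast at h2
    linarith
  have hlim : Tendsto (fun n : ℕ => b + c / ((n : ℝ) + 1)) atTop (𝓝 (b + 0)) :=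
    tendsto_const_nhds.add (tendsto_const_nhds.div_atTop
      (tendsto_atTop_add_const_right _ _ tendsto_natCast_atTop_atTop))
  rw [add_zero] at hlim
  exact ge_of_tendsto hlim key

section DynamicDuality

variable {Ω₁ : Type} [MeasurableSpace Ω₁] [TopologicalSpace Ω₁] [PolishSpace Ω₁] [BorelSpace Ω₁]
  [Nonempty Ω₁] {d : ℕ} {Pt : (t : ℕ) → (Fin t → Ω₁) → Set (ProbabilityMeasure Ω₁)}
  {S : (t : ℕ) → (Fin t → Ω₁) → Fin d → ℝ} {T : ℕ}

/-- Superhedging with stocks only: if the prices under all martingale measures integrating a given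
weight are at most `p`, then the claim can be superhedged from `p`. -/
theorem exists_superhedge_of_upperSemianalytic (hM : Market Pt S T) (hNA : NoArb Pt S T)
    {F : (Fin T → Ω₁) → ℝ} (hF : UpperSemianalytic F) {φ : (Fin T → Ω₁) → ℝ≥0∞} (hφ : LSA φ)
    (hφt : ∀ ω, φ ω ≠ ⊤) :
    (∃ μ ∈ MartFam Pt S T, ∫⁻ ω, φ ω ∂μ ≠ ⊤) ∧
    ∀ p : ℝ, (∀ μ ∈ MartFam Pt S T, ∫⁻ ω, φ ω ∂μ ≠ ⊤ → Integrable F μ ∧ ∫ ω, F ω ∂μ ≤ p) →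
      ∃ H, Pred Ω₁ d H ∧ ∀ P ∈ MeasFam Ω₁ Pt T, ∀ᵐ ω ∂P, F ω ≤ p + gainR S H T ω := by
  have ha : ∀ n : ℕ, ((n + 1 : ℕ) : ℝ≥0∞) ≠ 0 := fun n => by simp
  have ha' : ∀ n : ℕ, ((n + 1 : ℕ) : ℝ≥0∞) ≠ ⊤ := fun n => ENNReal.natCast_ne_top _
  set u : ℕ → (Fin T → Ω₁) → ℝ≥0∞ := fun n ω =>
    ENNReal.ofReal (n - F ω) + φ ω / ((n + 1 : ℕ) : ℝ≥0∞) with hu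
  have hφu : ∀ μ : Measure (Fin T → Ω₁), ∀ n, ∫⁻ ω, u n ω ∂μ ≠ ⊤ → ∫⁻ ω, φ ω ∂μ ≠ ⊤ := by
    intro μ n hn
    have h1 : ∫⁻ ω, φ ω / ((n + 1 : ℕ) : ℝ≥0∞) ∂μ ≠ ⊤ :=
      ne_top_of_le_ne_top hn (lintegral_mono fun ω => le_add_self)
    simp_rw [div_eq_mul_inv] at h1
    rw [lintegral_mul_const' _ _ (ENNReal.inv_ne_top.2 (ha n))] at h1
    intro h
    rw [h, ENNReal.top_mul (ENNReal.inv_ne_zero.2 (ha' n))] at h1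
    exact h1 rfl
  have hmono : ∀ n m : ℕ, n ≤ m → ∀ ω, u m ω ≤ u n ω + ((m - n : ℕ) : ℝ≥0∞) := by
    intro n m hnm ω
    have h1 : ENNReal.ofReal (m - F ω) ≤ ENNReal.ofReal (n - F ω) + ((m - n : ℕ) : ℝ≥0∞) := by
      rw [← ENNReal.ofReal_natCast (m - n), Nat.cast_sub hnm]
      refine le_trans (le_of_eq ?_) ENNReal.ofReal_add_le
      congr 1; ring
    calc u m ω ≤ (ENNReal.ofReal (n - F ω) + ((m - n : ℕ) : ℝ≥0∞)) +
          φ ω / ((n + 1 : ℕ) : ℝ≥0∞) := by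
          refine add_le_add h1 (ENNReal.div_le_div_left ?_ _)
          exact_mod_cast Nat.succ_le_succ hnm
      _ = _ := by simp only [hu]; ring
  obtain ⟨hA, μ, hμ, n, hn⟩ := exists_superhedge_of_martFam hM hNA (u := u)
    (fun n => (hF.lsa_ofReal_sub n).add (hφ.const_mul_inv (ha n) (ha' n)))
    hmono (fun P _ => ae_of_all _ fun ω => ⟨0, by simp [hu, (hφt ω).lt_top]⟩)
  refine ⟨⟨μ, hμ, hφu μ n hn.ne⟩, fun p hp => ?_⟩
  obtain ⟨H, hH, hHP⟩ := hA p fun n μ hμ => by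
    by_cases hfin : ∫⁻ ω, u n ω ∂μ = ⊤
    · simp [hfin]
    · obtain ⟨hFi, hFp⟩ := hp μ hμ (hφu μ n hfin)
      have := isProbabilityMeasure_of_mem_martFam hμ
      have h1 := ofReal_integral_le_lintegral_ofReal ((integrable_const (n : ℝ)).sub hFi)
      simp only [Pi.sub_apply] at h1
      rw [integral_sub (integrable_const _) hFi] at h1
      simp only [integral_const, probReal_univ, smul_eq_mul, one_mul] at h1
      exact (ENNReal.ofReal_le_ofReal (by linarith)).trans
        (h1.trans (lintegral_mono fun ω => le_self_add))
  refine ⟨H, hH, fun P hP => (hHP P hP).mono fun ω hω => ?_⟩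
  refine le_of_forall_ofReal_sub_le (c := (φ ω).toReal) ENNReal.toReal_nonneg fun n => ?_
  rw [ENNReal.ofReal_toReal (hφt ω)]
  exact hω n

end DynamicDuality

theorem integrable_of_lintegral_ofReal_ne_top {X : Type*} [MeasurableSpace X]
    {μ : Measure X} {f : X → ℝ} (hf : AEMeasurable f μ)
    (hpos : ∫⁻ x, ENNReal.ofReal (f x) ∂μ ≠ ⊤) (hneg : ∫⁻ x, ENNReal.ofReal (-f x) ∂μ ≠ ⊤) :
    Integrable f μ := by
  refine ⟨hf.aestronglyMeasurable, ?_⟩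
  rw [hasFiniteIntegral_iff_norm]
  refine lt_of_le_of_lt (lintegral_mono fun x => ?_)
    (lt_of_eq_of_lt (lintegral_add_left' hf.ennreal_ofReal fun x => ENNReal.ofReal (-f x))
      (ENNReal.add_lt_top.2 ⟨hpos.lt_top, hneg.lt_top⟩))
  rw [Real.norm_eq_abs]
  rcases abs_cases (f x) with h | h <;> rw [h.1]
  · exact le_self_add
  · exact le_add_self

section MartingaleTransform

variable {X : Type*} {m m0 : MeasurableSpace X} {μ : Measure X} [IsFiniteMeasure μ] {d : ℕ}

theorem setIntegral_mul_eq_zero (hm : m ≤ m0) {h Z : X → ℝ} (hh : Measurable[m] h)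
    (hZ : Integrable Z μ) (hZ0 : ∀ A, MeasurableSet[m] A → ∫ x in A, Z x ∂μ = 0) {A : Set X}
    (hA : MeasurableSet[m] A) {c : ℝ} (hc : ∀ x ∈ A, |h x| ≤ c) :
    IntegrableOn (fun x => h x * Z x) A μ ∧ ∫ x in A, h x * Z x ∂μ = 0 := by
  have hc0 : ∀ x, |A.indicator h x| ≤ max c 0 := by
    intro x
    by_cases hx : x ∈ A
    · rw [indicator_of_mem hx]; exact (hc x hx).trans (le_max_left _ _)
    · simp [indicator_of_notMem hx]
  have hhA : StronglyMeasurable[m] (A.indicator h) := (hh.indicator hA).stronglyMeasurable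
  have hcond : (0 : X → ℝ) =ᵐ[μ] μ[Z|m] := by
    refine ae_eq_condExp_of_forall_setIntegral_eq hm hZ (fun s _ _ => integrableOn_zero)
      (fun s hs _ => ?_) stronglyMeasurable_zero.aestronglyMeasurable
    rw [hZ0 s hs]; simp
  have hInt : Integrable (A.indicator h * Z) μ :=
    hZ.bdd_mul (hhA.mono hm).aestronglyMeasurable (ae_of_all _ hc0)
  have heq : A.indicator h * Z = A.indicator fun x => h x * Z x := by
    ext x
    by_cases hx : x ∈ A <;> simp [hx]
  have hA0 : MeasurableSet A := hm _ hA
  refine ⟨?_, ?_⟩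
  · rw [← integrable_indicator_iff hA0, ← heq]; exact hInt
  · rw [← integral_indicator hA0, ← heq, ← integral_condExp hm]
    have h1 := condExp_mul_of_stronglyMeasurable_left hhA hInt hZ
    rw [integral_congr_ae h1]
    refine integral_eq_zero_of_ae ?_
    filter_upwards [hcond] with x hx
    simp [← hx]

theorem lintegral_neg_lt_top_of_martingale_transform (hm : m ≤ m0) {V : X → ℝ}
    {H Z : Fin d → X → ℝ} (hV : Measurable[m] V) (hH : ∀ i, Measurable[m] (H i))
    (hZ : ∀ i, Integrable (Z i) μ)
    (hZ0 : ∀ i, ∀ A, MeasurableSet[m] A → ∫ x in A, Z i x ∂μ = 0)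
    (hneg : ∫⁻ x, ENNReal.ofReal (-(V x + ∑ i, H i x * Z i x)) ∂μ ≠ ⊤) :
    ∫⁻ x, ENNReal.ofReal (-V x) ∂μ ≠ ⊤ ∧ (Integrable V μ →
      Integrable (fun x => V x + ∑ i, H i x * Z i x) μ ∧
      ∫ x, V x + ∑ i, H i x * Z i x ∂μ = ∫ x, V x ∂μ) := by
  set V' : X → ℝ := fun x => V x + ∑ i, H i x * Z i x with hV'
  let B : ℕ → Set X := fun k => {x | |V x| ≤ k} ∩ ⋂ i, {x | |H i x| ≤ k}
  have hB : ∀ k, MeasurableSet[m] (B k) := fun k =>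
    (measurableSet_le (measurable_norm.comp hV) measurable_const).inter
      (MeasurableSet.iInter fun i =>
        measurableSet_le (measurable_norm.comp (hH i)) measurable_const)
  have hBmono : Monotone B := by
    intro k l hkl x hx
    have hkl' : (k : ℝ) ≤ l := by exact_mod_cast hkl
    exact ⟨le_trans hx.1 hkl', mem_iInter.2 fun i => le_trans (mem_iInter.1 hx.2 i) hkl'⟩
  have hBU : ⋃ k, B k = univ := by
    refine eq_univ_of_forall fun x => ?_
    obtain ⟨k, hk⟩ := exists_nat_ge (|V x| + ∑ i, |H i x|)
    refine mem_iUnion.2 ⟨k, ?_, mem_iInter.2 fun i => ?_⟩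
    · have : 0 ≤ ∑ i, |H i x| := Finset.sum_nonneg fun i _ => abs_nonneg _
      simp only [mem_ofPred_eq]; linarith
    · have := Finset.single_le_sum (f := fun i => |H i x|) (fun i _ => abs_nonneg _)
        (Finset.mem_univ i)
      have h0 := abs_nonneg (V x)
      simp only [mem_ofPred_eq] at this ⊢; linarith
  have hloc : ∀ k A, MeasurableSet[m] A → A ⊆ B k →
      IntegrableOn V A μ ∧ IntegrableOn V' A μ ∧ ∫ x in A, V' x ∂μ = ∫ x in A, V x ∂μ := by
    intro k A hA hAB
    have hVi : IntegrableOn V A μ :=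
      Measure.integrableOn_of_bounded (M := k) (measure_ne_top _ _)
        (hV.mono hm le_rfl).aestronglyMeasurable
        (by filter_upwards [ae_restrict_mem (hm _ hA)] with x hx using (hAB hx).1)
    have h1 := fun i => setIntegral_mul_eq_zero hm (hH i) (hZ i) (hZ0 i) hA (c := k)
      fun x hx => mem_iInter.1 (hAB hx).2 i
    have h2 : IntegrableOn (fun x => ∑ i, H i x * Z i x) A μ :=
      integrable_finsetSum _ fun i _ => (h1 i).1
    refine ⟨hVi, hVi.add h2, ?_⟩
    rw [hV', integral_add hVi h2, integral_finsetSum _ fun i _ => (h1 i).1]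
    simp [(h1 _).2]
  have hVm : Measurable V := hV.mono hm le_rfl
  have hV'm : AEMeasurable V' μ :=
    hVm.aemeasurable.add (Finset.aemeasurable_fun_sum _ fun i _ =>
      ((hH i).mono hm le_rfl).aemeasurable.mul (hZ i).aestronglyMeasurable.aemeasurable)
  have hlim : ∀ W : X → ℝ≥0∞, ∀ C, (∀ k, ∫⁻ x in B k, W x ∂μ ≤ C) → ∫⁻ x, W x ∂μ ≤ C := by
    intro W C hC
    rw [← setLIntegral_univ, ← hBU, setLIntegral_iUnion_of_directed _ hBmono.directed_le]
    exact iSup_le hC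
  refine ⟨ne_top_of_le_ne_top hneg (hlim _ _ fun k => ?_), fun hVi => ?_⟩
  · have hN : MeasurableSet[m] {x | V x ≤ 0} := measurableSet_le hV measurable_const
    have hA := (hB k).inter hN
    obtain ⟨h1, h2, h3⟩ := hloc k _ hA inter_subset_left
    have e : ∫⁻ x in B k, ENNReal.ofReal (-V x) ∂μ =
        ∫⁻ x in B k ∩ {x | V x ≤ 0}, ENNReal.ofReal (-V x) ∂μ := by
      rw [inter_comm, ← Measure.restrict_restrict (hm _ hN), ← lintegral_indicator (hm _ hN)]
      refine lintegral_congr fun x => ?_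
      by_cases hx : V x ≤ 0
      · rw [indicator_of_mem (by exact hx)]
      · rw [indicator_of_notMem (by exact hx), ENNReal.ofReal_of_nonpos]
        linarith
    have hn : Integrable (fun x => -V x) (μ.restrict (B k ∩ {x | V x ≤ 0})) := h1.neg
    rw [e, ← ofReal_integral_eq_lintegral_ofReal hn]
    · rw [integral_neg, ← h3, ← integral_neg]
      exact (ofReal_integral_le_lintegral_ofReal h2.neg).trans (setLIntegral_le_lintegral _ _)
    · filter_upwards [ae_restrict_mem (hm _ hA)] with x hx
      have : V x ≤ 0 := hx.2
      simpa using this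
  · have hpos : ∫⁻ x, ENNReal.ofReal (V' x) ∂μ ≠ ⊤ := by
      refine ne_top_of_le_ne_top (ENNReal.add_ne_top.2 ⟨hneg, ENNReal.ofReal_ne_top
        (r := ∫ x, |V x| ∂μ)⟩) (hlim _ _ fun k => ?_)
      obtain ⟨h1, h2, h3⟩ := hloc k _ (hB k) subset_rfl
      have hle : ∫ x in B k, V' x ∂μ ≤ ∫ x, |V x| ∂μ := by
        rw [h3]
        exact (integral_mono h1 h1.abs fun x => le_abs_self _).trans
          (setIntegral_le_integral hVi.abs (ae_of_all _ fun x => abs_nonneg _))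
      have e1 : ∫ x in B k, V' x ∂μ = ∫ x in B k, max (V' x) 0 ∂μ -
          ∫ x in B k, max (-V' x) 0 ∂μ := by
        rw [← integral_sub h2.pos_part h2.neg_part]
        refine integral_congr_ae (ae_of_all _ fun x => ?_)
        simp only []
        rcases le_total 0 (V' x) with h | h
        · rw [max_eq_left h, max_eq_right (by linarith)]; ring
        · rw [max_eq_right h, max_eq_left (by linarith)]; ring
      calc ∫⁻ x in B k, ENNReal.ofReal (V' x) ∂μ
          = ∫⁻ x in B k, ENNReal.ofReal (max (V' x) 0) ∂μ := by simp
        _ = ENNReal.ofReal (∫ x in B k, max (V' x) 0 ∂μ) :=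
            (ofReal_integral_eq_lintegral_ofReal h2.pos_part
              (ae_of_all _ fun x => le_max_right _ _)).symm
        _ ≤ ENNReal.ofReal (∫ x in B k, max (-V' x) 0 ∂μ + ∫ x, |V x| ∂μ) :=
            ENNReal.ofReal_le_ofReal (by linarith)
        _ ≤ ENNReal.ofReal (∫ x in B k, max (-V' x) 0 ∂μ) + ENNReal.ofReal (∫ x, |V x| ∂μ) :=
            ENNReal.ofReal_add_le
        _ ≤ _ := by
            gcongr
            rw [ofReal_integral_eq_lintegral_ofReal h2.neg_part
              (ae_of_all _ fun x => le_max_right _ _)]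
            simp only [ENNReal.ofReal_max, ENNReal.ofReal_zero, max_eq_left, zero_le]
            exact setLIntegral_le_lintegral (μ := μ) (B k) fun x => ENNReal.ofReal (-V' x)
    have hV'i : Integrable V' μ := integrable_of_lintegral_ofReal_ne_top hV'm hpos hneg
    refine ⟨hV'i, ?_⟩
    have t1 := tendsto_setIntegral_of_monotone (f := V') (fun k => hm _ (hB k)) hBmono
      hV'i.integrableOn
    have t2 := tendsto_setIntegral_of_monotone (f := V) (fun k => hm _ (hB k)) hBmono
      hVi.integrableOn
    rw [hBU, setIntegral_univ] at t1 t2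
    exact tendsto_nhds_unique (t1.congr fun k => (hloc k _ (hB k) subset_rfl).2.2) t2

end MartingaleTransform

open ProbabilityTheory

section Martingale

variable {Ω₁ : Type} [MeasurableSpace Ω₁] {d T : ℕ}
  {S : (t : ℕ) → (Fin t → Ω₁) → Fin d → ℝ}

theorem measurable_restr {t : ℕ} (h : t ≤ T) : Measurable (restr Ω₁ t h) := by
  unfold restr; fun_prop

theorem exists_measurableSet_preimage_ae_eq {X Y : Type*} [MeasurableSpace X] [MeasurableSpace Y]
    {r : X → Y} (hr : Measurable r) (μ : Measure X) [IsProbabilityMeasure μ] {B : Set Y}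
    (hB : MeasurableSet[univComp Y] B) : ∃ B', MeasurableSet B' ∧ r ⁻¹' B' =ᵐ[μ] r ⁻¹' B := by
  have := Measure.isProbabilityMeasure_map (μ := μ) hr.aemeasurable
  obtain ⟨B', -, hB', h⟩ := (hB (μ.map r) this).exists_measurable_superset_ae_eq
  exact ⟨B', hB', (hr.quasiMeasurePreserving μ).preimage_ae_eq h⟩

theorem isMartMeas_iff {Q : Measure (Fin T → Ω₁)} [IsProbabilityMeasure Q] :
    IsMartMeas Ω₁ S Q ↔
      (∀ (t : ℕ) (h : t ≤ T) (i : Fin d), Integrable (fun ω => S t (restr Ω₁ t h ω) i) Q) ∧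
      ∀ (t : ℕ) (h : t + 1 ≤ T) (i : Fin d) (B : Set (Fin t → Ω₁)), MeasurableSet B →
        ∫ ω in restr Ω₁ t ((Nat.le_succ t).trans h) ⁻¹' B,
            S (t + 1) (restr Ω₁ (t + 1) h ω) i ∂Q
          = ∫ ω in restr Ω₁ t ((Nat.le_succ t).trans h) ⁻¹' B,
            S t (restr Ω₁ t ((Nat.le_succ t).trans h) ω) i ∂Q := by
  refine and_congr_right fun _ => ⟨fun hQ t h i B hB =>
    hQ t h i _ ⟨B, measurableSet_univComp hB, rfl⟩, fun hQ t h i A hA => ?_⟩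
  obtain ⟨B, hB, rfl⟩ := hA
  obtain ⟨B', hB', hBB'⟩ := exists_measurableSet_preimage_ae_eq
    (measurable_restr ((Nat.le_succ t).trans h)) Q hB
  rw [← setIntegral_congr_set hBB', ← setIntegral_congr_set hBB']
  exact hQ t h i B' hB'

theorem isMartMeas_succ (hS : ∀ t ≤ T + 1, Measurable (S t)) {Q : Measure (Fin (T + 1) → Ω₁)}
    [IsProbabilityMeasure Q] :
    IsMartMeas Ω₁ S Q ↔ IsMartMeas Ω₁ S (Q.map Fin.init) ∧
      (∀ i, Integrable (fun ω => S (T + 1) ω i) Q) ∧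
      ∀ i (B : Set (Fin T → Ω₁)), MeasurableSet B →
        ∫ ω in Fin.init ⁻¹' B, S (T + 1) ω i ∂Q = ∫ ω in Fin.init ⁻¹' B, S T (Fin.init ω) i ∂Q := by
  have hinit : Measurable (Fin.init : (Fin (T + 1) → Ω₁) → Fin T → Ω₁) := measurable_init
  have := Measure.isProbabilityMeasure_map (μ := Q) hinit.aemeasurable
  have hSm : ∀ t (h : t ≤ T) (i : Fin d), Measurable fun ω => S t (restr Ω₁ t h ω) i :=
    fun t h i => (measurable_pi_apply i).comp
      ((hS t (h.trans T.le_succ)).comp (measurable_restr h))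
  have hI : ∀ t (h : t ≤ T) (i : Fin d),
      Integrable (fun ω => S t (restr Ω₁ t h ω) i) (Q.map Fin.init) ↔
        Integrable (fun ω => S t (restr Ω₁ t (h.trans T.le_succ) ω) i) Q := fun t h i =>
    integrable_map_measure (hSm t h i).aestronglyMeasurable hinit.aemeasurable
  have hE : ∀ t u (h : t ≤ T) (hu : u ≤ T) (i : Fin d) (B : Set (Fin u → Ω₁)), MeasurableSet B →
      ∫ ω in restr Ω₁ u hu ⁻¹' B, S t (restr Ω₁ t h ω) i ∂(Q.map Fin.init) =
        ∫ ω in restr Ω₁ u (hu.trans T.le_succ) ⁻¹' B,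
          S t (restr Ω₁ t (h.trans T.le_succ) ω) i ∂Q := fun t u h hu i B hB =>
    setIntegral_map (measurable_restr hu hB) (hSm t h i).aestronglyMeasurable hinit.aemeasurable
  rw [isMartMeas_iff, isMartMeas_iff]
  refine ⟨fun h => ⟨⟨fun t ht i => (hI t ht i).2 (h.1 t (ht.trans T.le_succ) i),
    fun t ht i B hB => ?_⟩, fun i => h.1 (T + 1) le_rfl i, fun i B hB => h.2 T le_rfl i B hB⟩,
    fun h => ⟨fun t ht i => ?_, fun t ht i B hB => ?_⟩⟩
  · rw [hE _ _ _ _ _ _ hB, hE _ _ _ _ _ _ hB]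
    exact h.2 t (ht.trans T.le_succ) i B hB
  · rcases Nat.le_succ_iff_eq_or_le.1 ht with rfl | ht'
    · exact h.2.1 i
    · exact (hI t ht' i).1 (h.1.1 t ht' i)
  · rcases Nat.le_succ_iff_eq_or_le.1 ht with ht' | ht'
    · obtain rfl : t = T := by simpa using ht'
      exact h.2.2 i B hB
    · have := h.1.2 t ht' i B hB
      rwa [hE _ _ _ _ _ _ hB, hE _ _ _ _ _ _ hB] at this

theorem gainR_integral_eq_zero {H : (t : ℕ) → (Fin t → Ω₁) → Fin d → ℝ} (hH : Pred Ω₁ d H) :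
    ∀ {T : ℕ} {Q : Measure (Fin T → Ω₁)} [IsProbabilityMeasure Q],
      (∀ t ≤ T, Measurable (S t)) → IsMartMeas Ω₁ S Q →
      ∫⁻ ω, ENNReal.ofReal (-gainR S H T ω) ∂Q ≠ ⊤ →
      Integrable (gainR S H T) Q ∧ ∫ ω, gainR S H T ω ∂Q = 0
  | 0, Q, _, _, _, _ => by
    have : gainR S H 0 = fun _ => 0 := rfl
    simp [this]
  | T + 1, Q, _, hS, hQ, hneg => by
    have hinit : Measurable (Fin.init : (Fin (T + 1) → Ω₁) → Fin T → Ω₁) := measurable_init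
    have hprob := Measure.isProbabilityMeasure_map (μ := Q) hinit.aemeasurable
    obtain ⟨hQ', hQi, hQe⟩ := (isMartMeas_succ hS).1 hQ
    have hST : ∀ i, Integrable (fun ω => S T (Fin.init ω) i) Q := fun i => hQ.1 T T.le_succ i
    have hVa : AEMeasurable (gainR S H T) (Q.map Fin.init) := aemeasurable_of_measurable_univComp
      (measurable_gainR hH fun u hu => hS u (hu.trans T.le_succ)) _
    have hHa : AEMeasurable (H T) (Q.map Fin.init) := aemeasurable_of_measurable_univComp (hH T) _
    have hVae := ae_of_ae_map hinit.aemeasurable hVa.ae_eq_mk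
    have hHae := ae_of_ae_map hinit.aemeasurable hHa.ae_eq_mk
    have hVm := hVa.measurable_mk
    have hHm := hHa.measurable_mk
    generalize hVa.mk _ = V at hVae hVm
    generalize hHa.mk _ = K at hHae hHm
    have hgain : gainR S H (T + 1) =ᵐ[Q] fun ω => V (Fin.init ω) +
        ∑ i, K (Fin.init ω) i * (S (T + 1) ω i - S T (Fin.init ω) i) := by
      filter_upwards [hVae, hHae] with ω h1 h2
      rw [gainR_succ, h1, h2]
    have hcomap : Measurable[MeasurableSpace.comap Fin.init inferInstance]
        (Fin.init : (Fin (T + 1) → Ω₁) → Fin T → Ω₁) := comap_measurable _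
    have key := lintegral_neg_lt_top_of_martingale_transform (μ := Q) hinit.comap_le
      (V := fun ω => V (Fin.init ω)) (H := fun i ω => K (Fin.init ω) i)
      (Z := fun i ω => S (T + 1) ω i - S T (Fin.init ω) i)
      (hVm.comp hcomap) (fun i => (measurable_pi_apply i).comp (hHm.comp hcomap))
      (fun i => (hQi i).sub (hST i)) (by
        rintro i _ ⟨B, hB, rfl⟩
        rw [integral_sub (hQi i).integrableOn (hST i).integrableOn, hQe i B hB, sub_self])
      (ne_of_eq_of_ne (lintegral_congr_ae (hgain.mono fun ω h => congrArg
        (fun x => ENNReal.ofReal (-x)) h.symm)) hneg)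
    have hV0 : ∫⁻ ω, ENNReal.ofReal (-gainR S H T ω) ∂(Q.map Fin.init) ≠ ⊤ := by
      have hVn : AEMeasurable (fun ω => ENNReal.ofReal (-gainR S H T ω)) (Q.map Fin.init) :=
        hVa.neg.ennreal_ofReal
      rw [lintegral_map' hVn hinit.aemeasurable]
      exact ne_of_eq_of_ne (lintegral_congr_ae (hVae.mono fun ω h => congrArg
        (fun x => ENNReal.ofReal (-x)) h)) key.1
    obtain ⟨hi, h0⟩ := gainR_integral_eq_zero hH
      (fun t ht => hS t (ht.trans T.le_succ)) hQ' hV0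
    have hi' : Integrable (fun ω => V (Fin.init ω)) Q :=
      ((integrable_map_measure hVa.aestronglyMeasurable hinit.aemeasurable).1 hi).congr hVae
    obtain ⟨k1, k2⟩ := key.2 hi'
    refine ⟨k1.congr hgain.symm, ?_⟩
    rw [integral_congr_ae hgain, k2, ← h0,
      integral_map hinit.aemeasurable hVa.aestronglyMeasurable]
    exact (integral_congr_ae hVae).symm

end Martingale

section MartFam

variable {Ω₁ : Type} [MeasurableSpace Ω₁] [TopologicalSpace Ω₁] [PolishSpace Ω₁] [BorelSpace Ω₁]
  [Nonempty Ω₁] {d : ℕ} {Pt : (t : ℕ) → (Fin t → Ω₁) → Set (ProbabilityMeasure Ω₁)}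
  {S : (t : ℕ) → (Fin t → Ω₁) → Fin d → ℝ}

theorem isMartMeas_of_mem_martFam :
    ∀ {T : ℕ} {μ : Measure (Fin T → Ω₁)}, (∀ t ≤ T, Measurable (S t)) → μ ∈ MartFam Pt S T →
      (∀ t (h : t ≤ T) i, Integrable (fun ω => S t (restr Ω₁ t h ω) i) μ) → IsMartMeas Ω₁ S μ
  | 0, _, _, _, hInt => ⟨hInt, fun t h => absurd h (by omega)⟩
  | T + 1, μ, hS, hμ, hInt => by
    have hprob := isProbabilityMeasure_of_mem_martFam hμ
    obtain ⟨ν, hν, κ, P, hκ, hκp, -, -, hae, rfl⟩ := hμ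
    have := isProbabilityMeasure_of_mem_martFam hν
    have hinit : Measurable (Fin.init : (Fin (T + 1) → Ω₁) → Fin T → Ω₁) := measurable_init
    have hS' : ∀ t ≤ T, Measurable (S t) := fun t ht => hS t (ht.trans T.le_succ)
    refine (isMartMeas_succ hS).2 ⟨?_, fun i => hInt _ le_rfl i, fun i B hB => ?_⟩
    · rw [map_init_step hκ]
      refine isMartMeas_of_mem_martFam hS' hν fun t h i => ?_
      rw [← map_init_step (ν := ν) hκ]
      exact (integrable_map_measure ((measurable_pi_apply i).comp
        ((hS' t h).comp (measurable_restr h))).aestronglyMeasurable hinit.aemeasurable).2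
        (hInt t (h.trans T.le_succ) i)
    · have h1 : Integrable (fun ω => S (T + 1) ω i) (step ν κ) := hInt _ le_rfl i
      have h2 : Integrable (fun ω => S T (Fin.init ω) i) (step ν κ) := hInt T T.le_succ i
      rw [← sub_eq_zero, ← integral_sub h1.integrableOn h2.integrableOn]
      obtain ⟨κ', hκ', hκκ'⟩ := exists_kernel_ae_eq hκ ν
      have h3 : Integrable (fun ω => S (T + 1) ω i - S T (Fin.init ω) i) (step ν κ) := h1.sub h2
      rw [step_eq_map_compProd hκκ'] at h3 ⊢
      have h4 : Integrable (fun a => S (T + 1) (snocPair a) i - S T (Fin.init (snocPair a)) i)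
          (ν ⊗ₘ κ') := (integrable_map_measure h3.aestronglyMeasurable
        measurable_snocPair.aemeasurable).1 h3
      rw [setIntegral_map (hinit hB) h3.aestronglyMeasurable measurable_snocPair.aemeasurable]
      have hpre : snocPair ⁻¹' (Fin.init ⁻¹' B) = B ×ˢ (univ : Set Ω₁) := by
        ext a
        simp [init_snocPair]
      rw [hpre, Measure.setIntegral_compProd hB MeasurableSet.univ h4.integrableOn]
      refine integral_eq_zero_of_ae (ae_restrict_of_ae ?_)
      filter_upwards [hae, hκκ'] with ω hω hω'
      rw [← hω', setIntegral_univ]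
      have := hω.2.2 i
      simp only [incr] at this
      simpa [init_snocPair, snocPair] using this

end MartFam

section Expectation

variable {X : Type*} [MeasurableSpace X] {μ : Measure X} {f : X → ℝ}

theorem lintegral_ofReal_ne_top (hf : Integrable f μ) : ∫⁻ x, ENNReal.ofReal (f x) ∂μ ≠ ⊤ :=
  (hf.lintegral_lt_top).ne

theorem expec_of_integrable (hf : Integrable f μ) : expec μ f = ((∫ x, f x ∂μ : ℝ) : EReal) := by
  have h1 := lintegral_ofReal_ne_top hf
  have h2 : ∫⁻ x, ENNReal.ofReal (-f x) ∂μ ≠ ⊤ := lintegral_ofReal_ne_top hf.neg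
  rw [integral_eq_lintegral_pos_part_sub_lintegral_neg_part hf, expec, EReal.coe_sub,
    EReal.coe_ennreal_toReal h1, EReal.coe_ennreal_toReal h2]

theorem lintegral_neg_ne_top_of_expec_ne_bot (h : expec μ f ≠ ⊥) :
    ∫⁻ x, ENNReal.ofReal (-f x) ∂μ ≠ ⊤ := by
  intro h0
  refine h ?_
  rw [expec, h0]
  simp [sub_eq_add_neg]

theorem expec_ne_bot (h : ∫⁻ x, ENNReal.ofReal (-f x) ∂μ ≠ ⊤) : expec μ f ≠ ⊥ := by
  rw [expec, ← EReal.coe_ennreal_toReal h]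
  refine ne_of_gt (lt_of_lt_of_le (EReal.bot_lt_coe (0 - (∫⁻ x, ENNReal.ofReal (-f x) ∂μ).toReal)) ?_)
  rw [EReal.coe_sub]
  exact EReal.sub_le_sub (EReal.coe_ennreal_nonneg _) le_rfl

theorem integrable_of_expec_le (hf : AEMeasurable f μ) (h : expec μ f ≠ ⊥) {c : ℝ}
    (hc : expec μ f ≤ c) : Integrable f μ := by
  have h2 := lintegral_neg_ne_top_of_expec_ne_bot h
  refine integrable_of_lintegral_ofReal_ne_top hf (fun h1 => ?_) h2
  rw [expec, h1, ← EReal.coe_ennreal_toReal h2] at hc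
  rw [EReal.coe_ennreal_top, EReal.top_sub_coe] at hc
  exact absurd hc (not_le.2 (EReal.coe_lt_top c))

end Expectation

theorem QuasiSure.ae {X : Type*} [MeasurableSpace X] {PP : Set (Measure X)} {p : X → Prop}
    (h : QuasiSure PP (univComp X) p) {P : Measure X} (hP : P ∈ PP) :
    ∀ᵐ x ∂P, p x := by
  obtain ⟨A, _, hA, h⟩ := h
  exact ae_iff.2 (measure_mono_null hA (h P hP))

theorem quasiSure_iff {X : Type*} [MeasurableSpace X] {PP : Set (Measure X)} {p : X → Prop}
    (hp : MeasurableSet[univComp X] {x | p x}) :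
    QuasiSure PP (univComp X) p ↔ ∀ P ∈ PP, ∀ᵐ x ∂P, p x :=
  ⟨fun h _ hP => h.ae hP, fun h => ⟨{x | ¬p x}, @MeasurableSet.compl _ _ (univComp X) hp, subset_rfl,
      fun P hP => ae_iff.1 (h P hP)⟩⟩

section Semianalytic

variable {X : Type*} [TopologicalSpace X] [PolishSpace X] [MeasurableSpace X] [BorelSpace X]

theorem UpperSemianalytic.of_measurable {f : X → ℝ} (hf : Measurable f) : UpperSemianalytic f :=
  fun _ => (measurableSet_lt measurable_const hf).analyticSet

theorem UpperSemianalytic.measurable_univComp {f : X → ℝ} (hf : UpperSemianalytic f) :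
    Measurable[univComp X] f :=
  @measurable_of_Ioi _ X _ _ _ (univComp X) _ _ _ _
    fun c => measurableSet_univComp_of_analyticSet (hf c)

theorem UpperSemianalytic.add_measurable {f g : X → ℝ} (hf : UpperSemianalytic f)
    (hg : Measurable g) : UpperSemianalytic fun x => f x + g x := by
  intro c
  have : {x | c < f x + g x} = ⋃ q : ℚ, {x | (q : ℝ) < f x} ∩ {x | c - q < g x} := by
    ext x
    simp only [mem_ofPred_eq, mem_iUnion, mem_inter_iff]
    refine ⟨fun h => ?_, fun ⟨q, h1, h2⟩ => by linarith⟩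
    obtain ⟨q, hq1, hq2⟩ := exists_rat_btwn (show c - g x < f x by linarith)
    exact ⟨q, hq2, by linarith⟩
  rw [this]
  exact AnalyticSet.iUnion fun q => analyticSet_inter (hf q)
    (measurableSet_lt measurable_const hg).analyticSet

end Semianalytic

section Domination

variable {Ω₁ : Type} [MeasurableSpace Ω₁] [TopologicalSpace Ω₁] [PolishSpace Ω₁] [BorelSpace Ω₁]
  [Nonempty Ω₁] {d : ℕ} {Pt : (t : ℕ) → (Fin t → Ω₁) → Set (ProbabilityMeasure Ω₁)}
  {S : (t : ℕ) → (Fin t → Ω₁) → Fin d → ℝ}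

theorem Market.exists_dominating : ∀ {T : ℕ}, Market Pt S T → ∀ {P₁ P₂ : Measure (Fin T → Ω₁)},
    P₁ ∈ MeasFam Ω₁ Pt T → P₂ ∈ MeasFam Ω₁ Pt T → ∃ P ∈ MeasFam Ω₁ Pt T, P₁ ≪ P ∧ P₂ ≪ P
  | 0, _, P₁, P₂, h₁, h₂ => ⟨P₁, h₁, Measure.AbsolutelyContinuous.rfl, by
      rw [show P₁ = Measure.dirac Fin.elim0 from h₁, show P₂ = Measure.dirac Fin.elim0 from h₂]⟩
  | T + 1, hM, P₁, P₂, h₁, h₂ => by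
    classical
    obtain ⟨ν₁, hν₁, κ₁, hκ₁, hκ₁P, rfl⟩ := mem_measFam_succ.1 h₁
    obtain ⟨ν₂, hν₂, κ₂, hκ₂, hκ₂P, rfl⟩ := mem_measFam_succ.1 h₂
    obtain ⟨ν, hν, hν₁ν, hν₂ν⟩ := Market.exists_dominating hM.of_succ hν₁ hν₂
    have := isProbabilityMeasure_of_mem_measFam hν
    have := isProbabilityMeasure_of_mem_measFam hν₁
    have := isProbabilityMeasure_of_mem_measFam hν₂
    obtain ⟨p, q, hpq⟩ := hM.exists_isParam
    obtain ⟨z₀, hz₀, hz₀p⟩ := hpq.exists_selector (hM.nonempty T T.lt_succ_self)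
    obtain ⟨η₁, _, hη₁⟩ := exists_kernel_ae_eq (measurable_univComp_coe hκ₁) ν
    obtain ⟨η₂, _, hη₂⟩ := exists_kernel_ae_eq (measurable_univComp_coe hκ₂) ν
    let Γ : Set ((Fin T → Ω₁) × (ℕ → ℕ)) := {a | p a.2 = a.1 ∧
      η₁ a.1 ≪ (q a.2 : Measure Ω₁) ∧ η₂ a.1 ≪ (q a.2 : Measure Ω₁)}
    have hΓ : MeasurableSet Γ := by
      have h0 : MeasurableSet {a : (Fin T → Ω₁) × (ℕ → ℕ) | p a.2 = a.1} :=
        (isClosed_eq (hpq.continuous_fst.comp continuous_snd) continuous_fst).measurableSet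
      exact h0.inter ((Kernel.measurableSet_absolutelyContinuous
        (η₁.comap Prod.fst measurable_fst) (hpq.kernel.comap Prod.snd measurable_snd)).inter
        (Kernel.measurableSet_absolutelyContinuous
        (η₂.comap Prod.fst measurable_fst) (hpq.kernel.comap Prod.snd measurable_snd)))
    obtain ⟨s, hs, hsΓ⟩ := exists_univComp_selector hΓ.analyticSet
    let z : (Fin T → Ω₁) → ℕ → ℕ := fun ω => if (ω, s ω) ∈ Γ then s ω else z₀ ω
    have hset : MeasurableSet[univComp (Fin T → Ω₁)] {ω | (ω, s ω) ∈ Γ} :=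
      @Measurable.prodMk _ (univComp (Fin T → Ω₁)) _ _ _ _ _ _
        (measurable_univComp_of_measurable measurable_id) hs _ hΓ
    have hz : Measurable[univComp (Fin T → Ω₁)] z :=
      @Measurable.ite _ _ _ _ (univComp (Fin T → Ω₁)) _ _ _ hset hs hz₀
    have hzp : ∀ ω, p (z ω) = ω := by
      intro ω
      by_cases h : (ω, s ω) ∈ Γ
      · simp only [z, if_pos h]; exact h.1
      · simp only [z, if_neg h]; exact hz₀p ω
    have hac : ∀ᵐ ω ∂ν, (κ₁ ω : Measure Ω₁) ≪ (q (z ω) : Measure Ω₁) ∧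
        (κ₂ ω : Measure Ω₁) ≪ (q (z ω) : Measure Ω₁) := by
      filter_upwards [hη₁, hη₂] with ω h1 h2
      obtain ⟨P, hP, hP1, hP2⟩ := exists_half_sum_mem (hM.convex T T.lt_succ_self ω)
        (hκ₁P ω) (hκ₂P ω)
      obtain ⟨y, hy, rfl⟩ := (hpq.mem_iff _ _).1 hP
      have hmem := hsΓ ω ⟨y, hy, by rwa [← h1], by rwa [← h2]⟩
      simp only [z, if_pos hmem, h1, h2]
      exact hmem.2
    have hqz := hpq.measurable_comp hz
    refine ⟨step ν fun ω => (q (z ω) : Measure Ω₁), mem_measFam_succ.2 ⟨ν, hν, fun ω => q (z ω),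
      hqz, fun ω => (hpq.mem_iff _ _).2 ⟨z ω, hzp ω, rfl⟩, rfl⟩, ?_, ?_⟩
    · exact step_absolutelyContinuous (measurable_univComp_coe hκ₁) (measurable_univComp_coe hqz)
        hν₁ν (hν₁ν.ae_le (hac.mono fun ω h => h.1))
    · exact step_absolutelyContinuous (measurable_univComp_coe hκ₂) (measurable_univComp_coe hqz)
        hν₂ν (hν₂ν.ae_le (hac.mono fun ω h => h.2))

end Domination

section SemistaticDuality

variable {Ω₁ : Type} [MeasurableSpace Ω₁] [TopologicalSpace Ω₁] [PolishSpace Ω₁] [BorelSpace Ω₁]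
  [Nonempty Ω₁] {T d e : ℕ} {Pt : (t : ℕ) → (Fin t → Ω₁) → Set (ProbabilityMeasure Ω₁)}
  {S : (t : ℕ) → (Fin t → Ω₁) → Fin d → ℝ} {g : Fin e → (Fin T → Ω₁) → ℝ}
  {f : (Fin T → Ω₁) → ℝ}

theorem integrable_sum_mul {X : Type*} [MeasurableSpace X] {μ : Measure X} {g : Fin e → X → ℝ}
    (hg : ∀ i, Integrable (g i) μ) (h : Fin e → ℝ) : Integrable (fun x => ∑ i, h i * g i x) μ :=
  integrable_finsetSum _ fun i _ => (hg i).const_mul (h i)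

theorem integral_sum_mul {X : Type*} [MeasurableSpace X] {μ : Measure X} {g : Fin e → X → ℝ}
    (hg : ∀ i, Integrable (g i) μ) (h : Fin e → ℝ) :
    ∫ x, ∑ i, h i * g i x ∂μ = ∑ i, h i * ∫ x, g i x ∂μ := by
  rw [integral_finsetSum _ fun i _ => (hg i).const_mul (h i)]
  simp only [integral_const_mul]

/-- The martingale measures, not necessarily calibrated to the options, under which the options
and the negative part of the claim are integrable. -/
def IntegrableMart (Pt : (t : ℕ) → (Fin t → Ω₁) → Set (ProbabilityMeasure Ω₁))
    (S : (t : ℕ) → (Fin t → Ω₁) → Fin d → ℝ) (g : Fin e → (Fin T → Ω₁) → ℝ)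
    (f : (Fin T → Ω₁) → ℝ) : Set (Measure (Fin T → Ω₁)) :=
  {Q | IsProbabilityMeasure Q ∧ (∃ P ∈ MeasFam Ω₁ Pt T, Q ≪ P) ∧ IsMartMeas Ω₁ S Q ∧
    (∀ i, Integrable (g i) Q) ∧ ∫⁻ ω, ENNReal.ofReal (-f ω) ∂Q ≠ ⊤}

/-- A superhedging inequality can be integrated against a martingale measure. -/
theorem integral_le_of_ae_le_gainR (hS : ∀ t ≤ T, Measurable (S t))
    {H : (t : ℕ) → (Fin t → Ω₁) → Fin d → ℝ} (hH : Pred Ω₁ d H) {Q : Measure (Fin T → Ω₁)}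
    [IsProbabilityMeasure Q] (hQ : IsMartMeas Ω₁ S Q) {G : (Fin T → Ω₁) → ℝ} (hG : Integrable G Q)
    (hf : AEMeasurable f Q) (hneg : ∫⁻ ω, ENNReal.ofReal (-f ω) ∂Q ≠ ⊤)
    (hle : ∀ᵐ ω ∂Q, f ω ≤ gainR S H T ω + G ω) :
    Integrable f Q ∧ ∫ ω, f ω ∂Q ≤ ∫ ω, G ω ∂Q := by
  have h1 : ∫⁻ ω, ENNReal.ofReal (-gainR S H T ω) ∂Q ≠ ⊤ := by
    refine ne_top_of_le_ne_top (ENNReal.add_ne_top.2 ⟨hneg, lintegral_ofReal_ne_top hG⟩) ?_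
    rw [← lintegral_add_right' _ hG.aemeasurable.ennreal_ofReal]
    refine lintegral_mono_ae (hle.mono fun ω h => ?_)
    exact (ENNReal.ofReal_le_ofReal (by linarith)).trans ENNReal.ofReal_add_le
  obtain ⟨hi, h0⟩ := gainR_integral_eq_zero hH hS hQ h1
  have hfi : Integrable f Q := by
    refine integrable_of_lintegral_ofReal_ne_top hf ?_ hneg
    exact ne_top_of_le_ne_top (lintegral_ofReal_ne_top (hi.add hG))
      (lintegral_mono_ae (hle.mono fun ω h => ENNReal.ofReal_le_ofReal h))
  refine ⟨hfi, ?_⟩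
  have h2 := integral_mono_ae hfi (hi.add hG) hle
  rwa [integral_add' hi hG, h0, zero_add] at h2

theorem measurableSet_univComp_le_hedge (hS : ∀ t ≤ T, Measurable (S t))
    {H : (t : ℕ) → (Fin t → Ω₁) → Fin d → ℝ} (hH : Pred Ω₁ d H) (hg : ∀ i, Measurable (g i))
    (hf : Measurable[univComp (Fin T → Ω₁)] f) (x : ℝ) (h : Fin e → ℝ) :
    MeasurableSet[univComp (Fin T → Ω₁)]
      {ω | f ω ≤ x + gain Ω₁ S H T le_rfl ω + ∑ i, h i * g i ω} := by
  simp only [gain_eq_gainR]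
  have h1 : Measurable fun ω => ∑ i, h i * g i ω := by fun_prop
  refine @measurableSet_le _ _ _ _ _ (univComp _) _ _ _ _ _ hf
    (@Measurable.add _ _ _ _ (univComp _) (fun ω => x + gainR S H T ω) _ _
      (@Measurable.add _ _ _ _ (univComp _) (fun _ => x) _ _
        (@measurable_const _ _ _ (univComp _) _) (measurable_gainR hH hS))
      (measurable_univComp_of_measurable h1))

/-- Weak duality: superhedging prices dominate the calibrated martingale expectations. -/
theorem expec_le_of_superhedge (hS : ∀ t ≤ T, Measurable (S t)) (hg : ∀ i, Measurable (g i))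
    (hf : UpperSemianalytic f) {Q : Measure (Fin T → Ω₁)}
    (hQ : Q ∈ QSet Ω₁ (MeasFam Ω₁ Pt T) S g) {x : ℝ}
    {H : (t : ℕ) → (Fin t → Ω₁) → Fin d → ℝ} {h : Fin e → ℝ} (hH : Pred Ω₁ d H)
    (hle : QuasiSure (MeasFam Ω₁ Pt T) (univComp (Fin T → Ω₁))
      (fun ω => f ω ≤ x + gain Ω₁ S H T le_rfl ω + ∑ i, h i * g i ω)) : expec Q f ≤ x := by
  obtain ⟨hp, ⟨P, hP, hQP⟩, hm, hQg⟩ := hQ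
  by_cases hbot : expec Q f = ⊥
  · rw [hbot]; exact bot_le
  have hgi : ∀ i, Integrable (g i) Q := fun i =>
    integrable_of_expec_le (hg i).aemeasurable (by rw [hQg i]; exact EReal.zero_ne_bot)
      (c := 0) (by rw [hQg i]; rfl)
  have hg0 : ∀ i, ∫ ω, g i ω ∂Q = 0 := fun i => by
    have := hQg i
    rw [expec_of_integrable (hgi i)] at this
    exact_mod_cast this
  have hGi := (integrable_const (μ := Q) x).add (integrable_sum_mul hgi h)
  obtain ⟨hfi, hfle⟩ := integral_le_of_ae_le_gainR hS hH hm hGi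
    (aemeasurable_of_measurable_univComp hf.measurable_univComp Q)
    (lintegral_neg_ne_top_of_expec_ne_bot hbot)
    (hQP.ae_le ((hle.ae hP).mono fun ω hω => by
      rw [gain_eq_gainR] at hω; simp only [Pi.add_apply]; linarith))
  rw [integral_add' (integrable_const x) (integrable_sum_mul hgi h), integral_sum_mul hgi] at hfle
  rw [expec_of_integrable hfi]
  simp only [hg0, mul_zero, Finset.sum_const_zero, add_zero, integral_const, probReal_univ,
    one_smul] at hfle
  exact_mod_cast hfle

theorem isMartMeas_ofReal_smul_add {Q₁ Q₂ : Measure (Fin T → Ω₁)} (h₁ : IsMartMeas Ω₁ S Q₁)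
    (h₂ : IsMartMeas Ω₁ S Q₂) {a b : ℝ} (ha : 0 ≤ a) (hb : 0 ≤ b) :
    IsMartMeas Ω₁ S (ENNReal.ofReal a • Q₁ + ENNReal.ofReal b • Q₂) := by
  refine ⟨fun t h i => (integrable_ofReal_smul_add (h₁.1 t h i) (h₂.1 t h i) ha hb).1,
    fun t h i A hA => ?_⟩
  rw [Measure.restrict_add, Measure.restrict_smul, Measure.restrict_smul,
    (integrable_ofReal_smul_add (h₁.1 _ _ i).restrict (h₂.1 _ _ i).restrict ha hb).2,
    (integrable_ofReal_smul_add (h₁.1 _ _ i).restrict (h₂.1 _ _ i).restrict ha hb).2,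
    h₁.2 t h i A hA, h₂.2 t h i A hA]

theorem ofReal_smul_add_mem_integrableMart (hM : Market Pt S T) {Q₁ Q₂ : Measure (Fin T → Ω₁)}
    (h₁ : Q₁ ∈ IntegrableMart Pt S g f) (h₂ : Q₂ ∈ IntegrableMart Pt S g f) {a b : ℝ}
    (ha : 0 ≤ a) (hb : 0 ≤ b) (hab : a + b = 1) :
    ENNReal.ofReal a • Q₁ + ENNReal.ofReal b • Q₂ ∈ IntegrableMart Pt S g f := by
  obtain ⟨hp₁, ⟨P₁, hP₁, hQP₁⟩, hm₁, hg₁, hf₁⟩ := h₁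
  obtain ⟨hp₂, ⟨P₂, hP₂, hQP₂⟩, hm₂, hg₂, hf₂⟩ := h₂
  obtain ⟨P, hP, hPP₁, hPP₂⟩ := hM.exists_dominating hP₁ hP₂
  refine ⟨isProbabilityMeasure_ofReal_smul_add ha hb hab, ⟨P, hP, absolutelyContinuous_smul_add
    (hQP₁.trans hPP₁) (hQP₂.trans hPP₂) _ _⟩, isMartMeas_ofReal_smul_add hm₁ hm₂ ha hb,
    fun i => (integrable_ofReal_smul_add (hg₁ i) (hg₂ i) ha hb).1, ?_⟩
  rw [lintegral_add_measure, lintegral_smul_measure, lintegral_smul_measure]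
  exact ENNReal.add_ne_top.2 ⟨ENNReal.mul_ne_top ENNReal.ofReal_ne_top hf₁,
    ENNReal.mul_ne_top ENNReal.ofReal_ne_top hf₂⟩

theorem lintegral_ofReal_neg_min_le {X : Type*} [MeasurableSpace X] {μ : Measure X} (f : X → ℝ)
    (n : ℕ) : ∫⁻ x, ENNReal.ofReal (-min (f x) n) ∂μ ≤ ∫⁻ x, ENNReal.ofReal (-f x) ∂μ := by
  refine lintegral_mono fun x => ?_
  rcases le_total (f x) n with h | h
  · rw [min_eq_left h]
  · rw [min_eq_right h, ENNReal.ofReal_of_nonpos (neg_nonpos.2 n.cast_nonneg)]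
    exact zero_le

theorem integrable_min_natCast {X : Type*} [MeasurableSpace X] {μ : Measure X}
    [IsProbabilityMeasure μ] {f : X → ℝ} (hf : AEMeasurable f μ)
    (hneg : ∫⁻ x, ENNReal.ofReal (-f x) ∂μ ≠ ⊤) (n : ℕ) :
    Integrable (fun x => min (f x) n) μ := by
  refine integrable_of_lintegral_ofReal_ne_top (hf.min aemeasurable_const)
    (ne_top_of_le_ne_top (lintegral_ofReal_ne_top (integrable_const (n : ℝ)))
      (lintegral_mono fun x => ENNReal.ofReal_le_ofReal (min_le_right _ _)))
    (ne_top_of_le_ne_top hneg (lintegral_ofReal_neg_min_le f n))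

/-- If the truncated means are bounded, the function is integrable with the same bound. -/
theorem integrable_of_integral_min_le {X : Type*} [MeasurableSpace X] {μ : Measure X}
    [IsProbabilityMeasure μ] {f : X → ℝ} (hf : AEMeasurable f μ)
    (hneg : ∫⁻ x, ENNReal.ofReal (-f x) ∂μ ≠ ⊤) {c : ℝ}
    (hc : ∀ n : ℕ, ∫ x, min (f x) n ∂μ ≤ c) : Integrable f μ ∧ ∫ x, f x ∂μ ≤ c := by
  have hi := integrable_min_natCast hf hneg
  have hlim : ∀ x, ∀ᶠ n : ℕ in atTop, min (f x) n = f x := fun x => by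
    obtain ⟨N, hN⟩ := exists_nat_ge (f x)
    filter_upwards [eventually_ge_atTop N] with n hn
    exact min_eq_left (hN.trans (by exact_mod_cast hn))
  have hpos : ∫⁻ x, ENNReal.ofReal (f x) ∂μ ≠ ⊤ := by
    refine ne_top_of_le_ne_top (b := ENNReal.ofReal (c + (∫⁻ x, ENNReal.ofReal (-f x) ∂μ).toReal))
      ENNReal.ofReal_ne_top ?_
    have hmono : Monotone fun (n : ℕ) x => ENNReal.ofReal (min (f x) n) := fun n m hnm x =>
      ENNReal.ofReal_le_ofReal (min_le_min_left _ (by exact_mod_cast hnm))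
    have h1 := lintegral_tendsto_of_tendsto_of_monotone (μ := μ)
      (f := fun (n : ℕ) x => ENNReal.ofReal (min (f x) n)) (F := fun x => ENNReal.ofReal (f x))
      (fun n => (hi n).aemeasurable.ennreal_ofReal) (ae_of_all _ fun x n m hnm => hmono hnm x)
      (ae_of_all _ fun x => tendsto_const_nhds.congr' ((hlim x).mono fun n hn => (congrArg ENNReal.ofReal hn).symm))
    refine le_of_tendsto' h1 fun n => ?_
    have h2 := integral_eq_lintegral_pos_part_sub_lintegral_neg_part (hi n)
    have h3 := ENNReal.toReal_mono hneg (lintegral_ofReal_neg_min_le f n)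
    rw [← ENNReal.ofReal_toReal (lintegral_ofReal_ne_top (hi n))]
    exact ENNReal.ofReal_le_ofReal (by linarith [hc n])
  have hfi := integrable_of_lintegral_ofReal_ne_top hf hpos hneg
  refine ⟨hfi, le_of_tendsto' (integral_tendsto_of_tendsto_of_monotone hi hfi
    (ae_of_all _ fun x n m hnm => min_le_min_left _ (by exact_mod_cast hnm))
    (ae_of_all _ fun x => tendsto_const_nhds.congr' ((hlim x).mono fun n hn => hn.symm))) hc⟩

/-- The attainable pairs of option means and lower bounds for truncated claim means. -/
def optionMeans (Pt : (t : ℕ) → (Fin t → Ω₁) → Set (ProbabilityMeasure Ω₁))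
    (S : (t : ℕ) → (Fin t → Ω₁) → Fin d → ℝ) (g : Fin e → (Fin T → Ω₁) → ℝ)
    (f : (Fin T → Ω₁) → ℝ) : Set ((Fin e → ℝ) × ℝ) :=
  {k | ∃ Q ∈ IntegrableMart Pt S g f, (∀ i, ∫ ω, g i ω ∂Q = k.1 i) ∧
    ∃ n : ℕ, k.2 ≤ ∫ ω, min (f ω) n ∂Q}

theorem convex_optionMeans (hM : Market Pt S T) (hf : UpperSemianalytic f) :
    Convex ℝ (optionMeans Pt S g f) := by
  rintro k₁ ⟨Q₁, hQ₁, hg₁, n₁, hn₁⟩ k₂ ⟨Q₂, hQ₂, hg₂, n₂, hn₂⟩ a b ha hb hab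
  have hi : ∀ {Q}, Q ∈ IntegrableMart Pt S g f → ∀ n : ℕ, Integrable (fun ω => min (f ω) n) Q :=
    fun {Q} hQ n => by
      have := hQ.1
      exact integrable_min_natCast
        (aemeasurable_of_measurable_univComp hf.measurable_univComp Q) hQ.2.2.2.2 n
  have hmono : ∀ {Q}, Q ∈ IntegrableMart Pt S g f → ∀ n m : ℕ, n ≤ m →
      ∫ ω, min (f ω) n ∂Q ≤ ∫ ω, min (f ω) m ∂Q := fun hQ n m hnm =>
    integral_mono (hi hQ n) (hi hQ m) fun ω => min_le_min_left _ (Nat.cast_le.2 hnm)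
  refine ⟨_, ofReal_smul_add_mem_integrableMart hM hQ₁ hQ₂ ha hb hab, fun i => ?_, max n₁ n₂, ?_⟩
  · rw [(integrable_ofReal_smul_add (hQ₁.2.2.2.1 i) (hQ₂.2.2.2.1 i) ha hb).2, hg₁, hg₂]
    simp
  · rw [(integrable_ofReal_smul_add (hi hQ₁ _) (hi hQ₂ _) ha hb).2]
    simp only [Prod.snd_add, Prod.smul_snd, smul_eq_mul]
    have := hn₁.trans (hmono hQ₁ _ _ (le_max_left n₁ n₂))
    have := hn₂.trans (hmono hQ₂ _ _ (le_max_right n₁ n₂))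
    gcongr

/-- Superhedging without options, tested on the integrable martingale measures only. -/
theorem exists_superhedge_of_integrableMart (hM : Market Pt S T) (hNA : NoArb Pt S T)
    (hg : ∀ i, Measurable (g i)) (hf : UpperSemianalytic f) {F : (Fin T → Ω₁) → ℝ}
    (hF : UpperSemianalytic F) :
    (IntegrableMart Pt S g f).Nonempty ∧ ∀ p : ℝ,
      (∀ Q ∈ IntegrableMart Pt S g f, Integrable F Q ∧ ∫ ω, F ω ∂Q ≤ p) →
      ∃ H, Pred Ω₁ d H ∧ ∀ P ∈ MeasFam Ω₁ Pt T, ∀ᵐ ω ∂P, F ω ≤ p + gainR S H T ω := by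
  let φ : (Fin T → Ω₁) → ℝ≥0∞ := fun ω => ((∑ i, ENNReal.ofReal |g i ω|) +
    ENNReal.ofReal (0 - f ω)) + ∑ t : Fin (T + 1), ∑ i,
      ENNReal.ofReal |S t (restr Ω₁ t (Nat.lt_succ_iff.1 t.2) ω) i|
  have hSm : ∀ (t : ℕ) (h : t ≤ T) (i : Fin d), Measurable fun ω => S t (restr Ω₁ t h ω) i :=
    fun t h i => (measurable_pi_apply i).comp ((hM.measurable t h).comp (measurable_restr h))
  have hφ : LSA φ :=
    ((LSA.sum _ fun i _ => LSA.of_measurable (hg i).abs.ennreal_ofReal).add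
      (hf.lsa_ofReal_sub 0)).add (LSA.sum _ fun t _ => LSA.sum _ fun i _ =>
        LSA.of_measurable (hSm t _ i).abs.ennreal_ofReal)
  have hφt : ∀ ω, φ ω ≠ ⊤ := fun ω => by simp [φ]
  have key : ∀ μ ∈ MartFam Pt S T, ∫⁻ ω, φ ω ∂μ ≠ ⊤ → μ ∈ IntegrableMart Pt S g f := by
    intro μ hμ hfin
    have hp := isProbabilityMeasure_of_mem_martFam hμ
    have hInt : ∀ {u : (Fin T → Ω₁) → ℝ}, Measurable u →
        (∀ ω, ENNReal.ofReal |u ω| ≤ φ ω) → Integrable u μ := fun {u} hu hle =>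
      integrable_of_lintegral_ofReal_ne_top hu.aemeasurable
        (ne_top_of_le_ne_top hfin (lintegral_mono fun ω =>
          (ENNReal.ofReal_le_ofReal (le_abs_self _)).trans (hle ω)))
        (ne_top_of_le_ne_top hfin (lintegral_mono fun ω =>
          (ENNReal.ofReal_le_ofReal (neg_le_abs _)).trans (hle ω)))
    refine ⟨hp, exists_absolutelyContinuous_of_mem_martFam hμ,
      isMartMeas_of_mem_martFam hM.measurable hμ fun t h i => hInt (hSm t h i) fun ω => ?_,
      fun i => hInt (hg i) fun ω => ?_,
      ne_top_of_le_ne_top hfin (lintegral_mono fun ω => ?_)⟩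
    · let t' : Fin (T + 1) := ⟨t, Nat.lt_succ_of_le h⟩
      exact ((Finset.single_le_sum (f := fun i => ENNReal.ofReal |S t (restr Ω₁ t h ω) i|)
        (fun _ _ => zero_le) (Finset.mem_univ i)).trans
        (Finset.single_le_sum (f := fun t : Fin (T + 1) => ∑ i,
          ENNReal.ofReal |S t (restr Ω₁ t (Nat.lt_succ_iff.1 t.2) ω) i|)
          (fun _ _ => zero_le) (Finset.mem_univ t'))).trans le_add_self
    · exact (Finset.single_le_sum (f := fun i => ENNReal.ofReal |g i ω|)
        (fun _ _ => zero_le) (Finset.mem_univ i)).trans (le_self_add.trans le_self_add)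
    · rw [← zero_sub]
      exact le_add_self.trans le_self_add
  obtain ⟨⟨μ, hμ, hμφ⟩, h⟩ := exists_superhedge_of_upperSemianalytic hM hNA hF hφ hφt
  exact ⟨⟨μ, key μ hμ hμφ⟩, fun p hp => h p fun ν hν hνφ => hp ν (key ν hν hνφ)⟩

theorem noArb_of_NA (hS : ∀ t ≤ T, Measurable (S t)) (hg : ∀ i, Measurable (g i))
    (hNA : NA Ω₁ (MeasFam Ω₁ Pt T) S g) : NoArb Pt S T := by
  intro H hH hpos P hP
  have h := hNA H hH 0 ((quasiSure_iff (by
    simpa using measurableSet_univComp_le_hedge hS hH hg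
      (@measurable_const _ _ _ (univComp _) (0 : ℝ)) 0 0)).2 fun P hP =>
    (hpos P hP).mono fun ω hω => by simpa [gain_eq_gainR] using hω)
  exact (h.ae hP).mono fun ω hω => by simpa [gain_eq_gainR] using hω

/-- Absence of semistatic arbitrage passes to the attainable option means. -/
theorem optionMeans_no_arbitrage (hM : Market Pt S T) (hg : ∀ i, Measurable (g i))
    (hNA : NA Ω₁ (MeasFam Ω₁ Pt T) S g) (hf : UpperSemianalytic f) (h : Fin e → ℝ)
    (hpos : ∀ k ∈ optionMeans Pt S g f, 0 ≤ ∑ i, h i * k.1 i) :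
    ∀ k ∈ optionMeans Pt S g f, ∑ i, h i * k.1 i = 0 := by
  have hgm : Measurable fun ω => -∑ i, h i * g i ω := by fun_prop
  obtain ⟨H, hH, hle⟩ := (exists_superhedge_of_integrableMart hM
    (noArb_of_NA hM.measurable hg hNA) hg hf (UpperSemianalytic.of_measurable hgm)).2 0
    fun Q hQ => by
      refine ⟨(integrable_sum_mul hQ.2.2.2.1 h).neg, ?_⟩
      rw [integral_neg, integral_sum_mul hQ.2.2.2.1]
      have := hpos (fun i => ∫ ω, g i ω ∂Q, ∫ ω, min (f ω) (0 : ℕ) ∂Q)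
        ⟨Q, hQ, fun _ => rfl, 0, le_rfl⟩
      simpa using this
  have h0 := hNA H hH h ((quasiSure_iff (by
    simpa using measurableSet_univComp_le_hedge hM.measurable hH hg
      (@measurable_const _ _ _ (univComp _) (0 : ℝ)) 0 h)).2 fun P hP =>
    (hle P hP).mono fun ω hω => by rw [gain_eq_gainR]; linarith)
  rintro k ⟨Q, hQ, hk, -⟩
  obtain ⟨hp, ⟨P, hP, hQP⟩, hm, hgi, -⟩ := hQ
  have hae : ∀ᵐ ω ∂Q, gainR S H T ω = -∑ i, h i * g i ω :=
    hQP.ae_le ((h0.ae hP).mono fun ω hω => by rw [gain_eq_gainR] at hω; linarith)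
  have hsum := integrable_sum_mul hgi h
  obtain ⟨-, hz⟩ := gainR_integral_eq_zero hH hM.measurable hm (by
    rw [lintegral_congr_ae (hae.mono fun ω hω => congrArg (fun x => ENNReal.ofReal (-x)) hω)]
    simpa using lintegral_ofReal_ne_top hsum)
  rw [integral_congr_ae hae, integral_neg, neg_eq_zero, integral_sum_mul hgi] at hz
  simpa only [hk] using hz

theorem mem_QSet_of_integrableMart {Q : Measure (Fin T → Ω₁)} (hQ : Q ∈ IntegrableMart Pt S g f)
    (h0 : ∀ i, ∫ ω, g i ω ∂Q = 0) : Q ∈ QSet Ω₁ (MeasFam Ω₁ Pt T) S g :=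
  ⟨hQ.1, hQ.2.1, hQ.2.2.1, fun i => by
    rw [expec_of_integrable (hQ.2.2.2.1 i), h0, EReal.coe_zero]⟩

/-- Existence of a calibrated martingale measure and of an optimal semistatic superhedge. -/
theorem exists_semistatic_superhedge (hM : Market Pt S T) (hg : ∀ i, Measurable (g i))
    (hNA : NA Ω₁ (MeasFam Ω₁ Pt T) S g) (hf : UpperSemianalytic f) :
    (∃ Q ∈ QSet Ω₁ (MeasFam Ω₁ Pt T) S g, expec Q f ≠ ⊥) ∧ ∀ p : ℝ,
      (∀ Q ∈ QSet Ω₁ (MeasFam Ω₁ Pt T) S g, expec Q f ≤ p) →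
      ∃ H, ∃ h : Fin e → ℝ, Pred Ω₁ d H ∧ QuasiSure (MeasFam Ω₁ Pt T) (univComp (Fin T → Ω₁))
        (fun ω => f ω ≤ p + gain Ω₁ S H T le_rfl ω + ∑ i, h i * g i ω) := by
  have hNA' := noArb_of_NA hM.measurable hg hNA
  have hfm : ∀ Q ∈ IntegrableMart Pt S g f, AEMeasurable f Q := fun Q hQ => by
    have := hQ.1
    exact aemeasurable_of_measurable_univComp hf.measurable_univComp Q
  obtain ⟨Q₀, hQ₀⟩ := (exists_superhedge_of_integrableMart hM hNA' hg hf hf).1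
  obtain ⟨⟨r, Q, hQ, hQg, -⟩, hhedge⟩ := exists_hedge_of_no_arbitrage
    (convex_optionMeans (g := g) hM hf)
    ⟨(fun i => ∫ ω, g i ω ∂Q₀, ∫ ω, min (f ω) (0 : ℕ) ∂Q₀), Q₀, hQ₀, fun _ => rfl, 0, le_rfl⟩
    (optionMeans_no_arbitrage hM hg hNA hf)
  refine ⟨⟨Q, mem_QSet_of_integrableMart hQ hQg, expec_ne_bot hQ.2.2.2.2⟩, fun p hp => ?_⟩
  obtain ⟨h, hh⟩ := hhedge p (by
    rintro r ⟨Q, hQ, hQg, n, hn⟩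
    have := hQ.1
    have hle := hp Q (mem_QSet_of_integrableMart hQ hQg)
    have hfi := integrable_of_expec_le (hfm Q hQ) (expec_ne_bot hQ.2.2.2.2) hle
    rw [expec_of_integrable hfi] at hle
    refine hn.trans (le_trans ?_ (EReal.coe_le_coe_iff.1 hle))
    exact integral_mono (integrable_min_natCast (hfm Q hQ) hQ.2.2.2.2 n) hfi
      fun ω => min_le_left _ _)
  have hgm : Measurable fun ω => ∑ i, h i * g i ω := by fun_prop
  obtain ⟨H, hH, hle⟩ := (exists_superhedge_of_integrableMart hM hNA' hg hf
    (hf.add_measurable hgm)).2 p fun Q hQ => by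
      have := hQ.1
      have hsum := integrable_sum_mul hQ.2.2.2.1 h
      obtain ⟨hfi, hfle⟩ := integrable_of_integral_min_le (hfm Q hQ) hQ.2.2.2.2
        (c := p - ∑ i, h i * ∫ ω, g i ω ∂Q) fun n => by
          have := hh (fun i => ∫ ω, g i ω ∂Q, ∫ ω, min (f ω) n ∂Q) ⟨Q, hQ, fun _ => rfl, n, le_rfl⟩
          simp only at this
          linarith
      refine ⟨hfi.add hsum, ?_⟩
      rw [integral_add hfi hsum, integral_sum_mul hQ.2.2.2.1]
      linarith
  refine ⟨H, -h, hH, (quasiSure_iff (measurableSet_univComp_le_hedge hM.measurable hH hg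
    hf.measurable_univComp p (-h))).2 fun P hP => (hle P hP).mono fun ω hω => ?_⟩
  simp only [gain_eq_gainR, Pi.neg_apply, neg_mul, Finset.sum_neg_distrib]
  linarith

end SemistaticDuality

end BN

open BN in
/-- **Superhedging Theorem** (nondominated, with options). Under `NA(𝒫)`, for upper
semianalytic `f`, the minimal superhedging price equals `sup_{Q ∈ 𝒬} E_Q[f]`, it is
`> -∞`, and an optimal semistatic superhedging strategy exists. -/
theorem superhedging_theorem
    (Ω₁ : Type) [MeasurableSpace Ω₁] [TopologicalSpace Ω₁] [PolishSpace Ω₁]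
    [BorelSpace Ω₁] [Nonempty Ω₁] (T d e : ℕ)
    (Pt : (t : ℕ) → (Fin t → Ω₁) → Set (ProbabilityMeasure Ω₁))
    (hPtne : ∀ t, t < T → ∀ ω, (Pt t ω).Nonempty)
    (hPtconv : ∀ t, t < T → ∀ ω, ConvexPM (Pt t ω))
    (hPtgraph : ∀ t, t < T →
      AnalyticSet {p : (Fin t → Ω₁) × ProbabilityMeasure Ω₁ | p.2 ∈ Pt t p.1})
    (S : (t : ℕ) → (Fin t → Ω₁) → Fin d → ℝ) (hS : ∀ t, t ≤ T → Measurable (S t))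
    (g : Fin e → (Fin T → Ω₁) → ℝ) (hg : ∀ i, Measurable (g i))
    (hNA : NA Ω₁ (MeasFam Ω₁ Pt T) S g)
    (f : (Fin T → Ω₁) → ℝ) (hf : UpperSemianalytic f) :
    superPrice Ω₁ (MeasFam Ω₁ Pt T) S g f
        = sSup ((fun Q => expec Q f) '' QSet Ω₁ (MeasFam Ω₁ Pt T) S g) ∧
    superPrice Ω₁ (MeasFam Ω₁ Pt T) S g f ≠ ⊥ ∧
    ∃ H : (u : ℕ) → (Fin u → Ω₁) → Fin d → ℝ, ∃ h : Fin e → ℝ, Pred Ω₁ d H ∧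
      QuasiSure (MeasFam Ω₁ Pt T) (univComp (Fin T → Ω₁)) (fun ω =>
        (f ω : EReal) ≤ superPrice Ω₁ (MeasFam Ω₁ Pt T) S g f
          + ((gain Ω₁ S H T le_rfl ω + ∑ i, h i * g i ω : ℝ) : EReal)) := by
  obtain ⟨⟨Q, hQ, hQf⟩, hhedge⟩ :=
    exists_semistatic_superhedge ⟨hPtne, hPtconv, hPtgraph, hS⟩ hg hNA hf
  have hweak : sSup ((fun Q => expec Q f) '' QSet Ω₁ (MeasFam Ω₁ Pt T) S g)
      ≤ superPrice Ω₁ (MeasFam Ω₁ Pt T) S g f := by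
    refine sSup_le ?_
    rintro _ ⟨Q, hQ, rfl⟩
    refine le_sInf ?_
    rintro _ ⟨x, ⟨H, h, hH, hle⟩, rfl⟩
    exact expec_le_of_superhedge hS hg hf hQ hH hle
  have hQle := le_sSup (mem_image_of_mem (fun Q => expec Q f) hQ)
  have hsup : sSup ((fun Q => expec Q f) '' QSet Ω₁ (MeasFam Ω₁ Pt T) S g) ≠ ⊥ := fun h =>
    hQf (le_bot_iff.1 (h ▸ hQle))
  generalize hs : sSup ((fun Q => expec Q f) '' QSet Ω₁ (MeasFam Ω₁ Pt T) S g) = s at *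
  induction s with
  | bot => exact absurd rfl hsup
  | top =>
    rw [top_le_iff.1 hweak]
    refine ⟨rfl, top_ne_bot, fun _ _ => 0, 0, pred_zero, ∅, MeasurableSpace.measurableSet_empty _,
      fun ω hω => ?_, fun P _ => measure_empty⟩
    exact hω (le_top.trans_eq (EReal.top_add_coe _).symm)
  | coe p =>
    obtain ⟨H, h, hH, hle⟩ := hhedge p fun Q hQ => hs ▸
      le_sSup (mem_image_of_mem (fun Q => expec Q f) hQ)
    have hprice : superPrice Ω₁ (MeasFam Ω₁ Pt T) S g f = p :=
      le_antisymm (sInf_le ⟨p, ⟨H, h, hH, hle⟩, rfl⟩) hweak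
    rw [hprice]
    refine ⟨rfl, EReal.coe_ne_bot p, H, h, hH, ?_⟩
    simpa only [← EReal.coe_add, EReal.coe_le_coe_iff, ← add_assoc] using hle
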